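/- Let γ ∈ (71/72, 1], c = 1/γ, h ∈ F_c, φ the inverse of h, N prime, W ∈ [1/8 · log log N, 1/2 · log log N] an integer, m = ∏_{p ∈ P, p ≤ W} p, 0 ≤ b ≤ m − 1 with gcd(b, m) = 1, and let A ⊆ {1, ..., ⌊N/2⌋} contain no nontrivial three-term arithmetic progression when considered as a subset of ℤ_N. Define a(x) = 1_A(x) λ^h_{b,m,N}(x) on ℤ_N, and for δ, ε ∈ (0,1) set R = {ξ ∈ ℤ_N : |F_{ℤ_N}[a](ξ)| ≥ δ}, B = {x ∈ ℤ_N : ‖xξ/N‖ ≤ ε for all ξ ∈ R}, β = |B|^{−1} 1_B, and a₁ = a * β * β. Then for any r ∈ ((26 − 24γ)/(16γ − 15), 3), with r' the conjugate exponent of r, there is a constant C₁ > 0 such that Λ₃(a₁, a₁, a₁) ≤ C₁ N^{−3/2} + C₁ N^{−1} (ε² δ^{−r} + δ^{2 − r/r'}). -/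

import Mathlib

open Filter Real Set
open scoped Classical

structure Fc (c : ℝ) where
  x₀ : ℝ
  one_le_x₀ : 1 ≤ x₀
  toFun : ℝ → ℝ
  vth : ℝ → ℝ
  Ch : ℝ
  Ch_pos : 0 < Ch
  one_le : ∀ x ≥ x₀, 1 ≤ toFun x
  contDiffOn : ContDiffOn ℝ 3 toFun (Set.Ici x₀)
  deriv_pos : ∀ x ≥ x₀, 0 < deriv toFun x
  deriv2_pos : ∀ x ≥ x₀, 0 < iteratedDeriv 2 toFun x
  vth_contDiffOn : ContDiffOn ℝ 2 vth (Set.Ici x₀)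
  eqn : ∀ x ≥ x₀, toFun x = Ch * x ^ c * Real.exp (∫ t in x₀..x, vth t / t)
  cond_gt : 1 < c →
    Filter.Tendsto vth Filter.atTop (nhds 0) ∧
    Filter.Tendsto (fun x => x * deriv vth x) Filter.atTop (nhds 0) ∧
    Filter.Tendsto (fun x => x ^ 2 * deriv (deriv vth) x) Filter.atTop (nhds 0)
  cond_eq : c = 1 →
    (∀ x ≥ x₀, 0 < vth x) ∧
    (∀ x y, x₀ ≤ x → x ≤ y → vth y ≤ vth x) ∧
    (∀ ε : ℝ, 0 < ε → ∃ C > 0, ∀ x ≥ x₀, 1 / vth x ≤ C * x ^ ε) ∧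
    Filter.Tendsto (fun x => x / toFun x) Filter.atTop (nhds 0) ∧
    Filter.Tendsto vth Filter.atTop (nhds 0) ∧
    Filter.Tendsto (fun x => x * deriv vth x / vth x) Filter.atTop (nhds 0) ∧
    Filter.Tendsto (fun x => x ^ 2 * deriv (deriv vth) x / vth x) Filter.atTop (nhds 0)

def Ph {c : ℝ} (F : Fc c) : Set ℕ :=
  {p : ℕ | p.Prime ∧ ∃ n : ℕ, F.x₀ ≤ (n : ℝ) ∧ (p : ℤ) = ⌊F.toFun n⌋}

noncomputable def e (t : ℝ) : ℂ := Complex.exp (2 * Real.pi * Complex.I * t)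

/-- The measure `λ^h_{b,m,N}` on `Λ^h_{b,m,N} = {0 ≤ n ≤ N : mn + b ∈ P_h}`:
`λ^h_{b,m,N}(n) = ϕ(m) log(mn+b) / (m N φ'(mn+b))` there and `0` otherwise. -/
noncomputable def lamh {c : ℝ} (F : Fc c) (φ : ℝ → ℝ) (b m N n : ℕ) : ℝ :=
  if n ≤ N ∧ m * n + b ∈ Ph F then
    (Nat.totient m : ℝ) * Real.log (m * n + b) / (m * N * deriv φ ((m * n + b : ℕ) : ℝ))
  else 0

/-- The Fourier transform on `ℤ_N` of a real-valued function (regarded on `{0, …, N-1}`):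
`F_{ℤ_N}[f](ξ) = ∑_{x ∈ ℤ_N} f(x) e^{-2πiξx/N}`. -/
noncomputable def fourierZN (N : ℕ) (f : ℕ → ℝ) (ξ : ℕ) : ℂ :=
  ∑ n ∈ Finset.range N, (f n : ℂ) * e (-((ξ : ℝ) * n / N))

/-- Convolution on `ℤ_N` (with `{0, …, N-1}` as a set of representatives):
`(f * g)(x) = ∑_{y ∈ ℤ_N} f(x - y) g(y)`. -/
noncomputable def convZN (N : ℕ) (f g : ℕ → ℝ) (x : ℕ) : ℝ :=
  ∑ y ∈ Finset.range N, f ((x + (N - y)) % N) * g y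

/-- The distance of `t ∈ ℝ` to the nearest integer. -/
noncomputable def nint (t : ℝ) : ℝ := |t - round t|

/-- The trilinear form `Λ₃(f, g, h) = ∑_{x, d ∈ ℤ_N} f(x) g(x+d) h(x+2d)` on `ℤ_N`. -/
noncomputable def lam3 (N : ℕ) (f g h : ℕ → ℝ) : ℝ :=
  ∑ x ∈ Finset.range N, ∑ d ∈ Finset.range N,
    f x * g ((x + d) % N) * h ((x + 2 * d) % N)

namespace PS

lemma e_add (s t : ℝ) : e (s + t) = e s * e t := by
  unfold e; rw [← Complex.exp_add]; congr 1; push_cast; ring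

lemma e_zero : e 0 = 1 := by simp [e]

lemma norm_e (t : ℝ) : ‖e t‖ = 1 := by
  have : e t = Complex.exp ((2 * Real.pi * t : ℝ) * Complex.I) := by
    unfold e; congr 1; push_cast; ring
  rw [this, Complex.norm_exp_ofReal_mul_I]

lemma e_int (k : ℤ) : e k = 1 := by
  unfold e
  rw [Complex.exp_eq_one_iff]
  exact ⟨k, by push_cast; ring⟩

lemma e_add_int (t : ℝ) (k : ℤ) : e (t + k) = e t := by rw [e_add, e_int, mul_one]

lemma e_nat_mul (n : ℕ) (t : ℝ) : e (n * t) = e t ^ n := by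
  unfold e; rw [← Complex.exp_nat_mul]; congr 1; push_cast; ring

lemma e_neg (t : ℝ) : e (-t) = (starRingEnd ℂ) (e t) := by
  unfold e; rw [← Complex.exp_conj]; congr 1
  simp only [map_mul, Complex.conj_ofReal, Complex.conj_I, Complex.conj_ofNat]
  push_cast; ring

lemma e_re (t : ℝ) : (e t).re = Real.cos (2 * Real.pi * t) := by
  have : e t = Complex.exp ((2 * Real.pi * t : ℝ) * Complex.I) := by
    unfold e; congr 1; push_cast; ring
  rw [this, Complex.exp_ofReal_mul_I_re]

lemma e_im (t : ℝ) : (e t).im = Real.sin (2 * Real.pi * t) := by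
  have : e t = Complex.exp ((2 * Real.pi * t : ℝ) * Complex.I) := by
    unfold e; congr 1; push_cast; ring
  rw [this, Complex.exp_ofReal_mul_I_im]

lemma norm_e_sub_one (t : ℝ) : ‖e t - 1‖ = 2 * |Real.sin (Real.pi * t)| := by
  have : e t = Complex.exp (Complex.I * (2 * Real.pi * t : ℝ)) := by
    unfold e; congr 1; push_cast; ring
  rw [this, Complex.norm_exp_I_mul_ofReal_sub_one]
  rw [Real.norm_eq_abs, abs_mul]
  norm_num
  congr 2; ring

lemma norm_e_sub_one_le (t : ℝ) : ‖e t - 1‖ ≤ 2 * Real.pi * |t| := by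
  rw [norm_e_sub_one]
  have : |Real.sin (Real.pi * t)| ≤ |Real.pi * t| := Real.abs_sin_le_abs
  rw [abs_mul, abs_of_pos Real.pi_pos] at this
  nlinarith

lemma norm_e_sub_e_le (s t : ℝ) : ‖e s - e t‖ ≤ 2 * Real.pi * |s - t| := by
  have : e s - e t = e t * (e (s - t) - 1) := by
    rw [mul_sub, ← e_add]; ring_nf
  rw [this, norm_mul, norm_e, one_mul]
  exact norm_e_sub_one_le _

lemma e_sub_round (t : ℝ) : e (t - round t) = e t := by
  have := e_add_int t (-(round t))
  push_cast at this
  rw [sub_eq_add_neg, this]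

lemma nint_le_half (t : ℝ) : nint t ≤ 1 / 2 := abs_sub_round t

lemma nint_nonneg (t : ℝ) : 0 ≤ nint t := abs_nonneg _

lemma four_nint_le (t : ℝ) : 4 * nint t ≤ ‖e t - 1‖ := by
  rw [← e_sub_round, norm_e_sub_one]
  have h := nint_le_half t
  unfold nint at *
  set u := t - round t
  have h2 : |Real.sin (Real.pi * u)| = Real.sin (Real.pi * |u|) := by
    rcases abs_cases u with ⟨h1, h3⟩ | ⟨h1, h3⟩
    · rw [h1, abs_of_nonneg]
      apply Real.sin_nonneg_of_nonneg_of_le_pi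
      · positivity
      · nlinarith [Real.pi_pos]
    · rw [h1, mul_neg, Real.sin_neg, abs_of_nonpos]
      apply Real.sin_nonpos_of_nonpos_of_neg_pi_le
      · nlinarith [Real.pi_pos]
      · nlinarith [Real.pi_pos]
  rw [h2]
  have := Real.mul_le_sin (x := Real.pi * |u|) (by positivity) (by nlinarith [Real.pi_pos])
  have h3 : 2 / Real.pi * (Real.pi * |u|) = 2 * |u| := by
    field_simp
  linarith

/-- geometric sum bound -/
lemma geom_bound (L : ℕ) (α Δ : ℝ) (hΔ : 0 < Δ) (h : Δ ≤ nint α) :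
    ‖∑ l ∈ Finset.range L, e (l * α)‖ ≤ 1 / Δ := by
  have h1 := four_nint_le α
  have hne : e α ≠ 1 := by
    intro h0
    rw [h0] at h1; simp at h1; linarith
  have : ∑ l ∈ Finset.range L, e (l * α) = (e α ^ L - 1) / (e α - 1) := by
    rw [← geom_sum_eq hne]
    exact Finset.sum_congr rfl (fun l _ => e_nat_mul l α)
  rw [this, norm_div]
  have h2 : ‖e α ^ L - 1‖ ≤ 2 := by
    calc _ ≤ ‖e α ^ L‖ + ‖(1:ℂ)‖ := norm_sub_le _ _
      _ = 2 := by rw [norm_pow, norm_e]; norm_num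
  rw [div_le_div_iff₀ (by linarith) hΔ]
  nlinarith

lemma norm_sum_e_le {ι : Type*} (s : Finset ι) (f : ι → ℝ) : ‖∑ i ∈ s, e (f i)‖ ≤ s.card := by
  refine (norm_sum_le _ _).trans ?_
  simp [norm_e]

/-- distance to nearest integer is at most the distance to any integer -/
lemma nint_le (t : ℝ) (k : ℤ) : nint t ≤ |t - k| := round_le t k

lemma nint_add_int (t : ℝ) (k : ℤ) : nint (t + k) = nint t := by
  unfold nint; rw [round_add_intCast]; push_cast; congr 1; ring

lemma nint_sub_int (t : ℝ) (k : ℤ) : nint (t - k) = nint t := by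
  have := nint_add_int t (-k); push_cast at this; rwa [← sub_eq_add_neg] at this

lemma nint_neg (t : ℝ) : nint (-t) = nint t := by
  apply le_antisymm
  · have := nint_le (-t) (-(round t)); push_cast at this
    refine this.trans (le_of_eq ?_); unfold nint; rw [← abs_neg]; congr 1; ring
  · have := nint_le t (-(round (-t))); push_cast at this
    refine this.trans (le_of_eq ?_); unfold nint; rw [← abs_neg]; congr 1; ring

lemma nint_add_le (s t : ℝ) : nint (s + t) ≤ nint s + nint t := by
  have := nint_le (s + t) (round s + round t)
  refine this.trans ?_
  unfold nint
  push_cast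
  calc |s + t - (↑(round s) + ↑(round t))| = |(s - round s) + (t - round t)| := by congr 1; ring
    _ ≤ _ := abs_add_le _ _

end PS

namespace PS

section Zm
variable {N : ℕ} [NeZero N]

lemma chi_natCast (n : ℕ) : ZMod.stdAddChar (N := N) (n : ZMod N) = e ((n : ℝ) / N) := by
  have := ZMod.stdAddChar_coe (N := N) (n : ℤ)
  push_cast at this
  rw [this]; unfold e; congr 1; push_cast; ring

lemma chi_eq (x : ZMod N) : ZMod.stdAddChar x = e ((x.val : ℝ) / N) := by
  rw [← chi_natCast, ZMod.natCast_zmod_val]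

lemma chi_neg (x : ZMod N) : ZMod.stdAddChar (-x) = (starRingEnd ℂ) (ZMod.stdAddChar x) := by
  rw [AddChar.map_neg_eq_inv, chi_eq, ← e_neg]
  have : e (-((x.val : ℝ) / N)) * e ((x.val : ℝ) / N) = 1 := by rw [← e_add]; simp [e_zero]
  exact inv_eq_of_mul_eq_one_left this

lemma norm_chi (x : ZMod N) : ‖ZMod.stdAddChar x‖ = 1 := by rw [chi_eq, norm_e]

lemma sum_range_zmod {M : Type*} [AddCommMonoid M] (f : ℕ → M) :
    ∑ n ∈ Finset.range N, f n = ∑ x : ZMod N, f x.val := by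
  refine Finset.sum_nbij' (fun n => (n : ZMod N)) ZMod.val ?_ ?_ ?_ ?_ ?_
  · intros; simp
  · intro x _; simpa using ZMod.val_lt x
  · intro n hn; exact ZMod.val_cast_of_lt (by simpa using hn)
  · intro x _; simp
  · intro n hn; rw [ZMod.val_cast_of_lt (by simpa using hn)]

/-- Fourier transform on `ZMod N` -/
noncomputable def FT (f : ZMod N → ℂ) (k : ZMod N) : ℂ :=
  ∑ x, f x * ZMod.stdAddChar (-(x * k))

lemma fourierZN_eq (f : ℕ → ℝ) (ξ : ℕ) :
    fourierZN N f ξ = FT (fun x : ZMod N => (f x.val : ℂ)) ξ := by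
  unfold fourierZN FT
  rw [sum_range_zmod]
  refine Finset.sum_congr rfl fun x _ => ?_
  congr 1
  rw [chi_neg, e_neg]
  congr 1
  have : x * (ξ : ZMod N) = ((x.val * ξ : ℕ) : ZMod N) := by simp
  rw [this, chi_natCast]; congr 1; push_cast; ring

lemma chi_sum (b : ZMod N) : ∑ x : ZMod N, ZMod.stdAddChar (x * b) = if b = 0 then (N : ℂ) else 0 := by
  have := AddChar.sum_mulShift b (ZMod.isPrimitive_stdAddChar N)
  simpa [ZMod.card] using this

lemma triple (f : ZMod N → ℂ) :
    ∑ k, FT f k ^ 2 * FT f (-2 * k) =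
      N * ∑ x, ∑ d, f x * f (x + d) * f (x + 2 * d) := by
  have h1 : ∀ k, FT f k ^ 2 * FT f (-2 * k) =
      ∑ x, ∑ y, ∑ z, f x * f y * f z * ZMod.stdAddChar (k * (2 * y - x - z)) := by
    intro k
    rw [sq, mul_assoc, mul_comm (FT f k) (FT f (-2*k))]
    unfold FT
    rw [Finset.sum_mul_sum, Finset.sum_mul_sum]
    refine Finset.sum_congr rfl fun x _ => ?_
    simp_rw [Finset.mul_sum]
    rw [← Finset.sum_congr rfl fun y _ => rfl]
    refine Finset.sum_congr rfl fun y _ => ?_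
    refine Finset.sum_congr rfl fun z _ => ?_
    have : k * (2 * y - x - z) = -(x * k) + (-(y * (-2 * k)) + -(z * k)) := by ring
    rw [this, AddChar.map_add_eq_mul, AddChar.map_add_eq_mul]
    ring
  simp_rw [h1]
  rw [Finset.sum_comm, Finset.mul_sum]
  refine Finset.sum_congr rfl fun x _ => ?_
  rw [Finset.sum_comm, Finset.mul_sum]
  rw [← Equiv.sum_comp (Equiv.addLeft x)]
  refine Finset.sum_congr rfl fun d _ => ?_
  rw [Finset.sum_comm]
  simp_rw [← Finset.mul_sum, chi_sum]
  simp only [Equiv.coe_addLeft]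
  have h2 : ∀ z : ZMod N, (2 * (x + d) - x - z = 0) ↔ z = x + 2 * d := by
    intro z
    constructor
    · intro h; linear_combination -h
    · rintro rfl; ring
  simp_rw [h2]
  simp only [mul_ite, mul_zero, Finset.sum_ite_eq', Finset.mem_univ, if_true]
  ring

lemma FT_conv (f g : ZMod N → ℂ) (k : ZMod N) :
    FT (fun x => ∑ y, f (x - y) * g y) k = FT f k * FT g k := by
  unfold FT
  rw [Finset.sum_mul_sum]
  simp_rw [Finset.sum_mul]
  rw [Finset.sum_comm]
  rw [Finset.sum_comm (s := Finset.univ) (t := Finset.univ) (f := fun i j => f i * _ * (g j * _))]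
  refine Finset.sum_congr rfl fun y _ => ?_
  rw [← Equiv.sum_comp (Equiv.addRight y)]
  refine Finset.sum_congr rfl fun x _ => ?_
  simp only [Equiv.coe_addRight, add_sub_cancel_right]
  have : -((x + y) * k) = -(x * k) + -(y * k) := by ring
  rw [this, AddChar.map_add_eq_mul]; ring

lemma convZN_eq (f g : ℕ → ℝ) (x : ZMod N) :
    (convZN N f g x.val : ℂ) = ∑ y : ZMod N, (f (x - y).val : ℂ) * g y.val := by
  unfold convZN
  rw [sum_range_zmod]
  push_cast
  refine Finset.sum_congr rfl fun y _ => ?_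
  congr 3
  have : (x - y : ZMod N) = ((x.val + (N - y.val) : ℕ) : ZMod N) := by
    rw [Nat.cast_add, Nat.cast_sub (ZMod.val_lt y).le]; simp [sub_eq_add_neg]
  rw [this, ZMod.val_natCast]

lemma lam3_eq (f : ℕ → ℝ) :
    (lam3 N f f f : ℂ) = ∑ x : ZMod N, ∑ d : ZMod N,
      (f x.val : ℂ) * f (x + d).val * f (x + 2 * d).val := by
  unfold lam3
  rw [sum_range_zmod]
  push_cast
  refine Finset.sum_congr rfl fun x _ => ?_
  have := sum_range_zmod (N := N) (fun d => (f x.val : ℂ) * f ((x.val + d) % N) * f ((x.val + 2 * d) % N))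
  rw [this]
  refine Finset.sum_congr rfl fun d _ => ?_
  have h1 : (x + d : ZMod N) = ((x.val + d.val : ℕ) : ZMod N) := by simp
  have h2 : (x + 2 * d : ZMod N) = ((x.val + 2 * d.val : ℕ) : ZMod N) := by simp
  rw [h1, h2, ZMod.val_natCast, ZMod.val_natCast]

lemma norm_chi_sub_one_le (x k : ZMod N) :
    ‖ZMod.stdAddChar (x * k) - 1‖ ≤ 2 * Real.pi * nint ((x.val : ℝ) * k.val / N) := by
  have : x * k = ((x.val * k.val : ℕ) : ZMod N) := by simp
  rw [this, chi_natCast]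
  have h := norm_e_sub_one_le ((x.val : ℝ) * k.val / N - round ((x.val : ℝ) * k.val / N))
  rw [e_sub_round] at h
  push_cast
  exact h

lemma pow_bound (z w : ℂ) (hz : ‖z‖ ≤ 1) (hw : ‖w‖ ≤ 1) :
    ‖z ^ 4 * w ^ 2 - 1‖ ≤ 4 * ‖z - 1‖ + 2 * ‖w - 1‖ := by
  have h : z ^ 4 * w ^ 2 - 1 = z^4 * (w + 1) * (w - 1) + (z^3 + z^2 + z + 1) * (z - 1) := by ring
  rw [h]
  have a1 : ‖z^4 * (w + 1)‖ ≤ 2 := by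
    rw [norm_mul, norm_pow]
    calc ‖z‖^4 * ‖w+1‖ ≤ 1 * 2 := by
          gcongr
          · exact pow_le_one₀ (norm_nonneg _) hz
          · refine (norm_add_le _ _).trans ?_
            rw [norm_one]; linarith
      _ = 2 := by norm_num
  have a2 : ‖z^3 + z^2 + z + 1‖ ≤ 4 := by
    calc ‖z^3 + z^2 + z + 1‖ ≤ ‖z^3‖ + ‖z^2‖ + ‖z‖ + ‖(1:ℂ)‖ := by
          refine (norm_add_le _ _).trans ?_
          gcongr
          refine (norm_add_le _ _).trans ?_
          gcongr
          exact norm_add_le _ _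
      _ ≤ 1 + 1 + 1 + 1 := by
          rw [norm_pow, norm_pow, norm_one]
          gcongr
          · exact pow_le_one₀ (norm_nonneg _) hz
          · exact pow_le_one₀ (norm_nonneg _) hz
      _ = 4 := by norm_num
  refine (norm_add_le _ _).trans ?_
  rw [norm_mul (z^4 * (w + 1)), norm_mul (z^3 + z^2 + z + 1)]
  nlinarith [norm_nonneg (w - 1), norm_nonneg (z - 1), mul_le_mul_of_nonneg_right a1 (norm_nonneg (w - 1)), mul_le_mul_of_nonneg_right a2 (norm_nonneg (z - 1))]

lemma bohr_bound (S : Finset (ZMod N)) (hne : S.Nonempty) (hsym : ∀ x ∈ S, -x ∈ S) (k : ZMod N)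
    (η : ℝ) (h : ∀ x ∈ S, ‖ZMod.stdAddChar (x * k) - 1‖ ≤ η) :
    ‖FT (fun x => if x ∈ S then ((S.card : ℂ))⁻¹ else 0) k - 1‖ ≤ η ^ 2 / 2 := by
  have hc : (0:ℝ) < S.card := by exact_mod_cast hne.card_pos
  have hc' : (S.card : ℂ) ≠ 0 := by exact_mod_cast hc.ne'
  have h1 : FT (fun x => if x ∈ S then ((S.card : ℂ))⁻¹ else 0) k
      = (S.card : ℂ)⁻¹ * ∑ x ∈ S, ZMod.stdAddChar (-(x * k)) := by
    unfold FT
    simp_rw [ite_mul, zero_mul]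
    rw [Finset.sum_ite_mem, Finset.univ_inter, Finset.mul_sum]
  have h2 : ∑ x ∈ S, ZMod.stdAddChar (-(x * k)) = ∑ x ∈ S, ZMod.stdAddChar (x * k) := by
    refine Finset.sum_nbij' (fun x => -x) (fun x => -x) hsym hsym ?_ ?_ ?_ <;> simp
  have h3 : ∑ x ∈ S, ZMod.stdAddChar (-(x * k)) =
      ∑ x ∈ S, (((ZMod.stdAddChar (x * k) : ℂ).re : ℝ) : ℂ) := by
    have : (2:ℂ) * ∑ x ∈ S, ZMod.stdAddChar (-(x * k)) = 2 * ∑ x ∈ S, (((ZMod.stdAddChar (x * k) : ℂ).re : ℝ) : ℂ) := by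
      rw [two_mul]; nth_rewrite 2 [h2]
      rw [← Finset.sum_add_distrib, Finset.mul_sum]
      refine Finset.sum_congr rfl fun x _ => ?_
      rw [chi_neg, add_comm, Complex.add_conj]; push_cast; ring
    exact mul_left_cancel₀ two_ne_zero this
  rw [h1, h3]
  have h4 : (S.card : ℂ)⁻¹ * ∑ x ∈ S, (((ZMod.stdAddChar (x * k) : ℂ).re : ℝ) : ℂ) - 1
     = (S.card : ℂ)⁻¹ * ∑ x ∈ S, (((ZMod.stdAddChar (x * k) : ℂ).re - 1 : ℝ) : ℂ) := by
    push_cast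
    rw [Finset.sum_sub_distrib, mul_sub]
    simp [hc']
  rw [h4, norm_mul, norm_inv, Complex.norm_natCast]
  have h5 : ‖∑ x ∈ S, (((ZMod.stdAddChar (x * k) : ℂ).re - 1 : ℝ) : ℂ)‖ ≤ S.card * (η^2/2) := by
    refine (norm_sum_le _ _).trans ?_
    rw [← nsmul_eq_mul]
    refine Finset.sum_le_card_nsmul _ _ _ fun x hx => ?_
    have hx' := h x hx
    have hn := norm_chi (x * k)
    set z := (ZMod.stdAddChar (x * k) : ℂ)
    have h6 : ‖z - 1‖^2 = 2 - 2 * z.re := by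
      rw [← Complex.normSq_eq_norm_sq, Complex.normSq_apply]
      have : ‖z‖^2 = 1 := by rw [hn]; norm_num
      rw [← Complex.normSq_eq_norm_sq, Complex.normSq_apply] at this
      simp
      nlinarith
    rw [Complex.norm_real, Real.norm_eq_abs, abs_le]
    have : ‖z-1‖^2 ≤ η^2 := by gcongr
    constructor <;> nlinarith [sq_nonneg ‖z-1‖]
  rw [inv_mul_le_iff₀ hc]
  exact h5

lemma norm_FT_beta (S : Finset (ZMod N)) (hne : S.Nonempty) (k : ZMod N) :
    ‖FT (fun x => if x ∈ S then ((S.card : ℂ))⁻¹ else 0) k‖ ≤ 1 := by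
  have hc : (0:ℝ) < S.card := by exact_mod_cast hne.card_pos
  unfold FT
  simp_rw [ite_mul, zero_mul]
  rw [Finset.sum_ite_mem, Finset.univ_inter]
  refine (norm_sum_le _ _).trans ?_
  simp_rw [norm_mul, norm_chi, norm_inv, Complex.norm_natCast]
  simp [hc.ne']

end Zm
end PS

namespace PS

lemma reduction (N : ℕ) (hN : N.Prime) (hN2 : N ≠ 2) (r C M : ℝ) (hr2 : 2 < r) (hr3 : r < 3)
    (hC : 1 ≤ C) (hM : 0 ≤ M) (A : Finset ℕ)
    (hAP : ¬ ∃ a ∈ A, ∃ d : ℕ, d < N ∧ d ≠ 0 ∧ (a + d) % N ∈ A ∧ (a + 2 * d) % N ∈ A)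
    (δ ε : ℝ) (hδ : δ ∈ Set.Ioo (0 : ℝ) 1) (hε : ε ∈ Set.Ioo (0 : ℝ) 1)
    (a : ℕ → ℝ) (haA : ∀ n, n ∉ A → a n = 0) (haM : ∀ n < N, |a n| ≤ M)
    (hF : ∑ ξ ∈ Finset.range N, ‖fourierZN N a ξ‖ ^ r ≤ C)
    (R : Finset ℕ) (hR : R = (Finset.range N).filter (fun ξ => δ ≤ ‖fourierZN N a ξ‖))
    (B : Finset ℕ)
    (hB : B = (Finset.range N).filter (fun x : ℕ => ∀ ξ ∈ R, nint ((x : ℝ) * ξ / N) ≤ ε))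
    (β : ℕ → ℝ) (hβ : ∀ n, β n = if n ∈ B then ((B.card : ℝ))⁻¹ else 0)
    (a₁ : ℕ → ℝ) (ha₁ : ∀ n, a₁ n = convZN N (convZN N a β) β n) :
    lam3 N a₁ a₁ a₁ ≤ N * M ^ 3
        + (N : ℝ)⁻¹ * (240 * C ^ 4 * (ε ^ 2 * δ ^ (-r)) + 4 * C * δ ^ (3 - r)) := by
  have : Fact N.Prime := ⟨hN⟩
  obtain ⟨hδ0, hδ1⟩ := hδ
  obtain ⟨hε0, hε1⟩ := hε
  set f : ZMod N → ℂ := fun x => (a x.val : ℂ) with hf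
  set S : Finset (ZMod N) := Finset.univ.filter (fun x => x.val ∈ B) with hS
  have hcard : S.card = B.card := by
    refine Finset.card_nbij' ZMod.val (fun n => (n : ZMod N)) ?_ ?_ ?_ ?_
    · intro x hx; simpa [hS] using hx
    · intro n hn
      have hlt : n < N := by
        rw [hB] at hn; simp at hn; exact hn.1
      simp [hS, ZMod.val_cast_of_lt hlt]; exact hn
    · intro x _; simp
    · intro n hn
      have hlt : n < N := by
        rw [hB] at hn; simp at hn; exact hn.1
      exact ZMod.val_cast_of_lt hlt
  set b : ZMod N → ℂ := fun x => if x ∈ S then ((S.card : ℂ))⁻¹ else 0 with hb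
  have hbβ : ∀ x : ZMod N, (β x.val : ℂ) = b x := by
    intro x
    rw [hβ, hb]; simp only [hS, Finset.mem_filter, Finset.mem_univ, true_and]
    rw [← hS, hcard]
    split_ifs <;> simp
  -- membership
  have hmemR : ∀ k : ZMod N, k.val ∈ R ↔ δ ≤ ‖FT f k‖ := by
    intro k
    rw [hR]; simp only [Finset.mem_filter, Finset.mem_range, ZMod.val_lt, true_and]
    rw [fourierZN_eq, ZMod.natCast_zmod_val]
  have hmemS : ∀ x : ZMod N, x ∈ S ↔ ∀ k : ZMod N, δ ≤ ‖FT f k‖ → nint ((x.val : ℝ) * k.val / N) ≤ ε := by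
    intro x
    simp only [hS, Finset.mem_filter, Finset.mem_univ, true_and]
    rw [hB]; simp only [Finset.mem_filter, Finset.mem_range, ZMod.val_lt, true_and]
    constructor
    · intro h k hk; exact h _ ((hmemR k).2 hk)
    · intro h ξ hξ
      have hlt : ξ < N := by rw [hR] at hξ; simp at hξ; exact hξ.1
      have := h (ξ : ZMod N) ((hmemR _).1 (by rwa [ZMod.val_cast_of_lt hlt]))
      rwa [ZMod.val_cast_of_lt hlt] at this
  have h0S : (0 : ZMod N) ∈ S := by
    rw [hmemS]; intro k _; simp [nint]; exact hε0.le
  have hne : S.Nonempty := ⟨0, h0S⟩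
  have hNpos : (0:ℝ) < N := by exact_mod_cast hN.pos
  have hsym : ∀ x ∈ S, -x ∈ S := by
    intro x hx
    by_cases hx0 : x = 0
    · simpa [hx0] using h0S
    rw [hmemS] at hx ⊢
    intro k hk
    have h1 := hx k hk
    have : NeZero x := ⟨hx0⟩
    have : (((-x).val : ℕ) : ℝ) * k.val / N = -((x.val : ℝ) * k.val / N) + (k.val : ℤ) := by
      rw [ZMod.val_neg_of_ne_zero, Nat.cast_sub (ZMod.val_lt x).le]
      push_cast
      field_simp
      ring
    rw [this, nint_add_int, nint_neg]; exact h1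
  -- a₁
  have hFa1 : ∀ k : ZMod N, FT (fun x : ZMod N => (a₁ x.val : ℂ)) k = FT f k * FT b k ^ 2 := by
    intro k
    have h1 : (fun x : ZMod N => (a₁ x.val : ℂ)) =
        fun x => ∑ y, (fun x => ∑ y, f (x - y) * b y) (x - y) * b y := by
      funext x
      rw [ha₁, convZN_eq]
      refine Finset.sum_congr rfl fun y _ => ?_
      rw [hbβ, convZN_eq]
      congr 1
      refine Finset.sum_congr rfl fun z _ => ?_
      rw [hbβ]
    rw [h1, FT_conv (fun x => ∑ y, f (x - y) * b y) b, FT_conv]; ring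
  have hβ1 := norm_FT_beta S hne
  set F := FT f with hFdef
  set Bt := FT b with hBt
  -- main identity
  have key : (N : ℂ) * (lam3 N a₁ a₁ a₁ : ℂ) = N * (lam3 N a a a : ℂ) +
      ∑ k, F k ^ 2 * F (-2 * k) * (Bt k ^ 4 * Bt (-2 * k) ^ 2 - 1) := by
    rw [lam3_eq, lam3_eq, ← triple (fun x : ZMod N => (a₁ x.val : ℂ)), ← triple f, ← Finset.sum_add_distrib]
    refine Finset.sum_congr rfl fun k _ => ?_
    rw [hFa1, hFa1]; ring
  -- diag
  have hdiag : lam3 N a a a ≤ N * M ^ 3 := by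
    unfold lam3
    have : ∀ x ∈ Finset.range N, ∑ d ∈ Finset.range N, a x * a ((x + d) % N) * a ((x + 2 * d) % N) ≤ M ^ 3 := by
      intro x hx
      have hxN : x < N := by simpa using hx
      rw [Finset.sum_eq_single 0]
      · simp only [add_zero, mul_zero, Nat.mod_eq_of_lt hxN]
        calc a x * a x * a x ≤ |a x * a x * a x| := le_abs_self _
          _ = |a x| ^ 3 := by rw [abs_mul, abs_mul]; ring
          _ ≤ M ^ 3 := by gcongr; exact haM x hxN
      · intro d hd hd0
        by_contra hcon
        apply hAP
        refine ⟨x, ?_, d, by simpa using hd, hd0, ?_, ?_⟩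
        · by_contra h; exact hcon (by rw [haA _ h]; ring)
        · by_contra h; exact hcon (by rw [haA _ h]; ring)
        · by_contra h; exact hcon (by rw [haA _ h]; ring)
      · intro h; exact absurd (Finset.mem_range.2 hN.pos) h
    calc _ ≤ ∑ x ∈ Finset.range N, M ^ 3 := Finset.sum_le_sum this
      _ = _ := by simp
  -- Lr
  have hLr : ∑ k, ‖F k‖ ^ r ≤ C := by
    rw [sum_range_zmod] at hF
    convert hF using 2 with k
    rw [fourierZN_eq, ZMod.natCast_zmod_val]
  have hsup : ∀ k, ‖F k‖ ≤ C := by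
    intro k
    by_contra h
    push Not at h
    have h1 : ‖F k‖ ^ r ≤ C :=
      (Finset.single_le_sum (f := fun k => ‖F k‖ ^ r) (fun i _ => by positivity) (Finset.mem_univ k)).trans hLr
    have h2 : ‖F k‖ ^ (1:ℝ) ≤ ‖F k‖ ^ r := Real.rpow_le_rpow_of_exponent_le (by linarith) (by linarith)
    rw [Real.rpow_one] at h2
    linarith
  have h2ne : (-2 : ZMod N) ≠ 0 := by
    intro h
    have : ((2 : ℕ) : ZMod N) = 0 := by
      push_cast; linear_combination -h
    rw [ZMod.natCast_eq_zero_iff] at this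
    exact hN2 ((Nat.prime_dvd_prime_iff_eq hN Nat.prime_two).1 this)
  have hLr2 : ∑ k, ‖F (-2 * k)‖ ^ r ≤ C := by
    have := Equiv.sum_comp (Equiv.mulLeft₀ (-2 : ZMod N) h2ne) (fun k => ‖F k‖ ^ r)
    refine le_trans (le_of_eq ?_) hLr
    rw [← this]; rfl
  -- pointwise
  have hpt : ∀ k, ‖F k ^ 2 * F (-2 * k) * (Bt k ^ 4 * Bt (-2 * k) ^ 2 - 1)‖ ≤
      240 * C ^ 3 * ε ^ 2 * δ ^ (-r) * ‖F k‖ ^ r + 2 * δ ^ (3 - r) * (‖F k‖ ^ r + ‖F (-2 * k)‖ ^ r) := by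
    intro k
    rw [norm_mul, norm_mul, norm_pow]
    have hpb := pow_bound (Bt k) (Bt (-2 * k)) (hβ1 k) (hβ1 _)
    by_cases hk : δ ≤ ‖F k‖
    · have e1 : ‖Bt k - 1‖ ≤ (2 * Real.pi * ε) ^ 2 / 2 := by
        apply bohr_bound S hne hsym
        intro x hx
        refine (norm_chi_sub_one_le x k).trans ?_
        have := (hmemS x).1 hx k hk
        gcongr
      have e2 : ‖Bt (-2 * k) - 1‖ ≤ (4 * Real.pi * ε) ^ 2 / 2 := by
        apply bohr_bound S hne hsym
        intro x hx
        have h1 := norm_chi_sub_one_le x k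
        have h2 := (hmemS x).1 hx k hk
        have h3 : ZMod.stdAddChar (x * (-2 * k)) = (starRingEnd ℂ) ((ZMod.stdAddChar (x * k))^2 : ℂ) := by
          rw [← AddChar.map_nsmul_eq_pow, ← chi_neg]; congr 1; simp; ring
        rw [h3]
        have h4 : (starRingEnd ℂ) ((ZMod.stdAddChar (x * k))^2 : ℂ) - 1 =
           (starRingEnd ℂ) ((ZMod.stdAddChar (x * k) + 1) * (ZMod.stdAddChar (x * k) - 1)) := by
          simp only [map_mul, map_add, map_sub, map_pow, map_one]; ring
        rw [h4, Complex.norm_conj, norm_mul]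
        have h5 : ‖(ZMod.stdAddChar (x * k) : ℂ) + 1‖ ≤ 2 := by
          refine (norm_add_le _ _).trans ?_
          rw [norm_chi, norm_one]; norm_num
        calc _ ≤ 2 * (2 * Real.pi * ε) := by
              gcongr
              exact h1.trans (by gcongr)
          _ = _ := by ring
      have e3 : ‖Bt k ^ 4 * Bt (-2 * k) ^ 2 - 1‖ ≤ 240 * ε ^ 2 := by
        have hpi : Real.pi ^ 2 ≤ 10 := by nlinarith [Real.pi_lt_d2, Real.pi_pos]
        nlinarith [sq_nonneg ε]
      have e4 : 1 ≤ δ ^ (-r) * ‖F k‖ ^ r := by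
        rw [Real.rpow_neg hδ0.le, ← div_eq_inv_mul, ← Real.div_rpow (by positivity) hδ0.le]
        apply Real.one_le_rpow _ (by linarith)
        rw [le_div_iff₀ hδ0]; linarith
      have e5 : ‖F k‖ ^ 2 * ‖F (-2 * k)‖ ≤ C ^ 3 := by
        calc _ ≤ C ^ 2 * C := by gcongr <;> apply hsup
          _ = _ := by ring
      have e6 : ‖F k‖ ^ 2 * ‖F (-2 * k)‖ * ‖Bt k ^ 4 * Bt (-2 * k) ^ 2 - 1‖ ≤ C ^ 3 * (240 * ε ^ 2) := by
        gcongr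
      have e7 : C ^ 3 * (240 * ε ^ 2) * 1 ≤ C ^ 3 * (240 * ε ^ 2) * (δ ^ (-r) * ‖F k‖ ^ r) := by
        gcongr
      have e8 : 0 ≤ 2 * δ ^ (3 - r) * (‖F k‖ ^ r + ‖F (-2 * k)‖ ^ r) := by positivity
      linarith
    · push Not at hk
      have e3 : ‖Bt k ^ 4 * Bt (-2 * k) ^ 2 - 1‖ ≤ 2 := by
        refine (norm_sub_le _ _).trans ?_
        rw [norm_mul, norm_pow, norm_pow, norm_one]
        have := pow_le_one₀ (n := 4) (norm_nonneg _) (hβ1 k)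
        have := pow_le_one₀ (n := 2) (norm_nonneg _) (hβ1 (-2 * k))
        have := mul_le_one₀ ‹‖Bt k‖ ^ 4 ≤ 1› (by positivity) this
        linarith
      have e4 : ‖F k‖ ^ 2 * ‖F (-2 * k)‖ ≤ δ ^ (3 - r) * (‖F k‖ ^ r + ‖F (-2 * k)‖ ^ r) := by
        set u := ‖F k‖ with hu
        set v := ‖F (-2 * k)‖ with hv
        have hu0 : 0 ≤ u := norm_nonneg _
        have hv0 : 0 ≤ v := norm_nonneg _
        rcases hu0.eq_or_lt with hu1 | hu1
        · rw [← hu1]; simp; positivity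
        have e5 : u ^ 2 = u ^ (3 - r) * u ^ (r - 1) := by
          rw [← Real.rpow_add hu1]; rw [← Real.rpow_natCast]; congr 1; push_cast; ring
        have e6 : u ^ (r - 1) * v ≤ u ^ r + v ^ r := by
          have hup : 0 ≤ u ^ r := by positivity
          have hvp : 0 ≤ v ^ r := by positivity
          rcases le_total u v with h | h
          · rcases hv0.eq_or_lt with hv1 | hv1
            · linarith
            have : u ^ (r - 1) ≤ v ^ (r - 1) := Real.rpow_le_rpow hu0 h (by linarith)
            calc _ ≤ v ^ (r - 1) * v := by gcongr
              _ = v ^ r := by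
                nth_rewrite 2 [← Real.rpow_one v]; rw [← Real.rpow_add hv1]; congr 1; ring
              _ ≤ _ := by linarith
          · calc _ ≤ u ^ (r - 1) * u := by gcongr
              _ = u ^ r := by
                nth_rewrite 2 [← Real.rpow_one u]; rw [← Real.rpow_add hu1]; congr 1; ring
              _ ≤ _ := by linarith
        have e7 : u ^ (3 - r) ≤ δ ^ (3 - r) := Real.rpow_le_rpow hu0 hk.le (by linarith)
        rw [e5, mul_assoc]
        gcongr
      have e9 : 0 ≤ 240 * C ^ 3 * ε ^ 2 * δ ^ (-r) * ‖F k‖ ^ r := by positivity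
      have e10 : ‖F k‖ ^ 2 * ‖F (-2 * k)‖ * ‖Bt k ^ 4 * Bt (-2 * k) ^ 2 - 1‖ ≤
          (δ ^ (3 - r) * (‖F k‖ ^ r + ‖F (-2 * k)‖ ^ r)) * 2 := by gcongr
      linarith
  have hsum : ‖∑ k, F k ^ 2 * F (-2 * k) * (Bt k ^ 4 * Bt (-2 * k) ^ 2 - 1)‖ ≤
      240 * C ^ 4 * (ε ^ 2 * δ ^ (-r)) + 4 * C * δ ^ (3 - r) := by
    refine (norm_sum_le _ _).trans ((Finset.sum_le_sum fun k _ => hpt k).trans ?_)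
    rw [Finset.sum_add_distrib, ← Finset.mul_sum, ← Finset.mul_sum, Finset.sum_add_distrib]
    calc _ ≤ 240 * C ^ 3 * ε ^ 2 * δ ^ (-r) * C + 2 * δ ^ (3 - r) * (C + C) := by gcongr
      _ = _ := by ring
  have key2 : (N : ℝ) * lam3 N a₁ a₁ a₁ - N * lam3 N a a a ≤
      240 * C ^ 4 * (ε ^ 2 * δ ^ (-r)) + 4 * C * δ ^ (3 - r) := by
    refine le_trans ?_ hsum
    have : (((N : ℝ) * lam3 N a₁ a₁ a₁ - N * lam3 N a a a : ℝ) : ℂ) =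
       ∑ k, F k ^ 2 * F (-2 * k) * (Bt k ^ 4 * Bt (-2 * k) ^ 2 - 1) := by
      push_cast; rw [key]; ring
    rw [← this, Complex.norm_real]
    exact le_abs_self _
  have : lam3 N a₁ a₁ a₁ = (N:ℝ)⁻¹ * ((N : ℝ) * lam3 N a₁ a₁ a₁ - N * lam3 N a a a) + lam3 N a a a := by
    field_simp; ring
  rw [this]
  have h9 : (N:ℝ)⁻¹ * ((N : ℝ) * lam3 N a₁ a₁ a₁ - N * lam3 N a a a) ≤ (N:ℝ)⁻¹ * (240 * C ^ 4 * (ε ^ 2 * δ ^ (-r)) + 4 * C * δ ^ (3 - r)) := by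
    gcongr
  linarith

end PS

namespace PS

lemma strong_of_weak (s r C M : ℝ) (hs : 0 < s) (hsr : s < r) (hC : 0 < C) (hM : 0 < M) :
    ∃ C' : ℝ, ∀ (N : ℕ) (t : ℕ → ℝ), (∀ ξ < N, 0 ≤ t ξ ∧ t ξ ≤ M) →
      (∀ δ : ℝ, 0 < δ → (((Finset.range N).filter (fun ξ => δ ≤ t ξ)).card : ℝ) ≤ C * δ ^ (-s)) →
      ∑ ξ ∈ Finset.range N, t ξ ^ r ≤ C' := by
  set ρ : ℝ := (1/2 : ℝ) ^ (r - s) with hρ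
  have hρ1 : ρ < 1 := Real.rpow_lt_one (by norm_num) (by norm_num) (by linarith)
  have hρ0 : 0 < ρ := by positivity
  refine ⟨2 ^ r * C * M ^ (r - s) * (1 - ρ)⁻¹, fun N t ht hw => ?_⟩
  set y : ℕ → ℝ := fun j => M * (1/2) ^ j with hy
  have hy0 : ∀ j, 0 < y j := fun j => by positivity
  have hex : ∀ ξ, ∃ j : ℕ, ξ < N → 0 < t ξ → y j ≤ t ξ ∧ t ξ ≤ 2 * y j := by
    intro ξ
    by_cases h : ξ < N ∧ 0 < t ξ
    · obtain ⟨h1, h2⟩ := h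
      have hE : ∃ j, y j ≤ t ξ := by
        obtain ⟨j, hj⟩ := exists_pow_lt_of_lt_one (show 0 < t ξ / M by positivity) (show (1/2:ℝ) < 1 by norm_num)
        refine ⟨j, ?_⟩
        rw [lt_div_iff₀ hM] at hj
        simp only [hy]; linarith
      refine ⟨Nat.find hE, fun _ _ => ⟨Nat.find_spec hE, ?_⟩⟩
      rcases Nat.eq_zero_or_pos (Nat.find hE) with h0 | h0
      · rw [h0]; simp only [hy, pow_zero]; linarith [(ht ξ h1).2]
      · have h3 := Nat.find_min hE (m := Nat.find hE - 1) (by omega)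
        push Not at h3
        have : y (Nat.find hE - 1) = 2 * y (Nat.find hE) := by
          simp only [hy]
          obtain ⟨k, hk⟩ : ∃ k, Nat.find hE = k + 1 := ⟨Nat.find hE - 1, by omega⟩
          rw [hk]; simp [pow_succ]; ring
        linarith
    · exact ⟨0, fun h1 h2 => absurd ⟨h1, h2⟩ h⟩
  choose j hj using hex
  set J := (Finset.range N).sup j + 1 with hJ
  have h1 : ∀ ξ ∈ Finset.range N, t ξ ^ r ≤
      ∑ i ∈ Finset.range J, if y i ≤ t ξ then 2 ^ r * y i ^ r else 0 := by
    intro ξ hξ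
    have hξ' : ξ < N := by simpa using hξ
    rcases (ht ξ hξ').1.eq_or_lt with h0 | h0
    · rw [← h0, Real.zero_rpow (by linarith)]
      apply Finset.sum_nonneg; intro i _; split_ifs <;> [positivity; rfl]
    · obtain ⟨h2, h3⟩ := hj ξ hξ' h0
      have h4 : j ξ ∈ Finset.range J := by
        rw [Finset.mem_range, hJ, Nat.lt_succ_iff]
        exact Finset.le_sup hξ
      refine le_trans ?_ (Finset.single_le_sum (f := fun i => if y i ≤ t ξ then 2 ^ r * y i ^ r else 0) ?_ h4)
      · simp only [h2, if_true]
        rw [← Real.mul_rpow (by norm_num) (hy0 _).le]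
        exact Real.rpow_le_rpow h0.le h3 (by linarith)
      · intro i _; split_ifs <;> [positivity; rfl]
  calc ∑ ξ ∈ Finset.range N, t ξ ^ r ≤ ∑ ξ ∈ Finset.range N, ∑ i ∈ Finset.range J, (if y i ≤ t ξ then 2 ^ r * y i ^ r else 0) :=
        Finset.sum_le_sum h1
    _ = ∑ i ∈ Finset.range J, 2 ^ r * y i ^ r * ((Finset.range N).filter (fun ξ => y i ≤ t ξ)).card := by
        rw [Finset.sum_comm]
        refine Finset.sum_congr rfl fun i _ => ?_
        rw [← Finset.sum_filter, Finset.sum_const, nsmul_eq_mul, mul_comm]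
    _ ≤ ∑ i ∈ Finset.range J, 2 ^ r * y i ^ r * (C * y i ^ (-s)) := by
        gcongr with i _
        exact hw _ (hy0 i)
    _ = ∑ i ∈ Finset.range J, 2 ^ r * C * M ^ (r - s) * ρ ^ i := by
        refine Finset.sum_congr rfl fun i _ => ?_
        have e1 : y i ^ r * y i ^ (-s) = M ^ (r - s) * ρ ^ i := by
          rw [← Real.rpow_add (hy0 i), ← sub_eq_add_neg]
          simp only [hy]
          rw [Real.mul_rpow hM.le (by positivity), hρ, ← Real.rpow_natCast, ← Real.rpow_natCast,
            ← Real.rpow_mul (by norm_num), ← Real.rpow_mul (by norm_num), mul_comm (i:ℝ)]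
        linear_combination 2 ^ r * C * e1
    _ = 2 ^ r * C * M ^ (r - s) * ∑ i ∈ Finset.range J, ρ ^ i := by rw [Finset.mul_sum]
    _ ≤ _ := by
        gcongr
        have := Summable.sum_le_tsum (Finset.range J) (fun i _ => by positivity) (summable_geometric_of_lt_one hρ0.le hρ1)
        rwa [tsum_geometric_of_lt_one hρ0.le hρ1] at this

end PS

namespace PS

section phi
variable {c : ℝ} (F : Fc c)

lemma h_mono : StrictMonoOn F.toFun (Set.Ici F.x₀) := by
  apply strictMonoOn_of_deriv_pos (convex_Ici _) F.contDiffOn.continuousOn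
  intro x hx
  rw [interior_Ici] at hx
  exact F.deriv_pos x (le_of_lt hx)

lemma h_deriv (x : ℝ) (hx : F.x₀ < x) :
    HasDerivAt F.toFun (F.toFun x * (c + F.vth x) / x) x := by
  have hx1 := F.one_le_x₀
  have hx0 : 0 < x := by linarith
  have hcont : ContinuousOn (fun t => F.vth t / t) (Set.Ici F.x₀) :=
    F.vth_contDiffOn.continuousOn.div continuousOn_id (fun t ht => by
      have : F.x₀ ≤ t := ht
      simp; linarith)
  have h1 : HasDerivAt (fun x => ∫ t in F.x₀..x, F.vth t / t) (F.vth x / x) x := by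
    apply intervalIntegral.integral_hasDerivAt_right
    · apply ContinuousOn.intervalIntegrable
      apply hcont.mono
      rw [Set.uIcc_of_le hx.le]; exact Set.Icc_subset_Ici_self
    · exact ContinuousOn.stronglyMeasurableAtFilter isOpen_Ioi (hcont.mono Set.Ioi_subset_Ici_self) x hx
    · exact hcont.continuousAt (Ici_mem_nhds hx)
  have h2 : HasDerivAt (fun x : ℝ => x ^ c) (c * x ^ (c - 1)) x :=
    Real.hasDerivAt_rpow_const (Or.inl hx0.ne')
  have h3 := (h2.const_mul F.Ch).mul h1.exp
  have h4 : F.toFun =ᶠ[nhds x] (fun x => F.Ch * x ^ c) * (fun x => Real.exp (∫ t in F.x₀..x, F.vth t / t)) := by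
    filter_upwards [Ioi_mem_nhds hx] with y hy
    exact F.eqn y (le_of_lt hy)
  refine (h3.congr_of_eventuallyEq h4).congr_deriv ?_
  rw [F.eqn x hx.le, Real.rpow_sub_one hx0.ne']
  field_simp

lemma vth_deriv (x : ℝ) (hx : F.x₀ < x) : HasDerivAt F.vth (deriv F.vth x) x := by
  have := (F.vth_contDiffOn.contDiffAt (Ici_mem_nhds hx)).differentiableAt (by norm_num)
  exact this.hasDerivAt

variable (φ : ℝ → ℝ)

lemma phi_mono (hφ₁ : ∀ x ≥ F.x₀, φ (F.toFun x) = x) (hφ₂ : ∀ y ≥ F.toFun F.x₀, F.toFun (φ y) = y) (hφ₃ : ∀ y ≥ F.toFun F.x₀, F.x₀ ≤ φ y) : StrictMonoOn φ (Set.Ici (F.toFun F.x₀)) := by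
  intro y hy z hz hyz
  by_contra h
  push Not at h
  have := (h_mono F).monotoneOn (hφ₃ z hz) (hφ₃ y hy) h
  rw [hφ₂ z hz, hφ₂ y hy] at this
  linarith

lemma phi_lt (hφ₁ : ∀ x ≥ F.x₀, φ (F.toFun x) = x) (hφ₂ : ∀ y ≥ F.toFun F.x₀, F.toFun (φ y) = y) (hφ₃ : ∀ y ≥ F.toFun F.x₀, F.x₀ ≤ φ y) (x1 y : ℝ) (h1 : F.x₀ ≤ x1) (hy : F.toFun x1 < y) : x1 < φ y := by
  have h2 : F.toFun F.x₀ ≤ F.toFun x1 := (h_mono F).monotoneOn (Set.mem_Ici.2 le_rfl) h1 h1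
  have := phi_mono F φ hφ₁ hφ₂ hφ₃ (Set.mem_Ici.2 h2) (Set.mem_Ici.2 (h2.trans hy.le)) hy
  rwa [hφ₁ x1 h1] at this

lemma phi_deriv (hφ₁ : ∀ x ≥ F.x₀, φ (F.toFun x) = x) (hφ₂ : ∀ y ≥ F.toFun F.x₀, F.toFun (φ y) = y) (hφ₃ : ∀ y ≥ F.toFun F.x₀, F.x₀ ≤ φ y) (y : ℝ) (hy : F.toFun F.x₀ < y) :
    HasDerivAt φ ((y * (c + F.vth (φ y)) / φ y)⁻¹) y := by
  have h1 : F.x₀ < φ y := phi_lt F φ hφ₁ hφ₂ hφ₃ _ _ le_rfl hy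
  have hd := h_deriv F (φ y) h1
  rw [hφ₂ y hy.le] at hd
  have hne : y * (c + F.vth (φ y)) / φ y ≠ 0 := by
    have := F.deriv_pos (φ y) h1.le
    rw [hd.deriv] at this
    exact this.ne'
  apply HasDerivAt.of_local_left_inverse _ hd hne
  · filter_upwards [Ioi_mem_nhds hy] with z hz
    exact hφ₂ z (le_of_lt hz)
  · apply (phi_mono F φ hφ₁ hφ₂ hφ₃).continuousAt_of_image_mem_nhds (Ici_mem_nhds hy)
    filter_upwards [Ioi_mem_nhds h1] with x hx
    exact ⟨F.toFun x, (h_mono F).monotoneOn (Set.mem_Ici.2 le_rfl) (Set.mem_Ici.2 (le_of_lt hx)) (le_of_lt hx), hφ₁ x (le_of_lt hx)⟩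

lemma phi_deriv' (hφ₁ : ∀ x ≥ F.x₀, φ (F.toFun x) = x) (hφ₂ : ∀ y ≥ F.toFun F.x₀, F.toFun (φ y) = y) (hφ₃ : ∀ y ≥ F.toFun F.x₀, F.x₀ ≤ φ y) (y : ℝ) (hy : F.toFun F.x₀ < y) :
    deriv φ y = φ y / (y * (c + F.vth (φ y))) := by
  rw [(phi_deriv F φ hφ₁ hφ₂ hφ₃ y hy).deriv, inv_div]

lemma phi_deriv2 (hφ₁ : ∀ x ≥ F.x₀, φ (F.toFun x) = x) (hφ₂ : ∀ y ≥ F.toFun F.x₀, F.toFun (φ y) = y) (hφ₃ : ∀ y ≥ F.toFun F.x₀, F.x₀ ≤ φ y) (y : ℝ) (hy : F.toFun F.x₀ < y) (hne : c + F.vth (φ y) ≠ 0) :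
    HasDerivAt (deriv φ) (-(deriv φ y * ((c + F.vth (φ y)) * (c + F.vth (φ y) - 1) +
      φ y * deriv F.vth (φ y)) / (y * (c + F.vth (φ y)) ^ 2))) y := by
  have h1 : F.x₀ < φ y := phi_lt F φ hφ₁ hφ₂ hφ₃ _ _ le_rfl hy
  have hy0 : 0 < y := by linarith [F.one_le F.x₀ le_rfl]
  have hp0 : 0 < φ y := by linarith [F.one_le_x₀]
  have h2 : deriv φ =ᶠ[nhds y] φ / ((fun y => y) * (fun y => (c + F.vth (φ y)))) := by
    filter_upwards [Ioi_mem_nhds hy] with z hz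
    exact phi_deriv' F φ hφ₁ hφ₂ hφ₃ z hz
  have h3 : HasDerivAt φ (deriv φ y) y := (phi_deriv F φ hφ₁ hφ₂ hφ₃ y hy).differentiableAt.hasDerivAt
  have h4 : HasDerivAt (fun y => c + F.vth (φ y)) (deriv F.vth (φ y) * deriv φ y) y :=
    ((vth_deriv F (φ y) h1).comp y h3).const_add c
  have h5 := h3.div ((hasDerivAt_id' y).mul h4) (by
    simp only [Pi.mul_apply]; exact mul_ne_zero hy0.ne' hne)
  refine (h5.congr_of_eventuallyEq h2).congr_deriv ?_
  simp only [Pi.mul_apply]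
  rw [phi_deriv' F φ hφ₁ hφ₂ hφ₃ y hy]
  field_simp
  ring

end phi
end PS

namespace PS

section phi
variable {c : ℝ} (F : Fc c)

lemma vth_tendsto (hc : 1 ≤ c) : Tendsto F.vth atTop (nhds 0) := by
  rcases hc.eq_or_lt with h | h
  · exact (F.cond_eq h.symm).2.2.2.2.1
  · exact (F.cond_gt h).1

lemma vth'_tendsto (hc : 1 ≤ c) : Tendsto (fun x => x * deriv F.vth x) atTop (nhds 0) := by
  rcases hc.eq_or_lt with h | h
  · have h1 := (F.cond_eq h.symm).2.2.2.2.1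
    have h2 := (F.cond_eq h.symm).2.2.2.2.2.1
    have h3 := h2.mul h1
    rw [zero_mul] at h3
    refine h3.congr' ?_
    filter_upwards [eventually_ge_atTop F.x₀] with x hx
    have := (F.cond_eq h.symm).1 x hx
    field_simp
  · exact (F.cond_gt h).2.1

/-- lower bound for `u` -/
lemma u_lower (hc : 1 ≤ c) (ε : ℝ) (hε : 0 < ε) : ∃ κ > 0, ∀ᶠ x in atTop,
    κ * x ^ (-ε) ≤ (c + F.vth x) * (c + F.vth x - 1) + x * deriv F.vth x := by
  rcases hc.eq_or_lt with h | h
  · obtain ⟨C, hC, h1⟩ := (F.cond_eq h.symm).2.2.1 ε hε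
    have h2 := (F.cond_eq h.symm).2.2.2.2.2.1
    refine ⟨(2 * C)⁻¹, by positivity, ?_⟩
    filter_upwards [eventually_ge_atTop F.x₀, h2.eventually (lt_mem_nhds (show (-(1/2) : ℝ) < 0 by norm_num)),
      eventually_gt_atTop 0] with x hx h3 hx0
    have h4 := (F.cond_eq h.symm).1 x hx
    have h5 := h1 x hx
    rw [lt_div_iff₀ h4] at h3
    have h6 : C⁻¹ * x ^ (-ε) ≤ F.vth x := by
      rw [Real.rpow_neg hx0.le, ← mul_inv]
      rw [one_div] at h5
      exact inv_le_of_inv_le₀ h4 h5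
    have e1 : (c + F.vth x) * (c + F.vth x - 1) = F.vth x + F.vth x ^ 2 := by
      linear_combination (-(c + 2 * F.vth x)) * h
    rw [e1, mul_inv]
    nlinarith
  · have h1 := (F.cond_gt h).1
    have h2 := (F.cond_gt h).2.1
    have h3 : Tendsto (fun x => (c + F.vth x) * (c + F.vth x - 1) + x * deriv F.vth x) atTop
      (nhds ((c + 0) * (c + 0 - 1) + 0)) := ((h1.const_add c).mul ((h1.const_add c).sub_const 1)).add h2
    have h4 : 0 < c * (c - 1) := by nlinarith
    refine ⟨c * (c - 1) / 2, by positivity, ?_⟩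
    have h5 : c * (c - 1) / 2 < (c + 0) * (c + 0 - 1) + 0 := by simp; linarith
    filter_upwards [h3.eventually (lt_mem_nhds h5), eventually_ge_atTop 1] with x hx hx1
    have : x ^ (-ε) ≤ 1 := Real.rpow_le_one_of_one_le_of_nonpos hx1 (by linarith)
    nlinarith

lemma h_pos (x : ℝ) (hx : F.x₀ ≤ x) : 0 < F.toFun x := by linarith [F.one_le x hx]

lemma logh_deriv (x : ℝ) (hx : F.x₀ < x) (a : ℝ) :
    HasDerivAt (fun x => Real.log (F.toFun x) - a * Real.log x) ((c + F.vth x - a) / x) x := by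
  have hx0 : 0 < x := by linarith [F.one_le_x₀]
  have h0 := h_pos F x hx.le
  have := ((h_deriv F x hx).log h0.ne').sub ((Real.hasDerivAt_log hx0.ne').const_mul a)
  refine this.congr_deriv ?_
  field_simp

lemma logh_upper (hc : 1 ≤ c) (ε : ℝ) (hε : 0 < ε) : ∃ B, ∀ᶠ x in atTop,
    Real.log (F.toFun x) ≤ B + (c + ε) * Real.log x := by
  have h1 := (vth_tendsto F hc).eventually (gt_mem_nhds hε)
  obtain ⟨x1, hx1⟩ := (h1.and (eventually_gt_atTop F.x₀)).exists_forall_of_atTop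
  refine ⟨Real.log (F.toFun x1) - (c + ε) * Real.log x1, ?_⟩
  filter_upwards [eventually_ge_atTop x1] with x hx
  have : AntitoneOn (fun x => Real.log (F.toFun x) - (c + ε) * Real.log x) (Set.Ici x1) := by
    apply antitoneOn_of_deriv_nonpos (convex_Ici _)
    · intro z hz
      exact (logh_deriv F z (hx1 z hz).2 _).continuousAt.continuousWithinAt
    · intro z hz
      rw [interior_Ici] at hz
      exact (logh_deriv F z (hx1 z (le_of_lt hz)).2 _).differentiableAt.differentiableWithinAt
    · intro z hz
      rw [interior_Ici] at hz
      have h2 := hx1 z (le_of_lt hz)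
      rw [(logh_deriv F z h2.2 _).deriv]
      apply div_nonpos_of_nonpos_of_nonneg
      · linarith
      · linarith [F.one_le_x₀]
  have := this (Set.mem_Ici.2 le_rfl) hx hx
  simp only at this
  linarith

lemma x_div_h (hc : 1 ≤ c) : Tendsto (fun x => x / F.toFun x) atTop (nhds 0) := by
  rcases hc.eq_or_lt with h | h
  · exact (F.cond_eq h.symm).2.2.2.1
  set a := (c + 1) / 2 with ha
  have h1 := (vth_tendsto F hc).eventually (lt_mem_nhds (show -((c-1)/2) < 0 by linarith))
  obtain ⟨x1, hx1⟩ := (h1.and (eventually_gt_atTop F.x₀)).exists_forall_of_atTop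
  have hm : MonotoneOn (fun x => Real.log (F.toFun x) - a * Real.log x) (Set.Ici x1) := by
    apply monotoneOn_of_deriv_nonneg (convex_Ici _)
    · intro z hz
      exact (logh_deriv F z (hx1 z hz).2 _).continuousAt.continuousWithinAt
    · intro z hz
      rw [interior_Ici] at hz
      exact (logh_deriv F z (hx1 z (le_of_lt hz)).2 _).differentiableAt.differentiableWithinAt
    · intro z hz
      rw [interior_Ici] at hz
      have h2 := hx1 z (le_of_lt hz)
      rw [(logh_deriv F z h2.2 _).deriv]
      apply div_nonneg
      · linarith
      · linarith [F.one_le_x₀]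
  set B := Real.log (F.toFun x1) - a * Real.log x1 with hB
  have h3 : Tendsto (fun x => Real.exp (-B - (a - 1) * Real.log x)) atTop (nhds 0) := by
    apply Real.tendsto_exp_atBot.comp
    apply tendsto_atBot_add_const_left
    apply tendsto_neg_atTop_atBot.comp
    exact Real.tendsto_log_atTop.const_mul_atTop (by linarith)
  apply squeeze_zero' _ _ h3
  · filter_upwards [eventually_ge_atTop x1] with x hx
    have := hx1 x hx
    have := h_pos F x this.2.le
    have : 0 < x := by linarith [F.one_le_x₀]
    positivity
  · filter_upwards [eventually_ge_atTop x1] with x hx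
    have h4 := hx1 x hx
    have h5 := h_pos F x h4.2.le
    have h6 : 0 < x := by linarith [F.one_le_x₀]
    rw [← Real.log_le_iff_le_exp (by positivity), Real.log_div h6.ne' h5.ne']
    have := hm (Set.mem_Ici.2 le_rfl) hx hx
    simp only at this
    linarith

variable (φ : ℝ → ℝ)

lemma phi_tendsto (hφ₁ : ∀ x ≥ F.x₀, φ (F.toFun x) = x) (hφ₂ : ∀ y ≥ F.toFun F.x₀, F.toFun (φ y) = y) (hφ₃ : ∀ y ≥ F.toFun F.x₀, F.x₀ ≤ φ y) : Tendsto φ atTop atTop := by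
  rw [tendsto_atTop]
  intro x
  filter_upwards [eventually_gt_atTop (F.toFun (max x F.x₀))] with y hy
  have := phi_lt F φ hφ₁ hφ₂ hφ₃ (max x F.x₀) y (le_max_right _ _) hy
  exact (le_max_left _ _).trans this.le

set_option maxHeartbeats 800000 in
lemma phi_main (hφ₁ : ∀ x ≥ F.x₀, φ (F.toFun x) = x) (hφ₂ : ∀ y ≥ F.toFun F.x₀, F.toFun (φ y) = y) (hφ₃ : ∀ y ≥ F.toFun F.x₀, F.x₀ ≤ φ y) (γ : ℝ) (hγ : 1/2 < γ) (hγ₂ : γ ≤ 1) (hcγ : c = 1 / γ) (ε : ℝ) (hε : 0 < ε) (hε2 : ε < 1/2) :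
    ∀ᶠ y in atTop, F.toFun F.x₀ < y ∧ HasDerivAt φ (deriv φ y) y ∧ 0 < deriv φ y ∧ deriv φ y ≤ 1/6 ∧
      φ y ≤ y ∧
      y ^ (γ - 1 - ε) ≤ deriv φ y ∧ ∃ w, HasDerivAt (deriv φ) (-w) y ∧
        y ^ (γ - 2 - 2*ε) ≤ w ∧ w ≤ 20 * deriv φ y / y := by
  have hc1 : 1 ≤ c := by rw [hcγ, le_div_iff₀] <;> linarith
  have hc2 : c < 2 := by rw [hcγ, div_lt_iff₀] <;> linarith
  have hcg : γ * c = 1 := by rw [hcγ]; field_simp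
  have hT := phi_tendsto F φ hφ₁ hφ₂ hφ₃
  obtain ⟨κ, hκ, hu⟩ := u_lower F hc1 (ε/2) (by linarith)
  obtain ⟨B, hB⟩ := logh_upper F hc1 (ε/2) (by linarith)
  have hv := Metric.tendsto_nhds.1 (vth_tendsto F hc1) (1/4) (by norm_num)
  have hv' := Metric.tendsto_nhds.1 (vth'_tendsto F hc1) 1 (by norm_num)
  have hxh := (x_div_h F hc1).eventually (gt_mem_nhds (show (0:ℝ) < 1/8 by norm_num))
  have hK := (Real.tendsto_log_atTop.const_mul_atTop (show 0 < ε * c / 2 by nlinarith)).eventually_ge_atTop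
    (Real.log 3 + |B|)
  have hK2 := (tendsto_rpow_atTop (show 0 < ε/2 by linarith)).eventually_ge_atTop (9 / κ)
  filter_upwards [eventually_gt_atTop (F.toFun F.x₀), hT.eventually hu, hT.eventually hB, hT.eventually hv,
    hT.eventually hv', hT.eventually hxh, hT.eventually hK, hK2] with y hy hu hB hv hv' hxh hK hK2
  have hd := phi_deriv F φ hφ₁ hφ₂ hφ₃ y hy
  have hd' := phi_deriv' F φ hφ₁ hφ₂ hφ₃ y hy
  have hy0 : 1 ≤ y := by linarith [F.one_le F.x₀ le_rfl]
  have h1 : F.x₀ < φ y := phi_lt F φ hφ₁ hφ₂ hφ₃ _ _ le_rfl hy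
  have hp0 : 1 ≤ φ y := by linarith [F.one_le_x₀]
  rw [hφ₂ y hy.le] at hB hxh
  set x := φ y with hx
  set v := F.vth x
  rw [Real.dist_eq, sub_zero, abs_lt] at hv hv'
  have hcv : 3/4 ≤ c + v := by linarith [hv.1]
  have hcv2 : c + v ≤ 3 := by linarith [hv.2]
  have hcv0 : c + v ≠ 0 := by linarith
  rw [div_lt_iff₀ (by linarith)] at hxh
  have hpos : 0 < deriv φ y := by rw [hd']; positivity
  have hlow : y ^ (γ - 1 - ε) ≤ deriv φ y := by
    rw [← Real.log_le_log_iff (by positivity) hpos, Real.log_rpow (by linarith), hd',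
      Real.log_div (by linarith) (by positivity), Real.log_mul (by linarith) hcv0]
    have e1 : Real.log (c + v) ≤ Real.log 3 := Real.log_le_log (by linarith) hcv2
    have e2 : (γ - ε) * Real.log y ≤ (γ - ε) * (B + (c + ε/2) * Real.log x) :=
      mul_le_mul_of_nonneg_left hB (by linarith)
    have e3 : (γ - ε) * B ≤ |B| := by
      calc (γ - ε) * B ≤ (γ - ε) * |B| := mul_le_mul_of_nonneg_left (le_abs_self B) (by linarith)
        _ ≤ 1 * |B| := mul_le_mul_of_nonneg_right (by linarith) (abs_nonneg B)
        _ = |B| := one_mul _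
    have e4 : 0 ≤ Real.log x := Real.log_nonneg hp0
    have e5 : (γ - ε) * (c + ε/2) ≤ 1 - ε * c / 2 := by nlinarith
    have e6 := mul_le_mul_of_nonneg_right e5 e4
    nlinarith
  refine ⟨hy, hd.differentiableAt.hasDerivAt, hpos, ?_, ?_, hlow, _, phi_deriv2 F φ hφ₁ hφ₂ hφ₃ y hy hcv0, ?_, ?_⟩
  · rw [hd', div_le_iff₀ (by positivity)]
    nlinarith
  · linarith
  · rw [← hx]
    have f1 : κ * y ^ (-(ε/2)) ≤ (c + v) * (c + v - 1) + x * deriv F.vth x := by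
      refine le_trans ?_ hu
      apply mul_le_mul_of_nonneg_left _ hκ.le
      apply Real.rpow_le_rpow_of_nonpos (by linarith) (by linarith) (by linarith)
    have f2 : y ^ (γ - 2 - 2*ε) = y ^ (γ - 1 - ε) * y ^ (-(ε/2)) * y ^ (-(ε/2)) / y := by
      rw [← Real.rpow_add (by linarith), ← Real.rpow_add (by linarith), ← Real.rpow_sub_one (by linarith)]
      congr 1; ring
    have f3 : y ^ (-(ε/2)) ≤ κ / 9 := by
      rw [Real.rpow_neg (by linarith), ← inv_div 9 κ]
      exact inv_anti₀ (by positivity) hK2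
    have f4 : (c + v)^2 ≤ 9 := by nlinarith
    rw [f2]
    have f0 : 0 < y ^ (-(ε/2)) := Real.rpow_pos_of_pos (by linarith) _
    calc y ^ (γ - 1 - ε) * y ^ (-(ε/2)) * y ^ (-(ε/2)) / y ≤ deriv φ y * y ^ (-(ε/2)) * (κ/9) / y := by gcongr
      _ = deriv φ y * (κ * y ^ (-(ε/2))) / (y * 9) := by field_simp
      _ ≤ deriv φ y * ((c + v) * (c + v - 1) + x * deriv F.vth x) / (y * (c + v)^2) := by
          have f7 : 0 ≤ deriv φ y * ((c + v) * (c + v - 1) + x * deriv F.vth x) :=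
            mul_nonneg hpos.le (le_trans (mul_nonneg hκ.le f0.le) f1)
          exact div_le_div₀ f7 (mul_le_mul_of_nonneg_left f1 hpos.le) (by positivity)
            (mul_le_mul_of_nonneg_left f4 (by linarith))
  · rw [← hx, div_le_div_iff₀ (by positivity) (by positivity)]
    have f5 : (c + v) * (c + v - 1) + x * deriv F.vth x ≤ 7 := by
      have : (c + v) * (c + v - 1) ≤ 3 * 2 := by
        apply (mul_le_mul_of_nonneg_left (show c + v - 1 ≤ 2 by linarith) (by linarith)).trans
        linarith
      linarith [hv'.2]
    have f6 : 9/16 ≤ (c + v)^2 := by nlinarith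
    have : (c + v) * (c + v - 1) + x * deriv F.vth x ≤ 20 * (c + v)^2 := by linarith
    calc deriv φ y * ((c + v) * (c + v - 1) + x * deriv F.vth x) * y ≤ deriv φ y * (20 * (c + v)^2) * y := by gcongr
      _ = _ := by ring

end phi
end PS

namespace PS

/-- All analytic information about `φ` used in the exponential sum estimates. -/
structure PhiOK (φ : ℝ → ℝ) (P : Set ℕ) (γ η X : ℝ) : Prop where
  one_le : 1 ≤ X
  hd : ∀ y ≥ X, HasDerivAt φ (deriv φ y) y
  pos : ∀ y ≥ X, 0 < deriv φ y
  le : ∀ y ≥ X, deriv φ y ≤ 1/6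
  low : ∀ y ≥ X, y ^ (γ - 1 - η) ≤ deriv φ y
  anti : ∀ y ≥ X, ∀ z ≥ y, deriv φ z ≤ deriv φ y
  lip : ∀ y ≥ X, ∀ z ≥ y, deriv φ y - deriv φ z ≤ 20 * deriv φ y / y * (z - y)
  gap : ∀ y ≥ X, ∀ z ≥ y, z ^ (γ - 2 - η) * (z - y) ≤ deriv φ y - deriv φ z
  lin : ∀ y ≥ X, ∀ z ≥ y, |φ z - φ y - deriv φ y * (z - y)| ≤ 20 / y * (z - y) ^ 2
  near : ∀ p ∈ P, X ≤ p → nint (φ p) ≤ deriv φ p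
  prime : ∀ p ∈ P, p.Prime

lemma nint_le_of_int (t : ℝ) (k : ℤ) : nint t ≤ |t - k| := by
  unfold nint; exact round_le t k

section phi
variable {c : ℝ} (F : Fc c)
variable (φ : ℝ → ℝ)

lemma phi_ok (hφ₁ : ∀ x ≥ F.x₀, φ (F.toFun x) = x) (hφ₂ : ∀ y ≥ F.toFun F.x₀, F.toFun (φ y) = y) (hφ₃ : ∀ y ≥ F.toFun F.x₀, F.x₀ ≤ φ y) (γ : ℝ) (hγ : 1/2 < γ) (hγ₂ : γ ≤ 1) (hcγ : c = 1 / γ) (η : ℝ) (hη : 0 < η) (hη2 : η < 1/2) :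
    ∃ X, PhiOK φ (Ph F) γ η X := by
  obtain ⟨X, hX⟩ := ((phi_main F φ hφ₁ hφ₂ hφ₃ γ hγ hγ₂ hcγ (η/2) (by linarith) (by linarith)).and
    (eventually_ge_atTop 1)).exists_forall_of_atTop
  have hX1 : 1 ≤ X := (hX X le_rfl).2
  have hdX : ∀ y ≥ X, HasDerivAt φ (deriv φ y) y := fun y hy => (hX y hy).1.2.1
  have hpos : ∀ y ≥ X, 0 < deriv φ y := fun y hy => (hX y hy).1.2.2.1
  have hle : ∀ y ≥ X, deriv φ y ≤ 1/6 := fun y hy => (hX y hy).1.2.2.2.1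
  choose w hw using fun y (hy : X ≤ y) => (hX y hy).1.2.2.2.2.2.2
  have hanti : ∀ y ≥ X, ∀ z ≥ y, deriv φ z ≤ deriv φ y := by
    intro y hy z hyz
    have : AntitoneOn (deriv φ) (Set.Ici X) := by
      apply antitoneOn_of_deriv_nonpos (convex_Ici _)
      · intro z hz; exact (hw z hz).1.continuousAt.continuousWithinAt
      · intro z hz; rw [interior_Ici] at hz
        exact (hw z (le_of_lt hz)).1.differentiableAt.differentiableWithinAt
      · intro z hz; rw [interior_Ici] at hz
        have h1 := hw z (le_of_lt hz)
        have hz' : X < z := hz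
        rw [h1.1.deriv]
        have : 0 ≤ z ^ (γ - 2 - 2 * (η/2)) := Real.rpow_nonneg (by linarith) _
        linarith [h1.2.1]
    exact this hy (hy.trans hyz) hyz
  have hmvt : ∀ y ≥ X, ∀ z > y, ∃ t, ∃ ht : X ≤ t, y ≤ t ∧ t ≤ z ∧ deriv φ y - deriv φ z = w t ht * (z - y) := by
    intro y hy z hyz
    obtain ⟨t, ht, h1⟩ := exists_deriv_eq_slope (deriv φ) hyz
      (fun t ht => (hw t (hy.le.trans ht.1)).1.continuousAt.continuousWithinAt)
      (fun t ht => (hw t (hy.le.trans ht.1.le)).1.differentiableAt.differentiableWithinAt)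
    have hXt : X ≤ t := hy.le.trans ht.1.le
    refine ⟨t, hXt, ht.1.le, ht.2.le, ?_⟩
    rw [(hw t hXt).1.deriv, eq_div_iff (by linarith)] at h1
    linarith
  have hlip : ∀ y ≥ X, ∀ z ≥ y, deriv φ y - deriv φ z ≤ 20 * deriv φ y / y * (z - y) := by
    intro y hy z hyz
    rcases eq_or_lt_of_le hyz with h | h
    · rw [h]; simp
    obtain ⟨t, ht, h1, h2, h3⟩ := hmvt y hy z h
    rw [h3]
    have h4 : w t ht ≤ 20 * deriv φ y / y := by
      refine (hw t ht).2.2.trans ?_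
      have := hanti y hy t h1
      have := hpos t ht
      have := hpos y hy
      have : 0 < y := by linarith
      gcongr
    exact mul_le_mul_of_nonneg_right h4 (by linarith)
  have hXh : ∀ y ≥ X, F.toFun F.x₀ < y := fun y hy => (hX y hy).1.1
  refine ⟨X, hX1, hdX, hpos, hle, ?_, hanti, hlip, ?_, ?_, ?_, ?_⟩
  · intro y hy
    refine le_trans ?_ (hX y hy).1.2.2.2.2.2.1
    exact Real.rpow_le_rpow_of_exponent_le (by linarith) (by linarith)
  · intro y hy z hyz
    rcases eq_or_lt_of_le hyz with h | h
    · rw [h]; simp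
    obtain ⟨t, ht, h1, h2, h3⟩ := hmvt y hy z h
    rw [h3]
    apply mul_le_mul_of_nonneg_right _ (by linarith)
    refine le_trans ?_ (hw t ht).2.1
    rw [show 2 * (η / 2) = η by ring]
    exact Real.rpow_le_rpow_of_nonpos (by linarith) h2 (by linarith)
  · intro y hy z hyz
    rcases eq_or_lt_of_le hyz with h | h
    · rw [h]; simp
    obtain ⟨t, ht, h1⟩ := exists_deriv_eq_slope φ h
      (fun t ht => (hdX t (hy.le.trans ht.1)).continuousAt.continuousWithinAt)
      (fun t ht => (hdX t (hy.le.trans ht.1.le)).differentiableAt.differentiableWithinAt)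
    rw [eq_div_iff (by linarith)] at h1
    rw [← h1, ← sub_mul, abs_mul, abs_of_pos (show 0 < z - y by linarith), sq, ← mul_assoc]
    apply mul_le_mul_of_nonneg_right _ (by linarith)
    rw [abs_sub_comm, abs_of_nonneg (by linarith [hanti y hy t ht.1.le])]
    refine (hlip y hy t ht.1.le).trans ?_
    have h5 := hle y hy
    have h6 := hpos y hy
    have h7 : 0 < y := by linarith
    have h8 : t - y ≤ z - y := by linarith [ht.2]
    have h9 : 0 ≤ t - y := by linarith [ht.1]
    gcongr
    linarith
  · rintro p ⟨hp, n, hn, hpn⟩ hXp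
    have h1 := Int.floor_eq_iff.1 hpn.symm
    push_cast at h1
    have hmono := (phi_mono F φ hφ₁ hφ₂ hφ₃).monotoneOn
    have hp0 := hXh p hXp
    have h2 := hmono (Set.mem_Ici.2 hp0.le) (Set.mem_Ici.2 (hp0.le.trans h1.1)) h1.1
    have h3 := hmono (Set.mem_Ici.2 (hp0.le.trans h1.1))
      (Set.mem_Ici.2 (show F.toFun F.x₀ ≤ (p:ℝ) + 1 by linarith)) h1.2.le
    rw [hφ₁ n hn] at h2 h3
    refine (nint_le_of_int _ (n : ℤ)).trans ?_
    push_cast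
    rw [abs_sub_comm, abs_of_nonneg (by linarith)]
    obtain ⟨t, ht, h4⟩ := exists_deriv_eq_slope φ (show (p:ℝ) < p + 1 by linarith)
      (fun t ht => (hdX t (hXp.trans ht.1)).continuousAt.continuousWithinAt)
      (fun t ht => (hdX t (hXp.trans ht.1.le)).differentiableAt.differentiableWithinAt)
    have := hanti p hXp t ht.1.le
    rw [h4] at this
    simp at this
    linarith
  · rintro p ⟨hp, _⟩
    exact hp

end phi
end PS

namespace PS

/-- the product of a finite set of naturals -/
def qq (v : Finset ℕ) : ℕ := ∏ p ∈ v, p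

noncomputable def fam (P : Finset ℕ) (Q : ℝ) : Finset (Finset ℕ) :=
  P.powerset.filter (fun v => (qq v : ℝ) ≤ Q)

lemma mem_fam {P : Finset ℕ} {Q : ℝ} {v : Finset ℕ} : v ∈ fam P Q ↔ v ⊆ P ∧ (qq v : ℝ) ≤ Q := by
  simp [fam]

section
variable {P : Finset ℕ}

lemma qq_pos (hP : ∀ p ∈ P, p.Prime) {v : Finset ℕ} (hv : v ⊆ P) : 0 < qq v :=
  Finset.prod_pos fun p hp => (hP p (hv hp)).pos

lemma primeFactors_qq (hP : ∀ p ∈ P, p.Prime) {v : Finset ℕ} (hv : v ⊆ P) : (qq v).primeFactors = v :=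
  Nat.primeFactors_prod fun p hp => hP p (hv hp)

lemma qq_inj (hP : ∀ p ∈ P, p.Prime) {v w : Finset ℕ} (hv : v ⊆ P) (hw : w ⊆ P) (h : qq v = qq w) : v = w := by
  rw [← primeFactors_qq hP hv, ← primeFactors_qq hP hw, h]

lemma qq_dvd_iff (hP : ∀ p ∈ P, p.Prime) {v : Finset ℕ} (hv : v ⊆ P) (x : ℕ) : qq v ∣ x ↔ ∀ p ∈ v, p ∣ x := by
  constructor
  · intro h p hp
    exact (Finset.dvd_prod_of_mem _ hp).trans h
  · intro h
    exact Finset.prod_primes_dvd x (fun p hp => (hP p (hv hp)).prime) h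

lemma qq_mono (hP : ∀ p ∈ P, p.Prime) {v w : Finset ℕ} (hw : w ⊆ P) (h : v ⊆ w) : qq v ≤ qq w := by
  apply Nat.le_of_dvd (qq_pos hP hw)
  exact Finset.prod_dvd_prod_of_subset _ _ _ h

lemma qq_union_le (hP : ∀ p ∈ P, p.Prime) {v w : Finset ℕ} (hv : v ⊆ P) (hw : w ⊆ P) : qq (v ∪ w) ≤ qq v * qq w := by
  have h1 : qq (v ∪ w) * qq (v ∩ w) = qq v * qq w := Finset.prod_union_inter
  rw [← h1]
  exact Nat.le_mul_of_pos_right _ (qq_pos hP (Finset.inter_subset_left.trans hv))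

lemma sum_inv_fam (hP : ∀ p ∈ P, p.Prime) {Q : ℝ} (hQ : 1 ≤ Q) : ∑ v ∈ fam P Q, (1 : ℝ) / qq v ≤ 1 + Real.log Q := by
  have h1 : ∑ v ∈ fam P Q, (1 : ℝ) / qq v = ∑ n ∈ (fam P Q).image qq, (1 : ℝ) / n := by
    rw [Finset.sum_image]
    intro v hv w hw h
    exact qq_inj hP (mem_fam.1 hv).1 (mem_fam.1 hw).1 h
  rw [h1]
  have h2 : ∑ n ∈ (fam P Q).image qq, (1 : ℝ) / n ≤ ∑ n ∈ Finset.Icc 1 ⌊Q⌋₊, (1:ℝ)/n := by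
    apply Finset.sum_le_sum_of_subset_of_nonneg
    · intro n hn
      obtain ⟨v, hv, rfl⟩ := Finset.mem_image.1 hn
      rw [mem_fam] at hv
      exact Finset.mem_Icc.2 ⟨qq_pos hP hv.1, Nat.le_floor hv.2⟩
    · intros; positivity
  refine h2.trans ?_
  have := harmonic_floor_le_one_add_log Q hQ
  rw [harmonic_eq_sum_Icc] at this
  push_cast at this
  simpa [one_div] using this

lemma card_fam_dvd (hP : ∀ p ∈ P, p.Prime) {Q : ℝ} (hQ : 1 ≤ Q) : ((fam P Q).card : ℝ) ≤ Q := by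
  have : (fam P Q).card ≤ (Finset.Icc 1 ⌊Q⌋₊).card := by
    apply Finset.card_le_card_of_injOn qq
    · intro v hv
      rw [Finset.mem_coe, mem_fam] at hv
      exact Finset.mem_coe.2 (Finset.mem_Icc.2 ⟨qq_pos hP hv.1, Nat.le_floor hv.2⟩)
    · intro v hv w hw h
      exact qq_inj hP (mem_fam.1 hv).1 (mem_fam.1 hw).1 h
  have h2 : (fam P Q).card ≤ ⌊Q⌋₊ := by simpa using this
  exact (Nat.cast_le.2 h2).trans (Nat.floor_le (by linarith))
end

lemma omega_bound (K ε : ℝ) (hK : 1 ≤ K) (hε : 0 < ε) : ∃ C : ℝ, 1 ≤ C ∧ ∀ s : Finset ℕ,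
    (∀ p ∈ s, p.Prime) → K ^ s.card ≤ C * (qq s : ℝ) ^ ε := by
  set Y : ℕ := ⌈K ^ (1/ε)⌉₊
  refine ⟨K ^ Y, one_le_pow₀ hK, fun s hs => ?_⟩
  have h1 : K ^ s.card ≤ (∏ p ∈ s, (if p < Y then K else 1)) * ∏ p ∈ s, (p : ℝ) ^ ε := by
    rw [← Finset.prod_mul_distrib, ← Finset.prod_const]
    apply Finset.prod_le_prod
    · intros; linarith
    · intro p hp
      have hp1 : (1 : ℝ) ≤ p := by exact_mod_cast (hs p hp).one_le
      split_ifs with h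
      · have := Real.one_le_rpow hp1 hε.le
        nlinarith
      · push Not at h
        rw [one_mul]
        have h3 : K ^ (1/ε) ≤ p := (Nat.le_ceil _).trans (by exact_mod_cast h)
        calc K = (K ^ (1/ε)) ^ ε := by
              rw [← Real.rpow_mul (by linarith)]; field_simp; simp
          _ ≤ _ := Real.rpow_le_rpow (by positivity) h3 hε.le
  have h2 : (∏ p ∈ s, (if p < Y then K else 1)) ≤ K ^ Y := by
    rw [Finset.prod_ite, Finset.prod_const, Finset.prod_const_one, mul_one]
    apply pow_le_pow_right₀ hK
    calc (s.filter (fun p => p < Y)).card ≤ (Finset.range Y).card := by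
          apply Finset.card_le_card
          intro p hp; simp at hp ⊢; exact hp.2
      _ = Y := Finset.card_range Y
  have h3 : ∏ p ∈ s, (p : ℝ) ^ ε = (qq s : ℝ) ^ ε := by
    rw [Real.finsetProd_rpow _ _ (fun i _ => Nat.cast_nonneg i)]
    simp [qq]
  rw [h3] at h1
  exact h1.trans (mul_le_mul_of_nonneg_right h2 (by positivity))

lemma count_ap (L m b N : ℕ) (hL : 0 < L) (hLm : Nat.Coprime L m) :
    (((Finset.range N).filter (fun n => L ∣ m * n + b)).card : ℝ) ≤ N / L + 1 := by
  have h1 : ((Finset.range N).filter (fun n => L ∣ m * n + b)).card ≤ (Finset.range (N / L + 1)).card := by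
    apply Finset.card_le_card_of_injOn (fun n => n / L)
    · intro n hn
      simp only [Finset.coe_filter, Finset.mem_range, Set.mem_setOf_eq] at hn
      simp only [Finset.coe_range, Set.mem_Iio]
      exact Nat.lt_succ_of_le (Nat.div_le_div_right hn.1.le)
    · intro n hn n' hn' h
      simp only [Finset.coe_filter, Finset.mem_range, Set.mem_setOf_eq] at hn hn'
      have h2 : m * n + b ≡ m * n' + b [MOD L] :=
        ((Nat.modEq_zero_iff_dvd).2 hn.2).trans ((Nat.modEq_zero_iff_dvd).2 hn'.2).symm
      have h3 : n ≡ n' [MOD L] := Nat.ModEq.cancel_left_of_coprime hLm (Nat.ModEq.add_right_cancel' b h2)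
      have h4 : n % L = n' % L := h3
      simp only at h
      rw [← Nat.div_add_mod n L, ← Nat.div_add_mod n' L, h, h4]
  rw [Finset.card_range] at h1
  have h2 : ((N / L : ℕ) : ℝ) ≤ N / L := Nat.cast_div_le
  have h3 : (((Finset.range N).filter (fun n => L ∣ m * n + b)).card : ℝ) ≤ ((N / L + 1 : ℕ) : ℝ) := by exact_mod_cast h1
  push_cast at h3
  linarith

/-- number of squarefree `P`-divisors at most `Q` -/
noncomputable def tq (P : Finset ℕ) (Q : ℝ) (x : ℕ) : ℕ := ((fam P Q).filter (fun u => qq u ∣ x)).card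

lemma tq_pow {P : Finset ℕ} (hP : ∀ p ∈ P, p.Prime) (Q : ℝ) (hQ : 1 ≤ Q) (k x : ℕ) :
    tq P Q x ^ k ≤ ∑ U ∈ (fam P (Q ^ k)).filter (fun u => qq u ∣ x), (2 ^ k) ^ U.card := by
  set T := (fam P Q).filter (fun u => qq u ∣ x) with hT
  set T' := (fam P (Q ^ k)).filter (fun u => qq u ∣ x) with hT'
  have h1 : tq P Q x ^ k = (Fintype.piFinset (fun _ : Fin k => T)).card := by
    rw [Fintype.card_piFinset]; simp [tq, ← hT]
  rw [h1]
  have hsub : ∀ f ∈ Fintype.piFinset (fun _ : Fin k => T), ∀ i, f i ⊆ P ∧ (qq (f i) : ℝ) ≤ Q ∧ qq (f i) ∣ x := by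
    intro f hf i
    have := Fintype.mem_piFinset.1 hf i
    rw [hT, Finset.mem_filter, mem_fam] at this
    tauto
  have hmaps : ∀ f ∈ Fintype.piFinset (fun _ : Fin k => T), Finset.univ.biUnion f ∈ T' := by
    intro f hf
    have hf' := hsub f hf
    have hsubP : ∀ s : Finset (Fin k), s.biUnion f ⊆ P := by
      intro s
      exact Finset.biUnion_subset.2 fun i _ => (hf' i).1
    rw [hT', Finset.mem_filter, mem_fam]
    refine ⟨⟨hsubP _, ?_⟩, ?_⟩
    · have : ∀ s : Finset (Fin k), (qq (s.biUnion f) : ℝ) ≤ Q ^ s.card := by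
        intro s
        induction s using Finset.induction_on with
        | empty => simp [qq]
        | insert i s his ih =>
          rw [Finset.biUnion_insert, Finset.card_insert_of_notMem his, pow_succ']
          calc (qq (f i ∪ s.biUnion f) : ℝ) ≤ ((qq (f i) * qq (s.biUnion f) : ℕ) : ℝ) := by
                exact_mod_cast qq_union_le hP (hf' i).1 (hsubP s)
            _ = qq (f i) * qq (s.biUnion f) := by push_cast; ring
            _ ≤ Q * Q ^ s.card := by
                apply mul_le_mul (hf' i).2.1 ih (by positivity) (by linarith)
      have := this Finset.univ
      simpa using this
    · rw [qq_dvd_iff hP (hsubP _)]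
      intro p hp
      obtain ⟨i, _, hi⟩ := Finset.mem_biUnion.1 hp
      exact (qq_dvd_iff hP (hf' i).1 x).1 (hf' i).2.2 p hi
  rw [Finset.card_eq_sum_card_fiberwise hmaps]
  apply Finset.sum_le_sum
  intro U hU
  calc _ ≤ (Fintype.piFinset (fun _ : Fin k => U.powerset)).card := by
        apply Finset.card_le_card
        intro f hf
        rw [Finset.mem_filter] at hf
        rw [Fintype.mem_piFinset]
        intro i
        rw [Finset.mem_powerset, ← hf.2]
        exact Finset.subset_biUnion_of_mem f (Finset.mem_univ i)
    _ = (2 ^ k) ^ U.card := by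
        rw [Fintype.card_piFinset]; simp [← pow_mul, mul_comm]

lemma moment (k : ℕ) (ε : ℝ) (hε : 0 < ε) : ∃ C : ℝ, 1 ≤ C ∧ ∀ (P : Finset ℕ) (m b N : ℕ) (Q : ℝ),
    (∀ p ∈ P, p.Prime) → (∀ p ∈ P, Nat.Coprime p m) → 1 ≤ Q → Q ^ k ≤ N →
    ∑ n ∈ Finset.range N, (tq P Q (m * n + b) : ℝ) ^ k ≤ C * N * Q ^ ε := by
  obtain ⟨C, hC, hom⟩ := omega_bound (2 ^ k) (ε / (2 * (k + 1))) (one_le_pow₀ (by norm_num)) (by positivity)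
  refine ⟨C * 2 * (1 + k * (2 / ε)), ?_, fun P m b N Q hP hPm hQ hQN => ?_⟩
  · have : 0 ≤ k * (2 / ε) := by positivity
    nlinarith
  have hcop : ∀ U ⊆ P, Nat.Coprime (qq U) m := fun U hU =>
    Nat.Coprime.prod_left fun p hp => hPm p (hU hp)
  have hQk : 1 ≤ Q ^ k := one_le_pow₀ hQ
  have hQe : 1 ≤ Q ^ (ε/2) := Real.one_le_rpow hQ (by linarith)
  calc ∑ n ∈ Finset.range N, (tq P Q (m * n + b) : ℝ) ^ k
      ≤ ∑ n ∈ Finset.range N, ∑ U ∈ fam P (Q ^ k), if qq U ∣ m * n + b then ((2:ℝ) ^ k) ^ U.card else 0 := by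
        apply Finset.sum_le_sum
        intro n _
        rw [← Finset.sum_filter]
        exact_mod_cast tq_pow hP Q hQ k (m * n + b)
    _ = ∑ U ∈ fam P (Q ^ k), ((2:ℝ) ^ k) ^ U.card * ((Finset.range N).filter (fun n => qq U ∣ m * n + b)).card := by
        rw [Finset.sum_comm]
        refine Finset.sum_congr rfl fun U _ => ?_
        rw [← Finset.sum_filter, Finset.sum_const, nsmul_eq_mul, mul_comm]
    _ ≤ ∑ U ∈ fam P (Q ^ k), (C * Q ^ (ε/2)) * (2 * N * (1 / qq U)) := by
        apply Finset.sum_le_sum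
        intro U hU
        rw [mem_fam] at hU
        have hq : 0 < qq U := qq_pos hP hU.1
        have hq' : (0:ℝ) < qq U := by exact_mod_cast hq
        have h1 := count_ap (qq U) m b N hq (hcop U hU.1)
        have h2 := hom U (fun p hp => hP p (hU.1 hp))
        apply mul_le_mul
        · refine h2.trans (mul_le_mul_of_nonneg_left ?_ (by linarith))
          calc (qq U : ℝ) ^ (ε / (2 * (k + 1))) ≤ (Q ^ k) ^ (ε / (2 * (k + 1))) :=
                Real.rpow_le_rpow hq'.le hU.2 (by positivity)
            _ = Q ^ (k * (ε / (2 * (k + 1)))) := by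
                rw [← Real.rpow_natCast, ← Real.rpow_mul (by linarith)]
            _ ≤ Q ^ (ε/2) := by
                apply Real.rpow_le_rpow_of_exponent_le hQ
                rw [mul_div_assoc', div_le_div_iff₀ (by positivity) (by positivity)]
                nlinarith
        · refine h1.trans ?_
          have : (1:ℝ) ≤ N / qq U := by
            rw [le_div_iff₀ hq']; linarith [hU.2]
          calc (N:ℝ) / qq U + 1 ≤ N / qq U + N / qq U := by linarith
            _ = _ := by ring
        · positivity
        · positivity
    _ = C * Q ^ (ε/2) * (2 * N) * ∑ U ∈ fam P (Q ^ k), (1 : ℝ) / qq U := by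
        rw [Finset.mul_sum]
        refine Finset.sum_congr rfl fun U _ => ?_
        ring
    _ ≤ C * Q ^ (ε/2) * (2 * N) * (1 + Real.log (Q ^ k)) := by
        apply mul_le_mul_of_nonneg_left (sum_inv_fam hP hQk)
        positivity
    _ ≤ C * Q ^ (ε/2) * (2 * N) * ((1 + k * (2 / ε)) * Q ^ (ε/2)) := by
        apply mul_le_mul_of_nonneg_left _ (by positivity)
        rw [Real.log_pow]
        have h3 : Real.log Q ≤ Q ^ (ε/2) / (ε/2) := Real.log_le_rpow_div (by linarith) (by linarith)
        have h4 : (k:ℝ) * Real.log Q ≤ k * (Q ^ (ε/2) / (ε/2)) := mul_le_mul_of_nonneg_left h3 (by positivity)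
        calc 1 + (k:ℝ) * Real.log Q ≤ Q ^ (ε/2) + k * (Q ^ (ε/2) / (ε/2)) := by linarith
          _ = _ := by field_simp
    _ = _ := by
        have : Q ^ ε = Q ^ (ε/2) * Q ^ (ε/2) := by
          rw [← Real.rpow_add (by linarith)]; congr 1; ring
        rw [this]; ring

end PS

namespace PS

noncomputable def xp (p n : ℕ) : ℝ := if p ∣ n then -1 else 1 / ((p:ℝ) - 1)
noncomputable def xv (v : Finset ℕ) (n : ℕ) : ℝ := ∏ p ∈ v, xp p n
noncomputable def iv (v : Finset ℕ) : ℝ := ∏ p ∈ v, 1 / ((p:ℝ) - 1)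
noncomputable def TT (P : Finset ℕ) (D : ℝ) (n : ℕ) : ℝ := ∑ s ∈ fam P D, xv s n
noncomputable def GG (P : Finset ℕ) (D : ℝ) : ℝ := ∑ s ∈ fam P D, iv s
noncomputable def SS (P : Finset ℕ) (D : ℝ) (n : ℕ) : ℝ := TT P D n ^ 2 / GG P D

abbrev Trip := (_ : Finset ℕ × Finset ℕ) × Finset ℕ

noncomputable def trips (P : Finset ℕ) (D : ℝ) : Finset Trip :=
  (fam P D ×ˢ fam P D).sigma (fun st => (st.1 ∩ st.2).powerset)
noncomputable def tv (τ : Trip) : Finset ℕ := (τ.1.1 \ τ.1.2) ∪ (τ.1.2 \ τ.1.1) ∪ τ.2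
noncomputable def tw (τ : Trip) : Finset ℕ := (τ.1.1 ∩ τ.1.2) \ τ.2
noncomputable def tk (τ : Trip) : ℝ := (∏ p ∈ τ.2, -(((p:ℝ) - 2) / (p - 1))) * iv (tw τ)
noncomputable def om (P : Finset ℕ) (D : ℝ) (v : Finset ℕ) : ℝ :=
  (∑ τ ∈ (trips P D).filter (fun τ => tv τ = v), tk τ) / GG P D

section
variable {P : Finset ℕ} {D : ℝ}

lemma iv_pos (hP : ∀ p ∈ P, p.Prime) {v : Finset ℕ} (hv : v ⊆ P) : 0 < iv v := by
  apply Finset.prod_pos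
  intro p hp
  have : (2:ℝ) ≤ p := by exact_mod_cast (hP p (hv hp)).two_le
  apply one_div_pos.2; linarith

lemma empty_mem_fam (hD : 1 ≤ D) : ∅ ∈ fam P D := by
  rw [mem_fam]; simp [qq, hD]

lemma one_le_GG (hP : ∀ p ∈ P, p.Prime) (hD : 1 ≤ D) : 1 ≤ GG P D := by
  have h1 : iv ∅ ≤ GG P D := Finset.single_le_sum (f := iv)
    (fun s hs => (iv_pos hP (mem_fam.1 hs).1).le) (empty_mem_fam hD)
  simpa [iv] using h1

lemma SS_eq_GG (hP : ∀ p ∈ P, p.Prime) (hD : 1 ≤ D) (n : ℕ) (hn : ∀ p ∈ P, ¬ p ∣ n) : SS P D n = GG P D := by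
  have h1 : TT P D n = GG P D := by
    apply Finset.sum_congr rfl
    intro s hs
    apply Finset.prod_congr rfl
    intro p hp
    rw [xp, if_neg (hn p ((mem_fam.1 hs).1 hp))]
  have := one_le_GG hP hD
  rw [SS, h1]; field_simp

lemma SS_nonneg (hP : ∀ p ∈ P, p.Prime) (hD : 1 ≤ D) (n : ℕ) : 0 ≤ SS P D n := by
  have := one_le_GG hP hD
  unfold SS; positivity

lemma xp_sq {p : ℕ} (hp : p.Prime) (n : ℕ) : xp p n ^ 2 = -(((p:ℝ) - 2) / (p - 1)) * xp p n + 1 / ((p:ℝ)-1) := by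
  have : (2:ℝ) ≤ p := by exact_mod_cast hp.two_le
  have : (p:ℝ) - 1 ≠ 0 := by linarith
  unfold xp
  split_ifs
  · field_simp; ring
  · field_simp; ring

lemma xv_mul (hP : ∀ p ∈ P, p.Prime) {s t : Finset ℕ} (hs : s ⊆ P) (ht : t ⊆ P) (n : ℕ) :
    xv s n * xv t n = ∑ u ∈ (s ∩ t).powerset, tk ⟨(s, t), u⟩ * xv (tv ⟨(s, t), u⟩) n := by
  have h1 : xv s n = xv (s \ t) n * xv (s ∩ t) n := by
    unfold xv; rw [mul_comm, Finset.prod_inter_mul_prod_diff]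
  have h2 : xv t n = xv (t \ s) n * xv (s ∩ t) n := by
    unfold xv; rw [mul_comm, Finset.inter_comm, Finset.prod_inter_mul_prod_diff]
  have h3 : xv (s ∩ t) n * xv (s ∩ t) n = ∑ u ∈ (s ∩ t).powerset,
      (∏ p ∈ u, (-(((p:ℝ) - 2) / (p - 1)) * xp p n)) * ∏ p ∈ (s ∩ t) \ u, (1 / ((p:ℝ) - 1)) := by
    rw [← Finset.prod_add]
    unfold xv
    rw [← Finset.prod_mul_distrib]
    apply Finset.prod_congr rfl
    intro p hp
    rw [← xp_sq (hP p (hs (Finset.mem_inter.1 hp).1)), sq]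
  calc xv s n * xv t n = xv (s \ t) n * xv (t \ s) n * (xv (s ∩ t) n * xv (s ∩ t) n) := by
        rw [h1, h2]; ring
    _ = _ := by
        rw [h3, Finset.mul_sum]
        apply Finset.sum_congr rfl
        intro u hu
        rw [Finset.mem_powerset] at hu
        have d1 : Disjoint (s \ t) (t \ s) := by
          rw [Finset.disjoint_left]; intro p; simp; tauto
        have d2 : Disjoint (s \ t ∪ t \ s) u := by
          rw [Finset.disjoint_left]; intro p hp hpu
          have := hu hpu
          simp at hp this; tauto
        have : xv (tv ⟨(s, t), u⟩) n = xv (s \ t) n * xv (t \ s) n * xv u n := by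
          unfold xv tv
          rw [Finset.prod_union d2, Finset.prod_union d1]
        rw [this, Finset.prod_mul_distrib]
        simp only [tk, tw, iv, xv]
        ring

lemma tv_mem (hP : ∀ p ∈ P, p.Prime) {τ : Trip} (hτ : τ ∈ trips P D) : tv τ ∈ fam P (D ^ 2) := by
  obtain ⟨⟨s, t⟩, u⟩ := τ
  simp only [trips, Finset.mem_sigma, Finset.mem_product, mem_fam, Finset.mem_powerset] at hτ
  obtain ⟨⟨⟨h1, h2⟩, h3, h4⟩, h5⟩ := hτ
  have h6 : tv ⟨(s, t), u⟩ ⊆ s ∪ t := by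
    intro p hp
    simp only [tv, Finset.mem_union, Finset.mem_sdiff] at hp ⊢
    rcases hp with (h | h) | h
    · tauto
    · tauto
    · have := h5 h; simp at this; tauto
  have h7 := Finset.union_subset h1 h3
  rw [mem_fam]
  refine ⟨h6.trans h7, ?_⟩
  calc (qq (tv ⟨(s, t), u⟩) : ℝ) ≤ ((qq s * qq t : ℕ) : ℝ) := by
        exact_mod_cast (qq_mono hP h7 h6).trans (qq_union_le hP h1 h3)
    _ = qq s * qq t := by push_cast; ring
    _ ≤ D ^ 2 := by rw [sq]; exact mul_le_mul h2 h4 (by positivity) (by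
          have : (0:ℝ) ≤ qq s := by positivity
          linarith)

lemma SS_expand (hP : ∀ p ∈ P, p.Prime) (n : ℕ) : SS P D n = ∑ v ∈ fam P (D ^ 2), om P D v * xv v n := by
  have h1 : TT P D n ^ 2 = ∑ τ ∈ trips P D, tk τ * xv (tv τ) n := by
    rw [trips, Finset.sum_sigma, Finset.sum_product, sq, TT, Finset.sum_mul_sum]
    apply Finset.sum_congr rfl
    intro s hs
    apply Finset.sum_congr rfl
    intro t ht
    exact xv_mul hP (mem_fam.1 hs).1 (mem_fam.1 ht).1 n
  rw [SS, h1, ← Finset.sum_fiberwise_of_maps_to (g := tv) (t := fam P (D^2)) (fun τ hτ => tv_mem hP hτ), Finset.sum_div]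
  apply Finset.sum_congr rfl
  intro v _
  rw [om, div_mul_eq_mul_div, Finset.sum_mul]
  congr 1
  apply Finset.sum_congr rfl
  intro τ hτ
  rw [(Finset.mem_filter.1 hτ).2]

lemma tk_le (hP : ∀ p ∈ P, p.Prime) {τ : Trip} (hτ : τ ∈ trips P D) : |tk τ| ≤ iv (tw τ) := by
  obtain ⟨⟨s, t⟩, u⟩ := τ
  simp only [trips, Finset.mem_sigma, Finset.mem_product, mem_fam, Finset.mem_powerset] at hτ
  obtain ⟨⟨⟨h1, h2⟩, h3, h4⟩, h5⟩ := hτ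
  have h6 : tw ⟨(s,t),u⟩ ⊆ P := by
    intro p hp
    simp only [tw, Finset.mem_sdiff, Finset.mem_inter] at hp
    exact h1 hp.1.1
  have h7 := iv_pos hP h6
  rw [tk, abs_mul, abs_of_pos h7]
  apply mul_le_of_le_one_left h7.le
  rw [Finset.abs_prod]
  apply Finset.prod_le_one
  · intros; positivity
  · intro p hp
    have hp' := hP p (h1 (Finset.mem_inter.1 (h5 hp)).1)
    have : (2:ℝ) ≤ p := by exact_mod_cast hp'.two_le
    rw [abs_neg, abs_of_nonneg (div_nonneg (by linarith) (by linarith)), div_le_one (by linarith)]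
    linarith

lemma om_le (hP : ∀ p ∈ P, p.Prime) (hD : 1 ≤ D) (v : Finset ℕ) : |om P D v| ≤ 4 ^ v.card := by
  have hG := one_le_GG hP hD
  rw [om, abs_div, abs_of_pos (show 0 < GG P D by linarith), div_le_iff₀ (by linarith)]
  refine (Finset.abs_sum_le_sum_abs _ _).trans ?_
  set A := (trips P D).filter (fun τ => tv τ = v) with hA
  let g : Trip → (Finset ℕ × Finset ℕ) × Finset ℕ := fun τ => ((τ.1.1 \ τ.1.2, τ.2), tw τ)
  have hinj : Set.InjOn g A := by
    rintro ⟨⟨s, t⟩, u⟩ h1 ⟨⟨s', t'⟩, u'⟩ h2 h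
    simp only [hA, Finset.coe_filter, Set.mem_setOf_eq, trips, Finset.mem_sigma, Finset.mem_product,
      mem_fam, Finset.mem_powerset] at h1 h2
    simp only [g, Prod.mk.injEq, tw] at h
    obtain ⟨⟨e1, e2⟩, e3⟩ := h
    obtain ⟨⟨_, h1u⟩, h1v⟩ := h1
    obtain ⟨⟨_, h2u⟩, h2v⟩ := h2
    have e4 := h1v.trans h2v.symm
    simp only [tv] at e4
    subst e2
    have key : ∀ p, (p ∈ s ↔ p ∈ s') ∧ (p ∈ t ↔ p ∈ t') := by
      intro p
      have a1 := Finset.ext_iff.1 e1 p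
      have a3 := Finset.ext_iff.1 e3 p
      have a4 := Finset.ext_iff.1 e4 p
      have b1 := @h1u p
      have b2 := @h2u p
      simp only [Finset.mem_sdiff, Finset.mem_inter, Finset.mem_union] at a1 a3 a4 b1 b2
      clear e1 e3 e4 h1v h2v h1u h2u
      grind
    have k1 : s = s' := Finset.ext fun p => (key p).1
    have k2 : t = t' := Finset.ext fun p => (key p).2
    subst k1 k2
    rfl
  have hnn : ∀ w ∈ fam P D, 0 ≤ iv w := fun w hw => (iv_pos hP (mem_fam.1 hw).1).le
  calc ∑ τ ∈ A, |tk τ| ≤ ∑ τ ∈ A, iv ((g τ).2) :=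
        Finset.sum_le_sum fun τ hτ => tk_le hP (Finset.mem_filter.1 hτ).1
    _ = ∑ z ∈ A.image g, iv z.2 := by rw [Finset.sum_image hinj]
    _ ≤ ∑ z ∈ (v.powerset ×ˢ v.powerset) ×ˢ fam P D, iv z.2 := by
        apply Finset.sum_le_sum_of_subset_of_nonneg
        · intro z hz
          obtain ⟨⟨⟨s, t⟩, u⟩, hτ, rfl⟩ := Finset.mem_image.1 hz
          simp only [hA, Finset.mem_filter, trips, Finset.mem_sigma, Finset.mem_product,
            mem_fam, Finset.mem_powerset] at hτ
          obtain ⟨⟨⟨⟨h1, h2⟩, h3, h4⟩, h5⟩, h6⟩ := hτ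
          simp only [g, Finset.mem_product, Finset.mem_powerset, mem_fam]
          have h7 : tw ⟨(s,t),u⟩ ⊆ s := by
            intro p hp
            simp only [tw, Finset.mem_sdiff, Finset.mem_inter] at hp
            exact hp.1.1
          refine ⟨⟨?_, ?_⟩, h7.trans h1, ?_⟩
          · rw [← h6]; intro p hp; simp only [tv, Finset.mem_union]; tauto
          · rw [← h6]; intro p hp; simp only [tv, Finset.mem_union]; tauto
          · exact (Nat.cast_le.2 (qq_mono hP h1 h7)).trans h2
        · intro z hz _
          exact hnn _ (Finset.mem_product.1 hz).2
    _ = 4 ^ v.card * GG P D := by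
        rw [Finset.sum_product]
        simp only [GG, Finset.sum_const, nsmul_eq_mul, Finset.card_product, Finset.card_powerset]
        push_cast
        rw [← mul_pow]; norm_num
end
end PS

namespace PS

noncomputable def JJ (P : Finset ℕ) (v : Finset ℕ) (p : ↥P) : Finset ℕ :=
  if p.1 ∈ v then Finset.Ico 1 p.1 else {0}
noncomputable def AA (P : Finset ℕ) (v : Finset ℕ) : Finset (↥P → ℕ) := Fintype.piFinset (JJ P v)
noncomputable def th {P : Finset ℕ} (a : ↥P → ℕ) : ℝ := ∑ p : ↥P, (a p : ℝ) / (p.1 : ℝ)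
noncomputable def sg (v : Finset ℕ) : ℝ := ∏ p ∈ v, -(1 / ((p:ℝ) - 1))

lemma e_eq_one_iff (t : ℝ) : e t = 1 ↔ ∃ k : ℤ, t = k := by
  unfold e
  rw [Complex.exp_eq_one_iff]
  constructor
  · rintro ⟨k, hk⟩
    refine ⟨k, ?_⟩
    have : (2 * π * Complex.I : ℂ) ≠ 0 := Complex.two_pi_I_ne_zero
    have h2 : (2 * π * Complex.I) * (t : ℂ) = (2 * π * Complex.I) * (k : ℂ) := by rw [hk]; ring
    have h3 := mul_left_cancel₀ this h2
    exact_mod_cast h3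
  · rintro ⟨k, hk⟩
    refine ⟨k, ?_⟩
    rw [hk]; push_cast; ring

lemma e_sum {ι : Type*} (s : Finset ι) (f : ι → ℝ) : e (∑ i ∈ s, f i) = ∏ i ∈ s, e (f i) := by
  induction s using Finset.induction_on with
  | empty => simp [e_zero]
  | insert i s hi ih => rw [Finset.sum_insert hi, Finset.prod_insert hi, e_add, ih]

lemma sum_e_prime (p n : ℕ) (hp : p.Prime) :
    ∑ a ∈ Finset.Ico 1 p, e ((n:ℝ) * ((a:ℝ) / p)) = if p ∣ n then (p:ℂ) - 1 else -1 := by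
  have hp0 : (p:ℝ) ≠ 0 := by exact_mod_cast hp.ne_zero
  have h1 : ∑ a ∈ Finset.range p, e ((n:ℝ) * ((a:ℝ) / p)) = if p ∣ n then (p:ℂ) else 0 := by
    have h2 : ∀ a : ℕ, e ((n:ℝ) * ((a:ℝ) / p)) = e ((n:ℝ) / p) ^ a := by
      intro a; rw [← e_nat_mul]; congr 1; ring
    simp only [h2]
    split_ifs with h
    · obtain ⟨k, rfl⟩ := h
      have : e (((p * k : ℕ) : ℝ) / p) = 1 := by
        rw [e_eq_one_iff]; exact ⟨k, by push_cast; field_simp⟩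
      rw [this]; simp
    · have hne : e ((n:ℝ) / p) ≠ 1 := by
        rw [Ne, e_eq_one_iff]
        rintro ⟨k, hk⟩
        rw [div_eq_iff hp0] at hk
        apply h
        have h3 : (n:ℤ) = k * p := by exact_mod_cast hk
        exact Int.natCast_dvd_natCast.1 ⟨k, by rw [h3]; ring⟩
      rw [geom_sum_eq hne, ← e_nat_mul]
      have : e ((p:ℝ) * ((n:ℝ)/p)) = 1 := by
        rw [e_eq_one_iff]; exact ⟨n, by push_cast; field_simp⟩
      rw [this]; simp
  rw [Finset.range_eq_Ico, Finset.sum_eq_sum_Ico_succ_bot hp.pos] at h1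
  simp only [Nat.cast_zero, zero_div, mul_zero, e_zero, zero_add] at h1
  split_ifs at h1 ⊢ <;> linear_combination h1

section
variable {P : Finset ℕ}

lemma xv_expand (hP : ∀ p ∈ P, p.Prime) {v : Finset ℕ} (hv : v ⊆ P) (n : ℕ) :
    (xv v n : ℂ) = sg v * ∑ a ∈ AA P v, e ((n:ℝ) * th a) := by
  have h1 : ∑ a ∈ AA P v, e ((n:ℝ) * th a) = ∏ p : ↥P, ∑ j ∈ JJ P v p, e ((n:ℝ) * ((j:ℝ) / p.1)) := by
    rw [Finset.prod_univ_sum, AA]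
    apply Finset.sum_congr rfl
    intro a _
    rw [th, Finset.mul_sum, e_sum]
  have h2 : ∀ p : ↥P, ∑ j ∈ JJ P v p, e ((n:ℝ) * ((j:ℝ) / p.1)) =
      (fun p : ℕ => if p ∈ v then (if p ∣ n then (p:ℂ) - 1 else -1) else 1) p.1 := by
    intro p
    simp only [JJ]
    split_ifs with h h3
    · rw [sum_e_prime _ _ (hP p.1 p.2), if_pos h3]
    · rw [sum_e_prime _ _ (hP p.1 p.2), if_neg h3]
    · simp [e_zero]
  rw [h1, Finset.prod_congr rfl (fun p _ => h2 p), Finset.prod_coe_sort P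
    (fun p : ℕ => if p ∈ v then (if p ∣ n then (p:ℂ) - 1 else -1) else 1), Finset.prod_ite_mem,
    Finset.inter_eq_right.2 hv]
  unfold xv sg
  push_cast
  rw [← Finset.prod_mul_distrib]
  apply Finset.prod_congr rfl
  intro p hp
  have h3 : ((p:ℂ) - 1) ≠ 0 := by
    have := (hP p (hv hp)).one_lt
    rw [sub_ne_zero]; exact_mod_cast this.ne'
  unfold xp
  split_ifs
  · push_cast; field_simp
  · push_cast; field_simp

lemma abs_sg (hP : ∀ p ∈ P, p.Prime) {v : Finset ℕ} (hv : v ⊆ P) : |sg v| = iv v := by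
  unfold sg iv
  rw [Finset.abs_prod]
  apply Finset.prod_congr rfl
  intro p hp
  have : (2:ℝ) ≤ p := by exact_mod_cast (hP p (hv hp)).two_le
  rw [abs_neg, abs_of_nonneg (one_div_nonneg.2 (by linarith))]

lemma card_AA (hP : ∀ p ∈ P, p.Prime) {v : Finset ℕ} (hv : v ⊆ P) : iv v * (AA P v).card = 1 := by
  have h1 : (AA P v).card = ∏ p : ↥P, (fun p : ℕ => if p ∈ v then (p - 1) else 1) p.1 := by
    rw [AA, Fintype.card_piFinset]
    apply Finset.prod_congr rfl
    intro p _
    simp only [JJ]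
    split_ifs <;> simp
  rw [h1, Finset.prod_coe_sort P (fun p : ℕ => if p ∈ v then (p - 1) else 1), Finset.prod_ite_mem,
    Finset.inter_eq_right.2 hv, iv]
  push_cast
  rw [← Finset.prod_mul_distrib]
  apply Finset.prod_eq_one
  intro p hp
  have : (2:ℝ) ≤ p := by exact_mod_cast (hP p (hv hp)).two_le
  rw [Nat.cast_sub (hP p (hv hp)).one_le]
  have : (p:ℝ) - 1 ≠ 0 := by linarith
  push_cast
  field_simp

lemma AA_supp {v : Finset ℕ} {a : ↥P → ℕ} (ha : a ∈ AA P v) (p : ↥P) : (a p ≠ 0 ↔ p.1 ∈ v) ∧ (p.1 ∈ v → a p < p.1) := by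
  have := Fintype.mem_piFinset.1 ha p
  unfold JJ at this
  split_ifs at this with h
  · rw [Finset.mem_Ico] at this
    exact ⟨⟨fun _ => h, fun _ => by omega⟩, fun _ => this.2⟩
  · rw [Finset.mem_singleton] at this
    exact ⟨⟨fun h => absurd this h, fun h' => absurd h' h⟩, fun h' => absurd h' h⟩

lemma nint_div_ge (k : ℤ) (q : ℕ) (hq : 0 < q) (h : ¬ (q:ℤ) ∣ k) : 1 / (q:ℝ) ≤ nint ((k:ℝ) / q) := by
  have hq' : (0:ℝ) < q := by exact_mod_cast hq
  unfold nint
  set r := round ((k:ℝ)/q)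
  have h1 : (k:ℝ)/q - r = ((k - q * r : ℤ) : ℝ) / q := by push_cast; field_simp
  rw [h1, abs_div, abs_of_pos hq']
  apply div_le_div_of_nonneg_right _ hq'.le
  have h2 : k - q * r ≠ 0 := by
    intro h0; apply h; exact ⟨r, by linarith⟩
  have h3 := Int.one_le_abs h2
  exact_mod_cast h3

lemma spacing (hP : ∀ p ∈ P, p.Prime) (m : ℕ) (hm : ∀ p ∈ P, Nat.Coprime p m) {v w : Finset ℕ} (hv : v ⊆ P) (hw : w ⊆ P) {a a' : ↥P → ℕ}
    (ha : a ∈ AA P v) (ha' : a' ∈ AA P w) (hne : a ≠ a') :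
    1 / (qq (v ∪ w) : ℝ) ≤ nint (m * (th a - th a')) := by
  set u := v ∪ w with hu
  have huP : u ⊆ P := Finset.union_subset hv hw
  have hq := qq_pos hP huP
  set c : ↥P → ℤ := fun p => (a p : ℤ) - a' p with hc
  set K : ℤ := ∑ p : ↥P, c p * qq (u.erase p.1) with hK
  have hc0 : ∀ p : ↥P, p.1 ∉ u → c p = 0 := by
    intro p hp
    rw [hu, Finset.mem_union, not_or] at hp
    have h1 : a p = 0 := by by_contra h; exact hp.1 ((AA_supp ha p).1.1 h)
    have h2 : a' p = 0 := by by_contra h; exact hp.2 ((AA_supp ha' p).1.1 h)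
    simp [hc, h1, h2]
  have hclt : ∀ p : ↥P, |c p| < p.1 := by
    intro p
    have hpp := (hP p.1 p.2).pos
    have h1 : a p < p.1 := by
      by_cases h : p.1 ∈ v
      · exact (AA_supp ha p).2 h
      · have : a p = 0 := by by_contra h'; exact h ((AA_supp ha p).1.1 h')
        omega
    have h2 : a' p < p.1 := by
      by_cases h : p.1 ∈ w
      · exact (AA_supp ha' p).2 h
      · have : a' p = 0 := by by_contra h'; exact h ((AA_supp ha' p).1.1 h')
        omega
    rw [abs_lt]; simp only [hc]; omega
  have hqp : ∀ p ∈ u, qq u = p * qq (u.erase p) := fun p hp => (Finset.mul_prod_erase u (fun p => p) hp).symm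
  have hth : m * (th a - th a') = ((m * K : ℤ) : ℝ) / qq u := by
    have : th a - th a' = (K:ℝ) / qq u := by
      rw [th, th, ← Finset.sum_sub_distrib, hK]
      push_cast
      rw [Finset.sum_div]
      apply Finset.sum_congr rfl
      intro p _
      have hp0 : (p.1:ℝ) ≠ 0 := by exact_mod_cast (hP p.1 p.2).ne_zero
      by_cases hpu : p.1 ∈ u
      · have hqr : (qq u : ℝ) = p.1 * qq (u.erase p.1) := by exact_mod_cast hqp p.1 hpu
        have : (qq (u.erase p.1) : ℝ) ≠ 0 := by
          exact_mod_cast (qq_pos hP ((Finset.erase_subset _ _).trans huP)).ne'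
        rw [hqr]; simp only [hc]; push_cast; field_simp
      · have h3 : ((c p : ℤ):ℝ) = 0 := by rw [hc0 p hpu]; simp
        have h4 := h3
        simp only [hc] at h4
        push_cast at h4
        rw [h3, ← sub_div, h4]; simp
    rw [this]; push_cast; ring
  rw [hth]
  apply nint_div_ge _ _ hq
  intro hdvd
  apply hne
  funext p0
  by_contra hp0
  have hc1 : c p0 ≠ 0 := by simp only [hc]; omega
  have hp0u : p0.1 ∈ u := by by_contra h; exact hc1 (hc0 p0 h)
  have hpp := hP p0.1 p0.2
  have hprime : Prime (p0.1 : ℤ) := Nat.prime_iff_prime_int.1 hpp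
  have h1 : (p0.1:ℤ) ∣ m * K := dvd_trans (by exact_mod_cast Finset.dvd_prod_of_mem _ hp0u) hdvd
  have h2 : (p0.1:ℤ) ∣ K := by
    rcases hprime.dvd_or_dvd h1 with h | h
    · exfalso
      have h' := Int.natCast_dvd_natCast.1 h
      have := hm p0.1 p0.2
      exact hpp.one_lt.ne' (Nat.Coprime.eq_one_of_dvd this h')
    · exact h
  have h3 : (p0.1:ℤ) ∣ c p0 * qq (u.erase p0.1) := by
    rw [hK, ← Finset.add_sum_erase _ _ (Finset.mem_univ p0)] at h2
    refine (dvd_add_left ?_).1 h2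
    apply Finset.dvd_sum
    intro p hp
    have hpne : p ≠ p0 := (Finset.mem_erase.1 hp).1
    apply Dvd.dvd.mul_left
    apply Int.natCast_dvd_natCast.2
    apply Finset.dvd_prod_of_mem (fun p => p)
    rw [Finset.mem_erase]
    exact ⟨fun h => hpne (Subtype.ext h.symm), hp0u⟩
  rcases hprime.dvd_or_dvd h3 with h | h
  · exact hc1 (Int.eq_zero_of_abs_lt_dvd h (hclt p0))
  · have h' := Int.natCast_dvd_natCast.1 h
    have h4 := (Prime.dvd_finset_prod_iff hpp.prime (fun p => p)).1 h'
    obtain ⟨p, hp, hpd⟩ := h4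
    rw [Finset.mem_erase] at hp
    exact hp.1 ((Nat.prime_dvd_prime_iff_eq hpp (hP p (huP hp.2))).1 hpd).symm
end
end PS

namespace PS

noncomputable def SV (P : Finset ℕ) (D : ℝ) (V : Finset (Finset ℕ)) (n : ℕ) : ℝ := ∑ v ∈ V, om P D v * xv v n

lemma one_bad {ι : Type*} (I : Finset ι) (co f : ι → ℝ) (cm A B : ℝ) (hco : ∀ i ∈ I, 0 ≤ co i)
    (hcm : ∀ i ∈ I, co i ≤ cm) (hcm0 : 0 ≤ cm) (hA0 : 0 ≤ A) (hB : 0 ≤ B) (hA : ∀ i ∈ I, f i ≤ A)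
    (h : ∀ i ∈ I, ∀ j ∈ I, i ≠ j → f i ≤ B ∨ f j ≤ B) :
    ∑ i ∈ I, co i * f i ≤ cm * A + B * ∑ i ∈ I, co i := by
  by_cases hb : ∃ i ∈ I, ¬ f i ≤ B
  · obtain ⟨i, hi, hfi⟩ := hb
    rw [← Finset.add_sum_erase I _ hi]
    apply add_le_add
    · calc co i * f i ≤ co i * A := mul_le_mul_of_nonneg_left (hA i hi) (hco i hi)
        _ ≤ cm * A := mul_le_mul_of_nonneg_right (hcm i hi) hA0
    · rw [Finset.mul_sum]
      calc ∑ j ∈ I.erase i, co j * f j ≤ ∑ j ∈ I.erase i, B * co j := by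
            apply Finset.sum_le_sum
            intro j hj
            rw [Finset.mem_erase] at hj
            rcases h i hi j hj.2 hj.1.symm with h1 | h1
            · exact absurd h1 hfi
            · rw [mul_comm]; exact mul_le_mul_of_nonneg_right h1 (hco j hj.2)
        _ ≤ _ := Finset.sum_le_sum_of_subset_of_nonneg (Finset.erase_subset _ _)
            (fun j hj _ => mul_nonneg hB (hco j hj))
  · push Not at hb
    have : 0 ≤ cm * A := mul_nonneg hcm0 hA0
    rw [Finset.mul_sum]
    have h2 : ∑ i ∈ I, co i * f i ≤ ∑ i ∈ I, B * co i := by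
      apply Finset.sum_le_sum
      intro j hj
      rw [mul_comm]; exact mul_le_mul_of_nonneg_right (hb j hj) (hco j hj)
    linarith

section
variable {P : Finset ℕ} {D : ℝ}

lemma SS_eq_SV (hP : ∀ p ∈ P, p.Prime) (n : ℕ) : SS P D n = SV P D (fam P (D^2)) n := SS_expand hP n

lemma SV_expand (hP : ∀ p ∈ P, p.Prime) {V : Finset (Finset ℕ)} (hV : V ⊆ fam P (D^2)) (n : ℕ) :
    (SV P D V n : ℂ) = ∑ i ∈ V.sigma (fun v => AA P v), ((om P D i.1 * sg i.1 : ℝ) : ℂ) * e ((n:ℝ) * th i.2) := by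
  rw [Finset.sum_sigma, SV]
  push_cast
  apply Finset.sum_congr rfl
  intro v hv
  rw [xv_expand hP (mem_fam.1 (hV hv)).1, ← mul_assoc, Finset.mul_sum]

lemma coef_le (hP : ∀ p ∈ P, p.Prime) (hD : 1 ≤ D) {v : Finset ℕ} (hv : v ⊆ P) : |om P D v * sg v| ≤ 4 ^ v.card * iv v := by
  rw [abs_mul, abs_sg hP hv]
  exact mul_le_mul_of_nonneg_right (om_le hP hD v) (iv_pos hP hv).le

lemma two_pow_le (hP : ∀ p ∈ P, p.Prime) {v : Finset ℕ} (hv : v ⊆ P) : (2:ℝ) ^ v.card ≤ qq v := by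
  have : 2 ^ v.card ≤ qq v := by
    rw [← Finset.prod_const, qq]
    exact Finset.prod_le_prod' fun p hp => (hP p (hv hp)).two_le
  exact_mod_cast this

lemma coef_sum (hP : ∀ p ∈ P, p.Prime) (hD : 1 ≤ D) {V : Finset (Finset ℕ)} (hV : V ⊆ fam P (D^2)) :
    ∑ i ∈ V.sigma (fun v => AA P v), |om P D i.1 * sg i.1| ≤ D ^ 6 := by
  have hD2 : 1 ≤ D ^ 2 := one_le_pow₀ hD
  calc ∑ i ∈ V.sigma (fun v => AA P v), |om P D i.1 * sg i.1|
      ≤ ∑ i ∈ (fam P (D^2)).sigma (fun v => AA P v), |om P D i.1 * sg i.1| :=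
        Finset.sum_le_sum_of_subset_of_nonneg (Finset.sigma_mono hV (fun _ => le_rfl)) (fun _ _ _ => abs_nonneg _)
    _ = ∑ v ∈ fam P (D^2), (AA P v).card * |om P D v * sg v| := by
        rw [Finset.sum_sigma]; simp
    _ ≤ ∑ v ∈ fam P (D^2), (D^4) := by
        apply Finset.sum_le_sum
        intro v hv
        rw [mem_fam] at hv
        calc (AA P v).card * |om P D v * sg v| ≤ (AA P v).card * (4 ^ v.card * iv v) :=
              mul_le_mul_of_nonneg_left (coef_le hP hD hv.1) (by positivity)
          _ = 4 ^ v.card * (iv v * (AA P v).card) := by ring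
          _ = (2 ^ v.card) ^ 2 := by rw [card_AA hP hv.1, mul_one, ← pow_mul, mul_comm, pow_mul]; norm_num
          _ ≤ (D^2) ^ 2 := by
              apply pow_le_pow_left₀ (by positivity)
              exact (two_pow_le hP hv.1).trans hv.2
          _ = D ^ 4 := by ring
    _ = (fam P (D^2)).card * D ^ 4 := by simp
    _ ≤ D ^ 2 * D ^ 4 := mul_le_mul_of_nonneg_right (card_fam_dvd hP hD2) (by positivity)
    _ = D ^ 6 := by ring

lemma SS_weighted (hP : ∀ p ∈ P, p.Prime) (hD : 1 ≤ D) (m b : ℕ) (I : Finset ℕ) (g : ℕ → ℂ) (B : ℝ)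
    (hB : ∀ θ : ℝ, ‖∑ n ∈ I, g n * e ((n:ℝ) * θ)‖ ≤ B) :
    ‖∑ n ∈ I, (SS P D (m * n + b) : ℂ) * g n‖ ≤ D ^ 6 * B := by
  have h1 : ∑ n ∈ I, (SS P D (m * n + b) : ℂ) * g n =
      ∑ i ∈ (fam P (D^2)).sigma (fun v => AA P v), ((om P D i.1 * sg i.1 : ℝ) : ℂ) * e ((b:ℝ) * th i.2) *
        ∑ n ∈ I, g n * e ((n:ℝ) * (m * th i.2)) := by
    simp only [Finset.mul_sum]
    rw [Finset.sum_comm]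
    apply Finset.sum_congr rfl
    intro n _
    rw [SS_eq_SV hP, SV_expand hP le_rfl, Finset.sum_mul]
    apply Finset.sum_congr rfl
    intro i _
    have : ((m * n + b : ℕ) : ℝ) * th i.2 = (b:ℝ) * th i.2 + (n:ℝ) * (m * th i.2) := by push_cast; ring
    rw [this, e_add]; ring
  rw [h1]
  have hB0 : 0 ≤ B := (norm_nonneg _).trans (hB 0)
  calc _ ≤ ∑ i ∈ (fam P (D^2)).sigma (fun v => AA P v), |om P D i.1 * sg i.1| * B := by
        refine (norm_sum_le _ _).trans (Finset.sum_le_sum fun i _ => ?_)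
        rw [norm_mul, norm_mul, norm_e, mul_one, Complex.norm_real, Real.norm_eq_abs]
        exact mul_le_mul_of_nonneg_left (hB _) (abs_nonneg _)
    _ ≤ _ := by
        rw [← Finset.sum_mul]
        exact mul_le_mul_of_nonneg_right (coef_sum hP hD le_rfl) hB0

lemma sieve_sum (hP : ∀ p ∈ P, p.Prime) (hD : 1 ≤ D) (m b N : ℕ) (hm : ∀ p ∈ P, Nat.Coprime p m) {V : Finset (Finset ℕ)} (hV : V ⊆ fam P (D^2))
    (cm : ℝ) (hcm0 : 0 ≤ cm) (hcm : ∀ v ∈ V, 4 ^ v.card * iv v ≤ cm) (θ : ℝ) :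
    ‖∑ n ∈ Finset.range N, (SV P D V (m * n + b) : ℂ) * e ((n:ℝ) * θ)‖ ≤ cm * N + 2 * D ^ 10 := by
  have h1 : ∑ n ∈ Finset.range N, (SV P D V (m * n + b) : ℂ) * e ((n:ℝ) * θ) =
      ∑ i ∈ V.sigma (fun v => AA P v), ((om P D i.1 * sg i.1 : ℝ) : ℂ) * e ((b:ℝ) * th i.2) *
        ∑ n ∈ Finset.range N, e ((n:ℝ) * (m * th i.2 + θ)) := by
    simp only [Finset.mul_sum]
    rw [Finset.sum_comm]
    apply Finset.sum_congr rfl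
    intro n _
    rw [SV_expand hP hV, Finset.sum_mul]
    apply Finset.sum_congr rfl
    intro i _
    have : (n:ℝ) * (m * th i.2 + θ) = (n:ℝ) * (m * th i.2) + n * θ := by ring
    have h' : ((m * n + b : ℕ) : ℝ) * th i.2 = (b:ℝ) * th i.2 + (n:ℝ) * (m * th i.2) := by push_cast; ring
    rw [this, h', e_add, e_add]; ring
  rw [h1]
  have hD0 : 0 < D := by linarith
  set f : ((_ : Finset ℕ) × (↥P → ℕ)) → ℝ := fun i => ‖∑ n ∈ Finset.range N, e ((n:ℝ) * (m * th i.2 + θ))‖ with hf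
  calc _ ≤ ∑ i ∈ V.sigma (fun v => AA P v), |om P D i.1 * sg i.1| * f i := by
        refine (norm_sum_le _ _).trans (Finset.sum_le_sum fun i _ => ?_)
        rw [norm_mul, norm_mul, norm_e, mul_one, Complex.norm_real, Real.norm_eq_abs]
    _ ≤ cm * N + (2 * D ^ 4) * ∑ i ∈ V.sigma (fun v => AA P v), |om P D i.1 * sg i.1| := by
        apply one_bad
        · intros; positivity
        · rintro ⟨v, a⟩ hi
          rw [Finset.mem_sigma] at hi
          exact (coef_le hP hD (mem_fam.1 (hV hi.1)).1).trans (hcm v hi.1)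
        · exact hcm0
        · positivity
        · positivity
        · intro i _
          refine (norm_sum_e_le _ _).trans ?_
          simp
        · rintro ⟨v, a⟩ hi ⟨w, a'⟩ hj hij
          rw [Finset.mem_sigma] at hi hj
          simp only at hi hj
          have hv := mem_fam.1 (hV hi.1)
          have hw := mem_fam.1 (hV hj.1)
          have hne : a ≠ a' := by
            rintro rfl
            apply hij
            have : v = w := by
              ext p
              constructor
              · intro hp
                exact (AA_supp hj.2 ⟨p, hv.1 hp⟩).1.1 ((AA_supp hi.2 ⟨p, hv.1 hp⟩).1.2 hp)
              · intro hp
                exact (AA_supp hi.2 ⟨p, hw.1 hp⟩).1.1 ((AA_supp hj.2 ⟨p, hw.1 hp⟩).1.2 hp)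
            rw [this]
          have hsp := spacing hP m hm hv.1 hw.1 hi.2 hj.2 hne
          have hquP := Finset.union_subset hv.1 hw.1
          have hqp : (0:ℝ) < qq (v ∪ w) := by exact_mod_cast qq_pos hP hquP
          have hq4 : (qq (v ∪ w) : ℝ) ≤ D ^ 4 := by
            calc (qq (v ∪ w) : ℝ) ≤ ((qq v * qq w : ℕ) : ℝ) := by exact_mod_cast qq_union_le hP hv.1 hw.1
              _ = qq v * qq w := by push_cast; ring
              _ ≤ D^2 * D^2 := mul_le_mul hv.2 hw.2 (by positivity) (by positivity)
              _ = D ^ 4 := by ring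
          have hsp2 : 1 / D ^ 4 ≤ nint (m * (th a - th a')) :=
            (one_div_le_one_div_of_le hqp hq4).trans hsp
          have hsplit : nint (m * (th a - th a')) ≤ nint (m * th a + θ) + nint (m * th a' + θ) := by
            rw [← nint_neg (m * th a' + θ)]
            refine le_trans (le_of_eq ?_) (nint_add_le _ _)
            congr 1; ring
          have hΔ : 0 < 1 / (2 * D ^ 4) := by positivity
          have hhalf : 1 / D^4 = 1 / (2 * D^4) + 1 / (2 * D^4) := by field_simp; norm_num
          have hgeo : ∀ a : ↥P → ℕ, 1 / (2 * D ^ 4) ≤ nint (m * th a + θ) →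
              ‖∑ n ∈ Finset.range N, e ((n:ℝ) * (m * th a + θ))‖ ≤ 2 * D ^ 4 := by
            intro a ha
            have := geom_bound N _ _ hΔ ha
            rwa [one_div_one_div] at this
          rcases le_or_gt (1 / (2 * D ^ 4)) (nint (m * th a + θ)) with h | h
          · left; exact hgeo a h
          · right; apply hgeo a'; linarith
    _ ≤ cm * N + (2 * D ^ 4) * D ^ 6 := by
        have := mul_le_mul_of_nonneg_left (coef_sum hP hD hV) (show 0 ≤ 2 * D ^ 4 by positivity)
        linarith
    _ = _ := by ring

/-- coefficient size -/
lemma coef_small : ∃ C : ℝ, 1 ≤ C ∧ ∀ (P : Finset ℕ), (∀ p ∈ P, p.Prime) → ∀ v ⊆ P,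
    4 ^ v.card * iv v ≤ C * (qq v : ℝ) ^ (-(3/4) : ℝ) := by
  obtain ⟨C, hC, h⟩ := omega_bound 8 (1/4) (by norm_num) (by norm_num)
  refine ⟨C, hC, fun P hP v hv => ?_⟩
  have hq : (0:ℝ) < qq v := by exact_mod_cast qq_pos hP hv
  have h1 : iv v ≤ 2 ^ v.card / qq v := by
    have : (2:ℝ) ^ v.card / qq v = ∏ p ∈ v, (2 / (p:ℝ)) := by
      rw [Finset.prod_div_distrib, Finset.prod_const, qq]; push_cast; rfl
    rw [this, iv]
    apply Finset.prod_le_prod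
    · intro p hp
      have : (2:ℝ) ≤ p := by exact_mod_cast (hP p (hv hp)).two_le
      exact one_div_nonneg.2 (by linarith)
    · intro p hp
      have : (2:ℝ) ≤ p := by exact_mod_cast (hP p (hv hp)).two_le
      rw [div_le_div_iff₀ (by linarith) (by linarith)]
      linarith
  calc (4:ℝ) ^ v.card * iv v ≤ 4 ^ v.card * (2 ^ v.card / qq v) := mul_le_mul_of_nonneg_left h1 (by positivity)
    _ = 8 ^ v.card / qq v := by rw [← mul_div_assoc, ← mul_pow]; norm_num
    _ ≤ C * (qq v : ℝ) ^ (1/4 : ℝ) / qq v := by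
        apply div_le_div_of_nonneg_right _ hq.le
        exact h v (fun p hp => hP p (hv hp))
    _ = _ := by
        rw [mul_div_assoc, ← Real.rpow_sub_one hq.ne']; norm_num
end
end PS

namespace PS

lemma iv_le {P : Finset ℕ} (hP : ∀ p ∈ P, p.Prime) {v : Finset ℕ} (hv : v ⊆ P) : iv v ≤ 2 ^ v.card / qq v := by
  have : (2:ℝ) ^ v.card / qq v = ∏ p ∈ v, (2 / (p:ℝ)) := by
    rw [Finset.prod_div_distrib, Finset.prod_const, qq]; push_cast; rfl
  rw [this, iv]
  apply Finset.prod_le_prod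
  · intro p hp
    have : (2:ℝ) ≤ p := by exact_mod_cast (hP p (hv hp)).two_le
    exact one_div_nonneg.2 (by linarith)
  · intro p hp
    have : (2:ℝ) ≤ p := by exact_mod_cast (hP p (hv hp)).two_le
    rw [div_le_div_iff₀ (by linarith) (by linarith)]
    linarith

lemma head_bound (ε : ℝ) (hε : 0 < ε) : ∃ C : ℝ, 1 ≤ C ∧ ∀ (P : Finset ℕ) (D Q : ℝ) (x : ℕ),
    (∀ p ∈ P, p.Prime) → 1 ≤ D → 1 ≤ Q → |SV P D (fam P Q) x| ≤ C * Q ^ ε * tq P Q x := by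
  obtain ⟨C, hC, hom⟩ := omega_bound 8 (ε/3) (by norm_num) (by linarith)
  refine ⟨C * C * (1 + 3/ε), ?_, fun P D Q x hP hD hQ => ?_⟩
  · have : 0 < 3/ε := by positivity
    have : 1 ≤ C * C := by nlinarith
    nlinarith
  set E := Q ^ (ε/3) with hE
  have hE1 : 1 ≤ E := Real.one_le_rpow hQ (by linarith)
  have hQE : Q ^ ε = E * E * E := by
    rw [hE, ← Real.rpow_add (by linarith), ← Real.rpow_add (by linarith)]; congr 1; ring
  have h8 : ∀ v ∈ fam P Q, (8:ℝ) ^ v.card ≤ C * E := by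
    intro v hv
    rw [mem_fam] at hv
    refine (hom v (fun p hp => hP p (hv.1 hp))).trans ?_
    apply mul_le_mul_of_nonneg_left _ (by linarith)
    exact Real.rpow_le_rpow (by positivity) hv.2 (by linarith)
  have h4 : ∀ v ∈ fam P Q, (4:ℝ) ^ v.card ≤ C * E := fun v hv =>
    (pow_le_pow_left₀ (by norm_num) (by norm_num) _).trans (h8 v hv)
  set Fx := (fam P Q).filter (fun u => qq u ∣ x) with hFx
  let g : Finset ℕ → Finset ℕ × Finset ℕ := fun v => (v.filter (fun p => p ∣ x), v.filter (fun p => ¬ p ∣ x))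
  have hginj : Set.InjOn g (fam P Q) := by
    intro v _ w _ h
    simp only [g, Prod.mk.injEq] at h
    rw [← Finset.filter_union_filter_not_eq (fun p => p ∣ x) v, h.1, h.2, Finset.filter_union_filter_not_eq]
  have hiv : ∀ w ∈ fam P Q, 0 < iv w := fun w hw => iv_pos hP (mem_fam.1 hw).1
  calc |SV P D (fam P Q) x| ≤ ∑ v ∈ fam P Q, |om P D v * xv v x| := Finset.abs_sum_le_sum_abs _ _
    _ ≤ ∑ v ∈ fam P Q, (fun z : Finset ℕ × Finset ℕ => (4:ℝ) ^ z.1.card * (4 ^ z.2.card * iv z.2)) (g v) := by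
        apply Finset.sum_le_sum
        intro v hv
        rw [mem_fam] at hv
        have e1 : |xv v x| = iv (v.filter (fun p => ¬ p ∣ x)) := by
          rw [xv, Finset.abs_prod, iv, Finset.prod_filter]
          apply Finset.prod_congr rfl
          intro p hp
          have : (2:ℝ) ≤ p := by exact_mod_cast (hP p (hv.1 hp)).two_le
          unfold xp
          split_ifs
          · simp
          · exact abs_of_nonneg (one_div_nonneg.2 (by linarith))
        have e2 : v.card = (v.filter (fun p => p ∣ x)).card + (v.filter (fun p => ¬ p ∣ x)).card :=
          (Finset.card_filter_add_card_filter_not (s := v) (fun p => p ∣ x)).symm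
        simp only [g]
        rw [abs_mul, e1, ← mul_assoc, ← pow_add, ← e2]
        apply mul_le_mul_of_nonneg_right (om_le hP hD v)
        exact (iv_pos hP ((Finset.filter_subset _ _).trans hv.1)).le
    _ = ∑ z ∈ (fam P Q).image g, (4:ℝ) ^ z.1.card * (4 ^ z.2.card * iv z.2) := by
        rw [Finset.sum_image hginj]
    _ ≤ ∑ z ∈ Fx ×ˢ fam P Q, (4:ℝ) ^ z.1.card * (4 ^ z.2.card * iv z.2) := by
        apply Finset.sum_le_sum_of_subset_of_nonneg
        · intro z hz
          obtain ⟨v, hv, rfl⟩ := Finset.mem_image.1 hz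
          rw [mem_fam] at hv
          have s1 := Finset.filter_subset (fun p => p ∣ x) v
          have s2 := Finset.filter_subset (fun p => ¬ p ∣ x) v
          simp only [g, Finset.mem_product, hFx, Finset.mem_filter, mem_fam]
          refine ⟨⟨⟨s1.trans hv.1, (Nat.cast_le.2 (qq_mono hP hv.1 s1)).trans hv.2⟩, ?_⟩, s2.trans hv.1,
            (Nat.cast_le.2 (qq_mono hP hv.1 s2)).trans hv.2⟩
          rw [qq_dvd_iff hP (s1.trans hv.1)]
          intro p hp
          exact (Finset.mem_filter.1 hp).2
        · intro z hz _
          have := hiv _ (Finset.mem_product.1 hz).2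
          positivity
    _ = (∑ u ∈ Fx, (4:ℝ) ^ u.card) * ∑ w ∈ fam P Q, (4:ℝ) ^ w.card * iv w := by
        rw [Finset.sum_product, Finset.sum_mul_sum]
    _ ≤ (tq P Q x * (C * E)) * (C * E * (1 + Real.log Q)) := by
        apply mul_le_mul
        · calc ∑ u ∈ Fx, (4:ℝ) ^ u.card ≤ ∑ u ∈ Fx, C * E :=
                Finset.sum_le_sum fun u hu => h4 u (Finset.mem_filter.1 hu).1
            _ = tq P Q x * (C * E) := by simp [tq, hFx]
        · calc ∑ w ∈ fam P Q, (4:ℝ) ^ w.card * iv w ≤ ∑ w ∈ fam P Q, C * E * (1 / qq w) := by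
                apply Finset.sum_le_sum
                intro w hw
                calc (4:ℝ) ^ w.card * iv w ≤ 4 ^ w.card * (2 ^ w.card / qq w) :=
                      mul_le_mul_of_nonneg_left (iv_le hP (mem_fam.1 hw).1) (by positivity)
                  _ = 8 ^ w.card * (1 / qq w) := by
                      rw [← mul_div_assoc, ← mul_pow]; norm_num; ring
                  _ ≤ _ := mul_le_mul_of_nonneg_right (h8 w hw) (by positivity)
            _ ≤ _ := by
                rw [← Finset.mul_sum]
                exact mul_le_mul_of_nonneg_left (sum_inv_fam hP hQ) (by positivity)
        · exact Finset.sum_nonneg fun w hw => mul_nonneg (by positivity) (hiv w hw).le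
        · positivity
    _ ≤ (tq P Q x * (C * E)) * (C * E * ((1 + 3/ε) * E)) := by
        apply mul_le_mul_of_nonneg_left _ (by positivity)
        apply mul_le_mul_of_nonneg_left _ (by positivity)
        have h3 : Real.log Q ≤ Q ^ (ε/3) / (ε/3) := Real.log_le_rpow_div (by linarith) (by linarith)
        calc 1 + Real.log Q ≤ E + E / (ε/3) := by linarith
          _ = _ := by field_simp
    _ = _ := by rw [hQE]; ring

/-- primes at most `D` not dividing `m` -/
noncomputable def PP (D m : ℕ) : Finset ℕ := (Finset.range (D + 1)).filter (fun p => p.Prime ∧ ¬ p ∣ m)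

lemma PP_prime {D m : ℕ} : ∀ p ∈ PP D m, p.Prime := fun p hp => (Finset.mem_filter.1 hp).2.1

lemma PP_coprime {D m : ℕ} : ∀ p ∈ PP D m, Nat.Coprime p m := fun p hp =>
  ((Finset.mem_filter.1 hp).2.1.coprime_iff_not_dvd).2 (Finset.mem_filter.1 hp).2.2

lemma sum_sqfree (D : ℕ) : Real.log D ≤ 2 * ∑ d ∈ (Finset.Icc 1 D).filter Squarefree, (1:ℝ) / d := by
  choose a k hk using fun n : ℕ => Nat.sq_mul_squarefree n
  have h0 : Real.log D ≤ ∑ n ∈ Finset.Icc 1 D, (1:ℝ) / n := by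
    rcases Nat.eq_zero_or_pos D with rfl | hD
    · simp
    have h1 := log_add_one_le_harmonic D
    rw [harmonic_eq_sum_Icc] at h1
    push_cast at h1
    have h2 : Real.log D ≤ Real.log (D + 1) := Real.log_le_log (by exact_mod_cast hD) (by linarith)
    simp only [one_div]
    push_cast at *
    linarith
  have hsq : ∑ j ∈ Finset.Icc 1 D, (1:ℝ) / (j:ℝ)^2 ≤ 2 := by
    rcases Nat.eq_zero_or_pos D with rfl | hD
    · simp
    have := sum_Ioc_inv_sq_le_sub (α := ℝ) (k := 1) (n := D) one_ne_zero hD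
    rw [← Finset.add_sum_Ioc_eq_sum_Icc hD]
    simp only [one_div]
    have h3 : (0:ℝ) ≤ (D:ℝ)⁻¹ := by positivity
    simp only [Nat.cast_one, one_pow, inv_one] at this ⊢
    linarith
  refine h0.trans ?_
  let g : ℕ → ℕ × ℕ := fun n => (a n, k n)
  have hinj : Set.InjOn g (Finset.Icc 1 D) := by
    intro n _ n' _ h
    simp only [g, Prod.mk.injEq] at h
    rw [← (hk n).1, ← (hk n').1, h.1, h.2]
  calc ∑ n ∈ Finset.Icc 1 D, (1:ℝ) / n
      = ∑ n ∈ Finset.Icc 1 D, (fun z : ℕ × ℕ => (1:ℝ) / z.1 * (1 / (z.2:ℝ)^2)) (g n) := by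
        apply Finset.sum_congr rfl
        intro n _
        have : (n:ℝ) = (k n)^2 * a n := by exact_mod_cast (hk n).1.symm
        simp only [g]
        conv_lhs => rw [this]
        rw [one_div_mul_one_div, mul_comm]
    _ = ∑ z ∈ (Finset.Icc 1 D).image g, (1:ℝ) / z.1 * (1 / (z.2:ℝ)^2) := by
        rw [Finset.sum_image hinj]
    _ ≤ ∑ z ∈ ((Finset.Icc 1 D).filter Squarefree) ×ˢ Finset.Icc 1 D, (1:ℝ) / z.1 * (1 / (z.2:ℝ)^2) := by
        apply Finset.sum_le_sum_of_subset_of_nonneg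
        · intro z hz
          obtain ⟨n, hn, rfl⟩ := Finset.mem_image.1 hz
          rw [Finset.mem_Icc] at hn
          have h1 := (hk n).1
          have hapos : 0 < a n := by
            rcases Nat.eq_zero_or_pos (a n) with h | h
            · rw [h] at h1; omega
            · exact h
          have hkpos : 0 < k n := by
            rcases Nat.eq_zero_or_pos (k n) with h | h
            · rw [h] at h1; omega
            · exact h
          have hle1 : a n ≤ n := by
            conv_rhs => rw [← h1]
            exact Nat.le_mul_of_pos_left _ (by positivity)
          have hle2 : k n ≤ n := by
            conv_rhs => rw [← h1]
            nlinarith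
          simp only [g, Finset.mem_product, Finset.mem_filter, Finset.mem_Icc]
          exact ⟨⟨⟨hapos, hle1.trans hn.2⟩, (hk n).2⟩, hkpos, hle2.trans hn.2⟩
        · intros; positivity
    _ = (∑ d ∈ (Finset.Icc 1 D).filter Squarefree, (1:ℝ) / d) * ∑ j ∈ Finset.Icc 1 D, (1:ℝ) / (j:ℝ)^2 := by
        rw [Finset.sum_product, Finset.sum_mul_sum]
    _ ≤ _ := by
        rw [mul_comm]
        exact mul_le_mul_of_nonneg_right hsq (Finset.sum_nonneg fun _ _ => by positivity)

lemma GG_lower (D m : ℕ) (hm : 0 < m) :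
    (Nat.totient m : ℝ) / m * Real.log D ≤ 2 * GG (PP D m) D := by
  set M := m.primeFactors with hM
  have hMp : ∀ p ∈ M, p.Prime := fun p hp => Nat.prime_of_mem_primeFactors hp
  have h1 : ∑ t ∈ M.powerset, iv t = (m:ℝ) / Nat.totient m := by
    have e1 : ∑ t ∈ M.powerset, iv t = ∏ p ∈ M, (1 / ((p:ℝ) - 1) + 1) := by
      rw [Finset.prod_add]; simp [iv]
    have e2 : (Nat.totient m : ℝ) * ∏ p ∈ M, (p:ℝ) = m * ∏ p ∈ M, ((p:ℝ) - 1) := by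
      have := Nat.totient_mul_prod_primeFactors m
      have h' : ((Nat.totient m * ∏ p ∈ M, p : ℕ) : ℝ) = ((m * ∏ p ∈ M, (p - 1) : ℕ) : ℝ) := by rw [this]
      push_cast at h'
      rw [h']
      congr 1
      apply Finset.prod_congr rfl
      intro p hp
      rw [Nat.cast_sub (hMp p hp).one_le]; simp
    have e3 : ∏ p ∈ M, (1 / ((p:ℝ) - 1) + 1) = (∏ p ∈ M, (p:ℝ)) / ∏ p ∈ M, ((p:ℝ) - 1) := by
      rw [← Finset.prod_div_distrib]
      apply Finset.prod_congr rfl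
      intro p hp
      have : (2:ℝ) ≤ p := by exact_mod_cast (hMp p hp).two_le
      have : (p:ℝ) - 1 ≠ 0 := by linarith
      field_simp; ring
    have e4 : 0 < ∏ p ∈ M, ((p:ℝ) - 1) := by
      apply Finset.prod_pos
      intro p hp
      have : (2:ℝ) ≤ p := by exact_mod_cast (hMp p hp).two_le
      linarith
    have e5 : (0:ℝ) < Nat.totient m := by exact_mod_cast Nat.totient_pos.2 hm
    rw [e1, e3, div_eq_div_iff e4.ne' e5.ne']
    linarith
  have h2 : ∑ d ∈ (Finset.Icc 1 D).filter Squarefree, (1:ℝ) / d ≤ GG (PP D m) D * ∑ t ∈ M.powerset, iv t := by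
    let g : ℕ → Finset ℕ × Finset ℕ := fun d => (d.primeFactors \ M, d.primeFactors ∩ M)
    have hrec : ∀ d ∈ (Finset.Icc 1 D).filter Squarefree, qq d.primeFactors = d := by
      intro d hd
      exact Nat.prod_primeFactors_of_squarefree (Finset.mem_filter.1 hd).2
    have hinj : Set.InjOn g ((Finset.Icc 1 D).filter Squarefree) := by
      intro d hd d' hd' h
      simp only [g, Prod.mk.injEq] at h
      rw [← hrec d hd, ← hrec d' hd', ← Finset.sdiff_union_inter d.primeFactors M, h.1, h.2,
        Finset.sdiff_union_inter]
    calc ∑ d ∈ (Finset.Icc 1 D).filter Squarefree, (1:ℝ) / d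
        ≤ ∑ d ∈ (Finset.Icc 1 D).filter Squarefree, (fun z : Finset ℕ × Finset ℕ => iv z.1 * iv z.2) (g d) := by
          apply Finset.sum_le_sum
          intro d hd
          simp only [g, iv]
          rw [mul_comm, Finset.prod_inter_mul_prod_sdiff]
          have : (1:ℝ) / d = ∏ p ∈ d.primeFactors, 1 / (p:ℝ) := by
            conv_lhs => rw [← hrec d hd]
            rw [qq]; push_cast
            rw [Finset.prod_div_distrib]; simp
          rw [this]
          apply Finset.prod_le_prod
          · intros; positivity
          · intro p hp
            have : (2:ℝ) ≤ p := by exact_mod_cast (Nat.prime_of_mem_primeFactors hp).two_le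
            apply one_div_le_one_div_of_le <;> linarith
      _ = ∑ z ∈ ((Finset.Icc 1 D).filter Squarefree).image g, iv z.1 * iv z.2 := by
          rw [Finset.sum_image hinj]
      _ ≤ ∑ z ∈ fam (PP D m) D ×ˢ M.powerset, iv z.1 * iv z.2 := by
          apply Finset.sum_le_sum_of_subset_of_nonneg
          · intro z hz
            obtain ⟨d, hd, rfl⟩ := Finset.mem_image.1 hz
            have hd1 := Finset.mem_Icc.1 (Finset.mem_filter.1 hd).1
            simp only [g, Finset.mem_product, mem_fam, Finset.mem_powerset]
            refine ⟨⟨?_, ?_⟩, Finset.inter_subset_right⟩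
            · intro p hp
              rw [Finset.mem_sdiff] at hp
              have hpp := Nat.prime_of_mem_primeFactors hp.1
              have hpd := Nat.le_of_dvd (by omega) (Nat.dvd_of_mem_primeFactors hp.1)
              rw [PP, Finset.mem_filter, Finset.mem_range]
              refine ⟨by omega, hpp, fun h => hp.2 ?_⟩
              rw [hM, Nat.mem_primeFactors]
              exact ⟨hpp, h, by omega⟩
            · have : qq (d.primeFactors \ M) ≤ d := by
                conv_rhs => rw [← hrec d hd]
                exact qq_mono (fun p hp => Nat.prime_of_mem_primeFactors hp) le_rfl Finset.sdiff_subset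
              exact_mod_cast this.trans hd1.2
          · intro z hz _
            rw [Finset.mem_product, mem_fam, Finset.mem_powerset] at hz
            exact mul_nonneg (iv_pos PP_prime hz.1.1).le (iv_pos hMp hz.2).le
      _ = _ := by rw [Finset.sum_product, GG, Finset.sum_mul_sum]
  have h3 := sum_sqfree D
  rw [h1] at h2
  have e5 : (0:ℝ) < Nat.totient m := by exact_mod_cast Nat.totient_pos.2 hm
  have e6 : (0:ℝ) < m := by exact_mod_cast hm
  calc (Nat.totient m : ℝ) / m * Real.log D ≤ (Nat.totient m : ℝ) / m * (2 * (GG (PP D m) D * (m / Nat.totient m))) := by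
        apply mul_le_mul_of_nonneg_left _ (by positivity)
        linarith
    _ = _ := by field_simp
end PS

namespace PS

/-- Number of points of a separated sequence close to integers. -/
lemma bad_count (M : ℕ) (α : ℕ → ℝ) (u V lam Δ : ℝ) (hV : 0 ≤ V) (hl : 0 < lam) (hΔ : 0 < Δ)
    (hr : ∀ i < M, u ≤ α i ∧ α i ≤ u + V)
    (hs : ∀ i j, i < j → j < M → lam * ((j:ℝ) - i) ≤ |α i - α j|) :
    ((((Finset.range M).filter (fun i => nint (α i) < Δ)).card : ℕ) : ℝ) ≤ (V + 3) * (2 * Δ / lam + 1) := by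
  set S := (Finset.range M).filter (fun i => nint (α i) < Δ) with hS
  set T : Finset ℤ := Finset.Icc (round u) (round (u + V)) with hT
  have hmap : ∀ i ∈ S, round (α i) ∈ T := by
    intro i hi
    have h1 := hr i (Finset.mem_range.1 (Finset.mem_filter.1 hi).1)
    rw [hT, Finset.mem_Icc]
    have mono : ∀ x y : ℝ, x ≤ y → round x ≤ round y := by
      intro x y hxy
      rw [round_eq, round_eq]; exact Int.floor_le_floor (by linarith)
    exact ⟨mono _ _ h1.1, mono _ _ h1.2⟩
  have hfib : ∀ k ∈ T, (((S.filter (fun i => round (α i) = k)).card : ℕ) : ℝ) ≤ 2 * Δ / lam + 1 := by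
    intro k _
    set U := S.filter (fun i => round (α i) = k) with hU
    rcases U.eq_empty_or_nonempty with h0 | hne
    · rw [h0]; simp; positivity
    have hmem : ∀ i ∈ U, i < M ∧ |α i - k| < Δ := by
      intro i hi
      have h1 := Finset.mem_filter.1 hi
      have h2 := Finset.mem_filter.1 h1.1
      refine ⟨Finset.mem_range.1 h2.1, ?_⟩
      have := h2.2
      unfold nint at this; rwa [h1.2] at this
    have hmm : ((U.max' hne : ℕ) : ℝ) - U.min' hne ≤ 2 * Δ / lam := by
      have a1 := hmem _ (U.max'_mem hne)
      have a2 := hmem _ (U.min'_mem hne)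
      rcases (U.min'_le _ (U.max'_mem hne)).lt_or_eq with h | h
      · have := hs _ _ h a1.1
        rw [le_div_iff₀ hl]
        have h3 : |α (U.min' hne) - α (U.max' hne)| ≤ 2 * Δ := by
          rw [abs_le]; constructor <;> linarith [abs_lt.1 a1.2, abs_lt.1 a2.2]
        linarith
      · rw [h]; simp; positivity
    have hsub : U ⊆ Finset.Icc (U.min' hne) (U.max' hne) := fun i hi =>
      Finset.mem_Icc.2 ⟨U.min'_le i hi, U.le_max' i hi⟩
    have hc := Finset.card_le_card hsub
    rw [Nat.card_Icc] at hc
    have hle := U.min'_le _ (U.max'_mem hne)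
    have : (U.card : ℝ) ≤ ((U.max' hne : ℕ) : ℝ) + 1 - U.min' hne := by
      rw [← Nat.cast_one, ← Nat.cast_add, ← Nat.cast_sub (by omega)]
      exact_mod_cast hc
    linarith
  have hTc : (T.card : ℝ) ≤ V + 3 := by
    rw [hT, Int.card_Icc]
    have h1 : ((round (u + V) : ℤ) : ℝ) ≤ u + V + 1/2 := by
      linarith [abs_le.1 (abs_sub_round (u + V))]
    have h2 : u - 1/2 ≤ ((round u : ℤ) : ℝ) := by
      linarith [abs_le.1 (abs_sub_round u)]
    by_cases h : 0 ≤ round (u + V) + 1 - round u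
    · have : (((round (u + V) + 1 - round u).toNat : ℕ) : ℝ) = ((round (u + V) + 1 - round u : ℤ) : ℝ) := by
        rw [← Int.cast_natCast, Int.toNat_of_nonneg h]
      rw [this]; push_cast; linarith
    · rw [Int.toNat_of_nonpos (by omega)]; simp; linarith
  have := Finset.card_eq_sum_card_fiberwise (f := fun i => round (α i)) (s := S) (t := T) hmap
  rw [this]; push_cast
  calc _ ≤ ∑ k ∈ T, (2 * Δ / lam + 1) := Finset.sum_le_sum hfib
    _ = T.card * (2 * Δ / lam + 1) := by rw [Finset.sum_const, nsmul_eq_mul]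
    _ ≤ _ := mul_le_mul_of_nonneg_right hTc (by positivity)

/-- Sum of the geometric sums. -/
lemma geom_total (M L : ℕ) (α : ℕ → ℝ) (u V lam Δ : ℝ) (hV : 0 ≤ V) (hl : 0 < lam) (hΔ : 0 < Δ)
    (hr : ∀ i < M, u ≤ α i ∧ α i ≤ u + V)
    (hs : ∀ i j, i < j → j < M → lam * ((j:ℝ) - i) ≤ |α i - α j|) :
    ∑ i ∈ Finset.range M, ‖∑ l ∈ Finset.range L, e (l * α i)‖ ≤ M / Δ + L * ((V + 3) * (2 * Δ / lam + 1)) := by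
  have hb := bad_count M α u V lam Δ hV hl hΔ hr hs
  calc _ ≤ ∑ i ∈ Finset.range M, (1 / Δ + if nint (α i) < Δ then (L:ℝ) else 0) := by
        apply Finset.sum_le_sum
        intro i _
        split_ifs with h
        · have := norm_sum_e_le (Finset.range L) (fun l : ℕ => (l:ℝ) * α i)
          simp only [Finset.card_range] at this
          have : 0 < 1 / Δ := by positivity
          linarith
        · rw [add_zero]; exact geom_bound L (α i) Δ hΔ (not_lt.1 h)
    _ = M / Δ + L * (((Finset.range M).filter (fun i => nint (α i) < Δ)).card : ℝ) := by
        rw [Finset.sum_add_distrib, ← Finset.sum_filter]; simp; ring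
    _ ≤ _ := by gcongr

/-- Fejer kernel. -/
noncomputable def FK (H : ℕ) (t : ℝ) : ℝ := ‖∑ j ∈ Finset.range H, e (j * t)‖ ^ 2 / H

lemma FK_nonneg (H : ℕ) (t : ℝ) : 0 ≤ FK H t := by unfold FK; positivity

lemma FK_lower (H : ℕ) (t : ℝ) (h : H * nint t ≤ 1/6) : (H:ℝ) / 4 ≤ FK H t := by
  rcases Nat.eq_zero_or_pos H with rfl | hH
  · simp [FK]
  have hH' : (0:ℝ) < H := by exact_mod_cast hH
  have h1 : (H:ℝ)/2 ≤ ‖∑ j ∈ Finset.range H, e (j * t)‖ := by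
    have h2 : (H:ℝ)/2 ≤ (∑ j ∈ Finset.range H, e (j * t)).re := by
      rw [Complex.re_sum]
      calc (H:ℝ)/2 = ∑ j ∈ Finset.range H, (1/2:ℝ) := by simp; ring
        _ ≤ _ := by
          apply Finset.sum_le_sum
          intro j hj
          have e1 : e (j * t) = e (j * (t - round t)) := by
            rw [show (j:ℝ) * t = j * (t - round t) + ((j * round t : ℤ) : ℝ) by push_cast; ring, e_add_int]
          rw [e1, e_re]
          have hj' : (j:ℝ) ≤ H := by exact_mod_cast (Finset.mem_range.1 hj).le
          have h3 : |(j:ℝ) * (t - round t)| ≤ 1/6 := by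
            rw [abs_mul, abs_of_nonneg (Nat.cast_nonneg j)]
            refine le_trans (mul_le_mul_of_nonneg_right hj' (abs_nonneg _)) h
          rw [← Real.cos_pi_div_three, ← Real.cos_abs (2 * π * _)]
          apply Real.cos_le_cos_of_nonneg_of_le_pi (abs_nonneg _) (by linarith [pi_pos])
          rw [abs_mul, abs_of_pos (by positivity)]
          nlinarith [pi_pos]
    exact h2.trans (Complex.re_le_norm _)
  unfold FK
  rw [le_div_iff₀ hH']
  nlinarith

lemma FK_expand (H : ℕ) (hH : 0 < H) (t : ℝ) :
    ((FK H t : ℝ) : ℂ) - 1 = (1 / (H:ℂ)) * ∑ p ∈ (Finset.range H ×ˢ Finset.range H).filter (fun p => p.1 ≠ p.2),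
      e (((p.1:ℝ) - p.2) * t) := by
  have hH' : (H:ℂ) ≠ 0 := by exact_mod_cast hH.ne'
  have h1 : ((FK H t : ℝ) : ℂ) = (1 / (H:ℂ)) * ∑ p ∈ (Finset.range H ×ˢ Finset.range H), e (((p.1:ℝ) - p.2) * t) := by
    unfold FK
    push_cast
    rw [← Complex.mul_conj', map_sum, Finset.sum_mul_sum, Finset.sum_product]
    rw [div_eq_mul_one_div, mul_comm]
    congr 1
    apply Finset.sum_congr rfl; intro i _
    apply Finset.sum_congr rfl; intro j _
    rw [← e_neg, ← e_add]; congr 1; ring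
  rw [h1, ← Finset.sum_filter_add_sum_filter_not (Finset.range H ×ˢ Finset.range H) (fun p => p.1 ≠ p.2)]
  have h2 : ∑ p ∈ (Finset.range H ×ˢ Finset.range H).filter (fun p => ¬ p.1 ≠ p.2), e (((p.1:ℝ) - p.2) * t) = H := by
    rw [Finset.sum_congr rfl (g := fun _ => (1:ℂ))]
    · rw [Finset.sum_const, nsmul_eq_mul, mul_one]
      congr 1
      have : (Finset.range H ×ˢ Finset.range H).filter (fun p => ¬ p.1 ≠ p.2) = (Finset.range H).image (fun i => (i,i)) := by
        ext ⟨i,j⟩; simp; aesop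
      rw [this, Finset.card_image_of_injective _ (fun a b h => (Prod.mk.inj h).1), Finset.card_range]
    · intro p hp
      have := (Finset.mem_filter.1 hp).2
      push Not at this
      rw [this, sub_self, zero_mul, e_zero]
  rw [h2, mul_add, one_div_mul_cancel hH', add_sub_cancel_right]

end PS

namespace PS

lemma block_lin {φ : ℝ → ℝ} {P : Set ℕ} {γ η X : ℝ} (hΦ : PhiOK φ P γ η X) (m b n0 L : ℕ) (k θ : ℝ)
    (hy : X ≤ ((m * n0 + b : ℕ) : ℝ)) :
    ‖∑ l ∈ Finset.range L, e (k * φ ((m * (n0 + l) + b : ℕ) : ℝ) + ((n0 + l : ℕ) : ℝ) * θ)‖ ≤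
      ‖∑ l ∈ Finset.range L, e (l * (k * m * deriv φ ((m * n0 + b : ℕ) : ℝ) + θ))‖ +
      L * (2 * π * (|k| * (20 / ((m * n0 + b : ℕ) : ℝ) * ((m:ℝ) * L) ^ 2))) := by
  set y : ℝ := ((m * n0 + b : ℕ) : ℝ) with hyd
  have hy0 : 0 < y := by linarith [hΦ.one_le]
  set α := k * m * deriv φ y + θ with hα
  have h1 : ∑ l ∈ Finset.range L, e (k * φ ((m * (n0 + l) + b : ℕ) : ℝ) + ((n0 + l : ℕ) : ℝ) * θ) =
      e (k * φ y + n0 * θ) * ∑ l ∈ Finset.range L,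
        e (l * α + k * (φ ((m * (n0 + l) + b : ℕ) : ℝ) - φ y - deriv φ y * (((m * (n0 + l) + b : ℕ) : ℝ) - y))) := by
    rw [Finset.mul_sum]
    apply Finset.sum_congr rfl; intro l _
    rw [← e_add]; congr 1
    rw [hα, hyd]; push_cast; ring
  rw [h1, norm_mul, norm_e, one_mul]
  have h2 : ‖∑ l ∈ Finset.range L,
        e (l * α + k * (φ ((m * (n0 + l) + b : ℕ) : ℝ) - φ y - deriv φ y * (((m * (n0 + l) + b : ℕ) : ℝ) - y)))
        - ∑ l ∈ Finset.range L, e (l * α)‖ ≤ L * (2 * π * (|k| * (20 / y * ((m:ℝ) * L) ^ 2))) := by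
    rw [← Finset.sum_sub_distrib]
    calc _ ≤ ∑ l ∈ Finset.range L, (2 * π * (|k| * (20 / y * ((m:ℝ) * L) ^ 2))) := by
          apply norm_sum_le_of_le
          intro l hl
          refine (norm_e_sub_e_le _ _).trans ?_
          rw [add_sub_cancel_left, abs_mul]
          have hz : y ≤ ((m * (n0 + l) + b : ℕ) : ℝ) := by
            rw [hyd]; exact_mod_cast by nlinarith
          have h3 := hΦ.lin y hy _ hz
          have h4 : ((m * (n0 + l) + b : ℕ) : ℝ) - y = m * l := by rw [hyd]; push_cast; ring
          have hl' : (l:ℝ) ≤ L := by exact_mod_cast (Finset.mem_range.1 hl).le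
          have h5 : |φ ((m * (n0 + l) + b : ℕ) : ℝ) - φ y - deriv φ y * (((m * (n0 + l) + b : ℕ) : ℝ) - y)|
              ≤ 20 / y * ((m:ℝ) * L) ^ 2 := by
            refine h3.trans ?_
            rw [h4]; gcongr
          gcongr
      _ = _ := by rw [Finset.sum_const, nsmul_eq_mul, Finset.card_range]
  have h3 := norm_sub_norm_le (∑ l ∈ Finset.range L,
        e (l * α + k * (φ ((m * (n0 + l) + b : ℕ) : ℝ) - φ y - deriv φ y * (((m * (n0 + l) + b : ℕ) : ℝ) - y))))
        (∑ l ∈ Finset.range L, e (l * α))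
  linarith

/-- bound for the sum over blocks -/
noncomputable def YB (M L m : ℕ) (Hm Z y0 γ η Δ : ℝ) : ℝ :=
  M / Δ + L * ((Hm * m + 3) * (2 * Δ / (Z ^ (γ - 2 - η) * L) + 1)) +
    M * (L * (2 * π * (Hm * (20 / y0 * ((m:ℝ) * L) ^ 2))))

lemma Y_bound {φ : ℝ → ℝ} {P : Set ℕ} {γ η X : ℝ} (hΦ : PhiOK φ P γ η X) (hγ : γ ≤ 1) (hη : 0 < η)
    (m b n1 L M : ℕ) (hm : 1 ≤ m) (hL : 1 ≤ L)
    (Hm Z Δ : ℝ) (hΔ : 0 < Δ) (hy : X ≤ ((m * n1 + b : ℕ) : ℝ))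
    (hZ : ∀ i < M, ((m * (n1 + i * L) + b : ℕ) : ℝ) ≤ Z) (hZ0 : 0 < Z)
    (k θ : ℝ) (hk1 : 1 ≤ |k|) (hkH : |k| ≤ Hm) :
    ∑ i ∈ Finset.range M, ‖∑ l ∈ Finset.range L,
      e (k * φ ((m * ((n1 + i * L) + l) + b : ℕ) : ℝ) + (((n1 + i * L) + l : ℕ) : ℝ) * θ)‖ ≤
      YB M L m Hm Z ((m * n1 + b : ℕ) : ℝ) γ η Δ := by
  have hHm : 0 < Hm := by linarith
  have hm' : (1:ℝ) ≤ m := by exact_mod_cast hm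
  have hL' : (1:ℝ) ≤ L := by exact_mod_cast hL
  set y0 : ℝ := ((m * n1 + b : ℕ) : ℝ) with hy0
  have hy0p : 0 < y0 := by linarith [hΦ.one_le]
  set y : ℕ → ℝ := fun i => ((m * (n1 + i * L) + b : ℕ) : ℝ) with hyd
  have hyy : ∀ i, y0 ≤ y i := by
    intro i; simp only [hy0, hyd]
    exact_mod_cast Nat.add_le_add_right (Nat.mul_le_mul_left m (Nat.le_add_right n1 (i * L))) b
  have hyX : ∀ i, X ≤ y i := fun i => hy.trans (hyy i)
  set α : ℕ → ℝ := fun i => k * m * deriv φ (y i) + θ with hα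
  have hg := geom_total M L α (θ - Hm * m / 2) (Hm * m) (Z ^ (γ - 2 - η) * L) Δ (by positivity) (by positivity) hΔ
    (by
      intro i _
      have h1 := hΦ.le (y i) (hyX i)
      have h2 := hΦ.pos (y i) (hyX i)
      have h3 : |k * m * deriv φ (y i)| ≤ Hm * m / 2 := by
        rw [abs_mul, abs_mul, abs_of_pos h2, abs_of_nonneg (by positivity : (0:ℝ) ≤ m)]
        calc |k| * m * deriv φ (y i) ≤ Hm * m * (1/6) := by gcongr
          _ ≤ _ := by nlinarith [mul_pos hHm (by linarith : (0:ℝ) < m)]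
      have := abs_le.1 h3
      simp only [hα]
      constructor <;> linarith)
    (by
      intro i j hij hj
      have hij' : (i:ℝ) < j := by exact_mod_cast hij
      have hd : y j - y i = m * L * ((j:ℝ) - i) := by simp only [hyd]; push_cast; ring
      have hle : y i ≤ y j := by
        have : 0 ≤ (m:ℝ) * L * ((j:ℝ) - i) := mul_nonneg (by positivity) (by linarith)
        linarith
      have h1 := hΦ.gap (y i) (hyX i) (y j) hle
      have h2 : Z ^ (γ - 2 - η) ≤ y j ^ (γ - 2 - η) :=
        Real.rpow_le_rpow_of_nonpos (by linarith [hyy j]) (hZ j hj) (by linarith)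
      have h3 : α i - α j = k * m * (deriv φ (y i) - deriv φ (y j)) := by simp only [hα]; ring
      have h4 : 0 ≤ deriv φ (y i) - deriv φ (y j) := by linarith [hΦ.anti (y i) (hyX i) (y j) hle]
      rw [h3, abs_mul, abs_mul, abs_of_nonneg h4, abs_of_nonneg (by positivity : (0:ℝ) ≤ m)]
      rw [hd] at h1
      have h5 : Z ^ (γ - 2 - η) * (L * ((j:ℝ) - i)) ≤ y j ^ (γ - 2 - η) * (m * L * ((j:ℝ) - i)) := by
        apply mul_le_mul h2 _ (mul_nonneg (by positivity) (by linarith)) (by positivity)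
        have : 0 ≤ (L:ℝ) * ((j:ℝ) - i) := mul_nonneg (by positivity) (by linarith)
        nlinarith
      have h6 : (1:ℝ) * 1 ≤ |k| * m := mul_le_mul hk1 hm' (by norm_num) (abs_nonneg _)
      nlinarith)
  have hb : ∀ i ∈ Finset.range M, ‖∑ l ∈ Finset.range L,
      e (k * φ ((m * ((n1 + i * L) + l) + b : ℕ) : ℝ) + (((n1 + i * L) + l : ℕ) : ℝ) * θ)‖ ≤
      ‖∑ l ∈ Finset.range L, e (l * α i)‖ + L * (2 * π * (Hm * (20 / y0 * ((m:ℝ) * L) ^ 2))) := by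
    intro i _
    refine (block_lin hΦ m b (n1 + i * L) L k θ (hyX i)).trans ?_
    apply add_le_add le_rfl
    have := hyy i
    simp only [hyd] at this
    gcongr
  refine (Finset.sum_le_sum hb).trans ?_
  rw [Finset.sum_add_distrib, Finset.sum_const, nsmul_eq_mul, Finset.card_range]
  unfold YB
  linarith

lemma K_bound {φ : ℝ → ℝ} {P : Set ℕ} {γ η X : ℝ} (hΦ : PhiOK φ P γ η X) (hγ : γ ≤ 1) (hη : 0 < η)
    (m b n1 L M : ℕ) (hm : 1 ≤ m) (hL : 1 ≤ L)
    (Hm : ℕ) (Z Δ : ℝ) (hΔ : 0 < Δ) (hy : X ≤ ((m * n1 + b : ℕ) : ℝ))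
    (hZ : ∀ i < M, ((m * (n1 + i * L) + b : ℕ) : ℝ) ≤ Z) (hZ0 : 0 < Z)
    (H : ℕ → ℕ) (hH : ∀ i < M, 1 ≤ H i ∧ H i ≤ Hm) (θ : ℝ) :
    ‖∑ i ∈ Finset.range M, ∑ l ∈ Finset.range L,
      (((FK (H i) (φ ((m * ((n1 + i * L) + l) + b : ℕ) : ℝ)) : ℝ) : ℂ) - 1) * e ((((n1 + i * L) + l : ℕ) : ℝ) * θ)‖
      ≤ (Hm:ℝ) ^ 2 * YB M L m Hm Z ((m * n1 + b : ℕ) : ℝ) γ η Δ := by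
  set B : ℝ → ℕ → ℝ := fun k i => ‖∑ l ∈ Finset.range L,
      e (k * φ ((m * ((n1 + i * L) + l) + b : ℕ) : ℝ) + (((n1 + i * L) + l : ℕ) : ℝ) * θ)‖ with hB
  set J : ℕ → Finset (ℕ × ℕ) := fun H => (Finset.range H ×ˢ Finset.range H).filter (fun p => p.1 ≠ p.2) with hJ
  have h1 : ∀ i ∈ Finset.range M, ‖∑ l ∈ Finset.range L,
      (((FK (H i) (φ ((m * ((n1 + i * L) + l) + b : ℕ) : ℝ)) : ℝ) : ℂ) - 1) * e ((((n1 + i * L) + l : ℕ) : ℝ) * θ)‖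
      ≤ ∑ p ∈ J Hm, B ((p.1:ℝ) - p.2) i := by
    intro i hi
    have hHi := hH i (Finset.mem_range.1 hi)
    have h2 : ∑ l ∈ Finset.range L,
      (((FK (H i) (φ ((m * ((n1 + i * L) + l) + b : ℕ) : ℝ)) : ℝ) : ℂ) - 1) * e ((((n1 + i * L) + l : ℕ) : ℝ) * θ)
      = (1 / (H i : ℂ)) * ∑ p ∈ J (H i), ∑ l ∈ Finset.range L,
        e (((p.1:ℝ) - p.2) * φ ((m * ((n1 + i * L) + l) + b : ℕ) : ℝ) + (((n1 + i * L) + l : ℕ) : ℝ) * θ) := by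
      rw [Finset.sum_comm, Finset.mul_sum]
      apply Finset.sum_congr rfl; intro l _
      rw [FK_expand _ hHi.1, mul_assoc, Finset.sum_mul]
      congr 1
      apply Finset.sum_congr rfl; intro p _
      rw [e_add]
    rw [h2, norm_mul]
    have h3 : ‖(1 / (H i : ℂ))‖ ≤ 1 := by
      rw [norm_div, norm_one, Complex.norm_natCast]
      have : (1:ℝ) ≤ H i := by exact_mod_cast hHi.1
      rw [div_le_one (by linarith)]; exact this
    calc _ ≤ 1 * ∑ p ∈ J (H i), B ((p.1:ℝ) - p.2) i :=
          mul_le_mul h3 (norm_sum_le _ _) (norm_nonneg _) (by norm_num)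
      _ = ∑ p ∈ J (H i), B ((p.1:ℝ) - p.2) i := one_mul _
      _ ≤ _ := by
        apply Finset.sum_le_sum_of_subset_of_nonneg
        · intro p hp
          simp only [hJ, Finset.mem_filter, Finset.mem_product, Finset.mem_range] at hp ⊢
          exact ⟨⟨by omega, by omega⟩, hp.2⟩
        · intro p _ _; exact norm_nonneg _
  refine (norm_sum_le_of_le _ h1).trans ?_
  rw [Finset.sum_comm]
  have h4 : ∀ p ∈ J Hm, ∑ i ∈ Finset.range M, B ((p.1:ℝ) - p.2) i ≤ YB M L m Hm Z ((m * n1 + b : ℕ) : ℝ) γ η Δ := by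
    intro p hp
    simp only [hJ, Finset.mem_filter, Finset.mem_product, Finset.mem_range] at hp
    have hcast : ((p.1:ℝ) - p.2) = (((p.1:ℤ) - p.2 : ℤ) : ℝ) := by push_cast; ring
    apply Y_bound hΦ hγ hη m b n1 L M hm hL Hm Z Δ hΔ hy hZ hZ0
    · have h5 : (1:ℤ) ≤ |(p.1:ℤ) - p.2| := Int.one_le_abs (sub_ne_zero.2 (by exact_mod_cast hp.2))
      rw [hcast, ← Int.cast_abs]
      exact_mod_cast h5
    · have h5 : |(p.1:ℤ) - p.2| ≤ Hm := abs_le.2 ⟨by omega, by omega⟩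
      rw [hcast, ← Int.cast_abs]
      exact_mod_cast h5
  have hYB : 0 ≤ YB M L m Hm Z ((m * n1 + b : ℕ) : ℝ) γ η Δ := by
    unfold YB; positivity
  refine (Finset.sum_le_sum h4).trans ?_
  rw [Finset.sum_const, nsmul_eq_mul]
  apply mul_le_mul_of_nonneg_right _ hYB
  have : (J Hm).card ≤ Hm ^ 2 := by
    refine (Finset.card_filter_le _ _).trans ?_
    rw [Finset.card_product, Finset.card_range, sq]
  exact_mod_cast this

end PS

namespace PS

lemma YB_num (M L m : ℕ) (Hm Z y0 γ η u : ℝ) (hu : 2000 ≤ u) (hM : (M:ℝ) ≤ u ^ 2000)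
    (hL1 : 1 ≤ L) (hL : (L:ℝ) ≤ 2 * u ^ 1000) (hm : (m:ℝ) ≤ u ^ 3)
    (hH0 : 0 ≤ Hm) (hH : Hm ≤ u ^ 50) (hZ : 0 < Z) (hZ2 : (Z ^ (γ - 2 - η))⁻¹ ≤ u ^ 3054) (hy : u ^ 2700 ≤ y0) :
    Hm ^ 2 * YB M L m Hm Z y0 γ η (u ^ 500)⁻¹ ≤ u ^ 2820 := by
  have hu0 : 0 < u := by linarith
  have hu1 : 1 ≤ u := by linarith
  have hL' : (1:ℝ) ≤ L := by exact_mod_cast hL1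
  have hZp : 0 < Z ^ (γ - 2 - η) := by positivity
  have hpi : 2 * π ≤ 7 := by linarith [pi_lt_d2]
  have hy0 : 0 < y0 := lt_of_lt_of_le (by positivity) hy
  have hYB0 : 0 ≤ YB M L m Hm Z y0 γ η (u ^ 500)⁻¹ := by unfold YB; positivity
  have t1 : M / (u ^ 500)⁻¹ ≤ u ^ 2500 := by
    rw [div_inv_eq_mul]
    calc (M:ℝ) * u ^ 500 ≤ u ^ 2000 * u ^ 500 := by gcongr
      _ = u ^ 2500 := by rw [← pow_add]
  have t2 : L * ((Hm * m + 3) * (2 * (u ^ 500)⁻¹ / (Z ^ (γ - 2 - η) * L) + 1)) ≤ 16 * u ^ 2607 := by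
    have e1 : L * ((Hm * m + 3) * (2 * (u ^ 500)⁻¹ / (Z ^ (γ - 2 - η) * L) + 1)) =
        (Hm * m + 3) * (2 * (u ^ 500)⁻¹ * (Z ^ (γ - 2 - η))⁻¹ + L) := by
      field_simp
    rw [e1]
    have e2 : Hm * m + 3 ≤ 4 * u ^ 53 := by
      have : Hm * m ≤ u ^ 50 * u ^ 3 := by gcongr
      rw [← pow_add] at this
      have h1 : 1 ≤ u ^ 53 := one_le_pow₀ hu1
      norm_num at this ⊢
      linarith
    have e3 : 2 * (u ^ 500)⁻¹ * (Z ^ (γ - 2 - η))⁻¹ + L ≤ 4 * u ^ 2554 := by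
      have h1 : (u ^ 500)⁻¹ * (Z ^ (γ - 2 - η))⁻¹ ≤ (u ^ 500)⁻¹ * u ^ 3054 := by gcongr
      have h2 : (u ^ 500)⁻¹ * u ^ 3054 = u ^ 2554 := by
        rw [show 3054 = 500 + 2554 from rfl, pow_add, ← mul_assoc, inv_mul_cancel₀ (by positivity), one_mul]
      have h3 : u ^ 1000 ≤ u ^ 2554 := pow_le_pow_right₀ hu1 (by norm_num)
      linarith
    calc _ ≤ (4 * u ^ 53) * (4 * u ^ 2554) := by gcongr
      _ = 16 * u ^ 2607 := by rw [show 2607 = 53 + 2554 from rfl, pow_add]; ring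
  have t3 : M * (L * (2 * π * (Hm * (20 / y0 * ((m:ℝ) * L) ^ 2)))) ≤ 1120 * u ^ 2356 := by
    calc _ ≤ u ^ 2000 * ((2 * u ^ 1000) * (7 * (u ^ 50 * (20 / u ^ 2700 * (u ^ 3 * (2 * u ^ 1000)) ^ 2)))) := by
          gcongr
      _ = 1120 * (u ^ 5056 / u ^ 2700) := by ring
      _ = _ := by
        rw [show 5056 = 2356 + 2700 from rfl, pow_add, mul_div_cancel_right₀ _ (by positivity)]
  have t4 : Hm ^ 2 ≤ u ^ 100 := by
    calc Hm ^ 2 ≤ (u ^ 50) ^ 2 := by gcongr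
      _ = _ := by rw [← pow_mul]
  have t5 : u ^ 2500 ≤ u ^ 2607 := pow_le_pow_right₀ hu1 (by norm_num)
  have t6 : u ^ 2356 ≤ u ^ 2607 := pow_le_pow_right₀ hu1 (by norm_num)
  have t7 : YB M L m Hm Z y0 γ η (u ^ 500)⁻¹ ≤ u * u ^ 2607 := by
    unfold YB
    have : 0 < u ^ 2607 := by positivity
    nlinarith
  calc _ ≤ u ^ 100 * (u * u ^ 2607) := by gcongr
    _ = u ^ 2708 := by rw [show 2708 = 100 + (1 + 2607) from rfl, pow_add, pow_add, pow_one]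
    _ ≤ _ := pow_le_pow_right₀ hu1 (by norm_num)

lemma sum_blocks (f : ℕ → ℂ) (n1 M L : ℕ) :
    ∑ n ∈ Finset.Ico n1 (n1 + M * L), f n = ∑ i ∈ Finset.range M, ∑ l ∈ Finset.range L, f ((n1 + i * L) + l) := by
  induction M with
  | zero => simp
  | succ M ih =>
    rw [Finset.sum_range_succ, ← ih, ← Finset.sum_Ico_consecutive f (show n1 ≤ n1 + M * L by omega)
      (show n1 + M * L ≤ n1 + (M + 1) * L by rw [add_mul]; omega)]
    congr 1
    rw [Finset.sum_Ico_eq_sum_range]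
    congr 2
    rw [add_mul]; omega

set_option maxHeartbeats 1000000 in
lemma partG {φ : ℝ → ℝ} {P : Set ℕ} {γ X : ℝ} (hΦ : PhiOK φ P γ (1/10000) X) (hγ1 : 71/72 < γ) (hγ : γ ≤ 1) :
    ∃ N0 : ℕ, ∀ N ≥ N0, ∀ m b : ℕ, 1 ≤ m → (m:ℝ) ≤ (N:ℝ) ^ (1/1000:ℝ) → b < m →
    ∃ (I : Finset ℕ) (K : ℕ → ℝ), I ⊆ Finset.range N ∧ (∀ n ∈ I, (N:ℝ) ^ (9/10:ℝ) ≤ n) ∧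
      (∀ n ∈ I, X ≤ ((m * n + b : ℕ) : ℝ)) ∧
      (∀ n : ℕ, 2 * (N:ℝ) ^ (9/10:ℝ) ≤ n → n ≤ N / 2 → n ∈ I) ∧ (∀ n, 0 ≤ K n) ∧
      (∀ n ∈ I, m * n + b ∈ P → 1 / deriv φ ((m * n + b : ℕ) : ℝ) ≤ 96 * K n) ∧
      ∀ θ : ℝ, ‖∑ n ∈ I, ((K n : ℂ) - 1) * e (n * θ)‖ ≤ (N:ℝ) ^ (0.94:ℝ) := by
  have hlarge : ∀ᶠ N : ℕ in atTop, (max 2000 X) ≤ (N:ℝ) ^ (1/3000:ℝ) :=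
    ((tendsto_rpow_atTop (by norm_num)).comp tendsto_natCast_atTop_atTop).eventually_ge_atTop _
  obtain ⟨N0, hN0⟩ := eventually_atTop.1 hlarge
  refine ⟨N0, fun N hN m b hm hmN hb => ?_⟩
  set T : ℝ := (N:ℝ) with hT
  set u : ℝ := T ^ (1/3000:ℝ) with hu
  have hT0 : 0 ≤ T := by positivity
  have hu2 : 2000 ≤ u := (le_max_left _ _).trans (hN0 N hN)
  have huX : X ≤ u := (le_max_right _ _).trans (hN0 N hN)
  have hu1 : 1 ≤ u := by linarith
  have hu0 : 0 < u := by linarith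
  have hpw : ∀ k : ℕ, T ^ ((k:ℝ)/3000) = u ^ k := by
    intro k
    rw [hu, ← Real.rpow_natCast, ← Real.rpow_mul hT0]; congr 1; ring
  have hTu : T = u ^ 3000 := by
    rw [← hpw]; norm_num
  have h910 : T ^ (9/10:ℝ) = u ^ 2700 := by rw [← hpw]; norm_num
  have h94 : T ^ (0.94:ℝ) = u ^ 2820 := by rw [← hpw]; norm_num
  have hmu : (m:ℝ) ≤ u ^ 3 := by
    refine hmN.trans (le_of_eq ?_); rw [← hpw]; norm_num
  have hm' : (1:ℝ) ≤ m := by exact_mod_cast hm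
  set L : ℕ := ⌈u ^ 1000⌉₊ with hL
  have hL1 : u ^ 1000 ≤ L := Nat.le_ceil _
  have hLone : 1 ≤ u ^ 1000 := one_le_pow₀ hu1
  have hL2 : (L:ℝ) ≤ 2 * u ^ 1000 := by
    have := Nat.ceil_lt_add_one (show 0 ≤ u ^ 1000 by positivity)
    rw [← hL] at this; linarith
  have hLpos : 1 ≤ L := by
    have : (1:ℝ) ≤ L := hLone.trans hL1
    exact_mod_cast this
  set n1 : ℕ := ⌈u ^ 2700⌉₊ with hn1
  have hn1a : u ^ 2700 ≤ n1 := Nat.le_ceil _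
  have h27one : 1 ≤ u ^ 2700 := one_le_pow₀ hu1
  have hn1b : (n1:ℝ) ≤ 2 * u ^ 2700 := by
    have := Nat.ceil_lt_add_one (show 0 ≤ u ^ 2700 by positivity)
    rw [← hn1] at this; linarith
  have hbig : 10 * u ^ 2700 ≤ T := by
    rw [hTu, show 3000 = 2700 + 300 from rfl, pow_add]
    have : u ≤ u ^ 300 := le_self_pow₀ hu1 (by norm_num)
    have h3 : 0 < u ^ 2700 := by positivity
    nlinarith
  have h1027 : u ^ 1000 ≤ u ^ 2700 := pow_le_pow_right₀ hu1 (by norm_num)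
  set M : ℕ := (N / 2) / L + 1 with hM
  have hML1 : N / 2 < M * L := by
    rw [hM]
    have := Nat.div_add_mod (N/2) L
    have h2 := Nat.mod_lt (N/2) (show L > 0 by omega)
    nlinarith
  have hML2 : M * L ≤ N / 2 + L := by
    rw [hM, add_mul, one_mul]
    exact Nat.add_le_add_right (Nat.div_mul_le_self _ _) _
  have hML3 : n1 + M * L ≤ N := by
    have h1 : ((N/2 : ℕ):ℝ) ≤ T / 2 := Nat.cast_div_le
    have h2 : ((M * L : ℕ) : ℝ) ≤ ((N/2 + L : ℕ) : ℝ) := by exact_mod_cast hML2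
    push_cast at h2
    have h3 : ((n1 + M * L : ℕ):ℝ) ≤ N := by
      push_cast
      rw [← hT]
      push_cast at h1
      linarith
    exact_mod_cast h3
  have hMT : (M:ℝ) ≤ u ^ 2000 := by
    have h1 : (M:ℝ) * L ≤ T := by
      rw [hT]; exact_mod_cast (by omega : M * L ≤ N)
    have h2 : (M:ℝ) * u ^ 1000 ≤ u ^ 2000 * u ^ 1000 := by
      rw [← pow_add]
      calc (M:ℝ) * u ^ 1000 ≤ M * L := by gcongr
        _ ≤ _ := by rw [← hTu]; exact h1
    exact le_of_mul_le_mul_right h2 (by positivity)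
  -- points
  set y : ℕ → ℝ := fun i => ((m * (n1 + i * L) + b : ℕ) : ℝ) with hy
  have hx_low : ∀ n : ℕ, n1 ≤ n → u ^ 2700 ≤ ((m * n + b : ℕ) : ℝ) := by
    intro n hn
    have h1 : n1 ≤ m * n + b := by nlinarith
    exact hn1a.trans (by exact_mod_cast h1)
  have hx_X : ∀ n : ℕ, n1 ≤ n → X ≤ ((m * n + b : ℕ) : ℝ) := by
    intro n hn
    exact (huX.trans (le_self_pow₀ hu1 (by norm_num))).trans (hx_low n hn)
  have hx_up : ∀ n : ℕ, n < N → ((m * n + b : ℕ) : ℝ) ≤ u ^ 3003 := by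
    intro n hn
    have h1 : m * n + b ≤ m * N := by nlinarith
    have h2 : ((m * n + b : ℕ) : ℝ) ≤ m * T := by rw [hT]; exact_mod_cast h1
    refine h2.trans ?_
    rw [hTu, show 3003 = 3 + 3000 from rfl, pow_add]; gcongr
  have hiL : ∀ i < M, n1 + i * L < N := by
    intro i hi
    have : i * L + L ≤ M * L := by nlinarith
    omega
  have hyX : ∀ i, X ≤ y i := fun i => hx_X _ (Nat.le_add_right _ _)
  have hpow2 : ∀ s : ℝ, 0 ≤ s → s ≤ 73/72 + 1/10000 → (u ^ 3003) ^ s ≤ u ^ 3054 := by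
    intro s _ hs
    rw [← Real.rpow_natCast, ← Real.rpow_mul hu0.le, ← Real.rpow_natCast]
    apply Real.rpow_le_rpow_of_exponent_le hu1
    push_cast; linarith
  set H : ℕ → ℕ := fun i => ⌊1 / (6 * deriv φ (y i))⌋₊ with hH
  have hdp : ∀ i, 0 < deriv φ (y i) := fun i => hΦ.pos _ (hyX i)
  have hone : ∀ i, 1 ≤ 1 / (6 * deriv φ (y i)) := by
    intro i
    rw [le_div_iff₀ (by linarith [hdp i])]
    linarith [hΦ.le _ (hyX i)]
  have hH1 : ∀ i, 1 ≤ H i := fun i => Nat.le_floor (by exact_mod_cast hone i)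
  have hHle : ∀ i, (H i : ℝ) ≤ 1 / (6 * deriv φ (y i)) := fun i => Nat.floor_le (by linarith [hone i])
  have hHge : ∀ i, 1 / (12 * deriv φ (y i)) ≤ H i := by
    intro i
    have h1 := Nat.lt_floor_add_one (1 / (6 * deriv φ (y i)))
    have h2 : (1:ℝ) ≤ H i := by exact_mod_cast hH1 i
    have h3 : 1 / (6 * deriv φ (y i)) = 2 * (1 / (12 * deriv φ (y i))) := by
      have := (hdp i).ne'; field_simp; norm_num
    rw [h3] at h1
    have h4 : (⌊2 * (1 / (12 * deriv φ (y i)))⌋₊ : ℝ) = H i := by rw [hH, ← h3]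
    rw [h4] at h1; linarith
  set Hm : ℕ := ⌊u ^ 50⌋₊ with hHm
  have hHmle : (Hm:ℝ) ≤ u ^ 50 := Nat.floor_le (by positivity)
  have hHHm : ∀ i < M, H i ≤ Hm := by
    intro i hi
    apply Nat.le_floor
    refine (hHle i).trans ?_
    have h1 := hΦ.low _ (hyX i)
    have hyi : 0 < y i := by linarith [hyX i, hΦ.one_le]
    have h2 : 1 / (6 * deriv φ (y i)) ≤ 1 / (y i ^ (γ - 1 - 1/10000)) := by
      apply one_div_le_one_div_of_le (by positivity)
      linarith [hdp i]
    refine h2.trans ?_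
    rw [one_div, ← Real.rpow_neg hyi.le]
    calc y i ^ (-(γ - 1 - 1/10000)) ≤ (u ^ 3003) ^ (-(γ - 1 - 1/10000)) :=
          Real.rpow_le_rpow hyi.le (hx_up _ (hiL i hi)) (by linarith)
      _ ≤ u ^ 50 := by
        rw [← Real.rpow_natCast, ← Real.rpow_mul hu0.le, ← Real.rpow_natCast]
        apply Real.rpow_le_rpow_of_exponent_le hu1
        push_cast; linarith
  -- index map
  have hdecomp : ∀ n ∈ Finset.Ico n1 (n1 + M * L), (n - n1) / L < M ∧ n = (n1 + ((n - n1) / L) * L) + (n - n1) % L := by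
    intro n hn
    rw [Finset.mem_Ico] at hn
    constructor
    · rw [Nat.div_lt_iff_lt_mul (by omega)]; omega
    · have := Nat.div_add_mod' (n - n1) L
      omega
  set K : ℕ → ℝ := fun n => FK (H ((n - n1) / L)) (φ ((m * n + b : ℕ) : ℝ)) with hK
  refine ⟨Finset.Ico n1 (n1 + M * L), K, ?_, ?_, ?_, ?_, ?_, ?_, ?_⟩
  · intro n hn; rw [Finset.mem_Ico] at hn; rw [Finset.mem_range]; omega
  · intro n hn; rw [Finset.mem_Ico] at hn; rw [h910]
    exact hn1a.trans (by exact_mod_cast hn.1)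
  · intro n hn; rw [Finset.mem_Ico] at hn; exact hx_X n hn.1
  · intro n hn1' hn2
    rw [h910] at hn1'
    rw [Finset.mem_Ico]
    refine ⟨?_, by omega⟩
    exact_mod_cast hn1b.trans hn1'
  · intro n; exact FK_nonneg _ _
  · intro n hn hP
    obtain ⟨hi, hdec⟩ := hdecomp n hn
    have hnn := Finset.mem_Ico.1 hn
    set i := (n - n1) / L with hi'
    set l := (n - n1) % L with hl'
    have hlL : l < L := Nat.mod_lt _ (by omega)
    set z : ℝ := ((m * n + b : ℕ) : ℝ) with hz
    have hzX : X ≤ z := hx_X n hnn.1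
    have hyz : z - y i = m * l := by
      rw [hz, hy]; simp only []
      rw [hdec]; push_cast; ring
    have hyz' : y i ≤ z := by
      have : (0:ℝ) ≤ m * l := by positivity
      linarith
    have hnear := hΦ.near _ hP hzX
    have hanti := hΦ.anti _ (hyX i) z hyz'
    have hlip := hΦ.lip _ (hyX i) z hyz'
    have hdz := hΦ.pos z hzX
    have hdi := hdp i
    have hylow : u ^ 2700 ≤ y i := hx_low _ (Nat.le_add_right _ _)
    have hcmp : deriv φ (y i) ≤ 2 * deriv φ z := by
      have h1 : 20 * deriv φ (y i) / y i * (z - y i) ≤ deriv φ (y i) / 2 := by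
        rw [hyz, div_mul_eq_mul_div, div_le_iff₀ (by linarith)]
        have h2 : (m:ℝ) * l ≤ u ^ 3 * (2 * u ^ 1000) := by
          have : (l:ℝ) ≤ L := by exact_mod_cast hlL.le
          gcongr; linarith
        have h3 : 40 * (u ^ 3 * (2 * u ^ 1000)) ≤ u ^ 2700 := by
          calc 40 * (u ^ 3 * (2 * u ^ 1000)) = 80 * u ^ 1003 := by ring
            _ ≤ u * u ^ 1003 := by gcongr; linarith
            _ = u ^ 1004 := by ring
            _ ≤ _ := pow_le_pow_right₀ hu1 (by norm_num)
        nlinarith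
      linarith
    have hlow := FK_lower (H i) (φ z) (by
      calc (H i : ℝ) * nint (φ z) ≤ 1 / (6 * deriv φ (y i)) * deriv φ (y i) := by
            apply mul_le_mul (hHle i) (hnear.trans hanti) (nint_nonneg _) (by positivity)
        _ = 1/6 := by field_simp)
    have h5 := hHge i
    have h6 : 1 / deriv φ z ≤ 24 * (1 / (12 * deriv φ (y i))) := by
      have : 24 * (1 / (12 * deriv φ (y i))) = 2 / deriv φ (y i) := by field_simp; norm_num
      rw [this, div_le_div_iff₀ hdz hdi]; linarith
    have h7 : K n = FK (H i) (φ z) := rfl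
    rw [h7]; linarith
  · intro θ
    have hsum : ∑ n ∈ Finset.Ico n1 (n1 + M * L), ((K n : ℂ) - 1) * e (n * θ) =
        ∑ i ∈ Finset.range M, ∑ l ∈ Finset.range L,
      (((FK (H i) (φ ((m * ((n1 + i * L) + l) + b : ℕ) : ℝ)) : ℝ) : ℂ) - 1) * e ((((n1 + i * L) + l : ℕ) : ℝ) * θ) := by
      rw [sum_blocks]
      apply Finset.sum_congr rfl; intro i _
      apply Finset.sum_congr rfl; intro l hl
      have h1 : (n1 + i * L + l - n1) / L = i := by
        have : n1 + i * L + l - n1 = l + i * L := by omega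
        rw [this, Nat.add_mul_div_right _ _ (by omega), Nat.div_eq_of_lt (Finset.mem_range.1 hl), zero_add]
      have h2 : K (n1 + i * L + l) = FK (H i) (φ ((m * ((n1 + i * L) + l) + b : ℕ) : ℝ)) := by
        simp only [hK]; rw [h1]
      rw [h2]
    rw [hsum, h94]
    refine (K_bound hΦ hγ (by norm_num) m b n1 L M hm hLpos Hm (u ^ 3003) (u ^ 500)⁻¹ (by positivity)
      (hx_X n1 le_rfl) (fun i hi => hx_up _ (hiL i hi)) (by positivity) H (fun i hi => ⟨hH1 i, hHHm i hi⟩) θ).trans ?_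
    apply YB_num M L m Hm _ _ γ _ u hu2 hMT hLpos hL2 hmu (by positivity) hHmle (by positivity) _ (hx_low n1 le_rfl)
    rw [← Real.rpow_neg (by positivity)]
    exact hpow2 _ (by linarith) (by linarith)

end PS

namespace PS

noncomputable def hh (N : ℕ) (R : Finset ℕ) (c : ℕ → ℂ) (n : ℕ) : ℂ :=
  ∑ ξ ∈ R, c ξ * e (-((ξ : ℝ) * n / N))

lemma hh_norm_le (N : ℕ) (R : Finset ℕ) (c : ℕ → ℂ) (hc : ∀ ξ, ‖c ξ‖ ≤ 1) (n : ℕ) : ‖hh N R c n‖ ≤ R.card := by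
  unfold hh
  calc _ ≤ ∑ ξ ∈ R, (1:ℝ) := by
        apply norm_sum_le_of_le
        intro ξ _
        rw [norm_mul, norm_e, mul_one]; exact hc ξ
    _ = _ := by simp

lemma hh_sq (N : ℕ) (R : Finset ℕ) (c : ℕ → ℂ) (n : ℕ) :
    ((‖hh N R c n‖ ^ 2 : ℝ) : ℂ) = ∑ ξ ∈ R, ∑ ξ' ∈ R, c ξ * (starRingEnd ℂ) (c ξ') * e (n * (((ξ':ℝ) - ξ) / N)) := by
  push_cast
  rw [← Complex.mul_conj', hh, map_sum, Finset.sum_mul_sum]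
  apply Finset.sum_congr rfl; intro ξ _
  apply Finset.sum_congr rfl; intro ξ' _
  rw [map_mul, ← e_neg]
  rw [show (n:ℝ) * (((ξ':ℝ) - ξ) / N) = -((ξ : ℝ) * n / N) + - (-((ξ' : ℝ) * n / N)) by ring, e_add]
  ring

lemma expand_sq (N : ℕ) (R : Finset ℕ) (c : ℕ → ℂ) (hc : ∀ ξ, ‖c ξ‖ ≤ 1) (I : Finset ℕ) (w : ℕ → ℂ) (B : ℝ)
    (hB : ∀ θ : ℝ, ‖∑ n ∈ I, w n * e (n * θ)‖ ≤ B) :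
    ‖∑ n ∈ I, w n * ((‖hh N R c n‖ ^ 2 : ℝ) : ℂ)‖ ≤ (R.card:ℝ) ^ 2 * B := by
  have hB0 : 0 ≤ B := (norm_nonneg _).trans (hB 0)
  have h1 : ∑ n ∈ I, w n * ((‖hh N R c n‖ ^ 2 : ℝ) : ℂ) = ∑ ξ ∈ R, ∑ ξ' ∈ R, (c ξ * (starRingEnd ℂ) (c ξ')) *
      ∑ n ∈ I, w n * e (n * (((ξ':ℝ) - ξ) / N)) := by
    simp only [hh_sq, Finset.mul_sum]
    rw [Finset.sum_comm]
    apply Finset.sum_congr rfl; intro ξ _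
    rw [Finset.sum_comm]
    apply Finset.sum_congr rfl; intro ξ' _
    apply Finset.sum_congr rfl; intro n _
    ring
  rw [h1]
  calc _ ≤ ∑ ξ ∈ R, ∑ ξ' ∈ R, B := by
        apply norm_sum_le_of_le; intro ξ _
        apply norm_sum_le_of_le; intro ξ' _
        rw [norm_mul, norm_mul, Complex.norm_conj]
        calc ‖c ξ‖ * ‖c ξ'‖ * _ ≤ 1 * 1 * B := by
              gcongr
              · exact hc ξ
              · exact hc ξ'
              · exact hB _
          _ = B := by ring
    _ = _ := by simp; ring

lemma orth (N : ℕ) (hN : 0 < N) (ξ ξ' : ℕ) (h : ξ < N) (h' : ξ' < N) (hne : ξ ≠ ξ') :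
    ∑ n ∈ Finset.range N, e (n * (((ξ':ℝ) - ξ) / N)) = 0 := by
  have hN' : (N:ℝ) ≠ 0 := by exact_mod_cast hN.ne'
  simp only [e_nat_mul]
  have h1 : e (((ξ':ℝ) - ξ) / N) ≠ 1 := by
    intro h2
    obtain ⟨k, hk⟩ := (e_eq_one_iff _).1 h2
    rw [div_eq_iff hN'] at hk
    have hk' : (ξ':ℤ) - ξ = k * N := by exact_mod_cast hk
    rcases lt_trichotomy k 0 with h3 | h3 | h3
    · nlinarith
    · rw [h3] at hk'; omega
    · nlinarith
  have h3 := geom_sum_mul (e (((ξ':ℝ) - ξ) / N)) N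
  rw [← e_nat_mul, show (N:ℝ) * (((ξ':ℝ) - ξ) / N) = (((ξ':ℤ) - ξ : ℤ) : ℝ) by push_cast; field_simp, e_int, sub_self] at h3
  rcases mul_eq_zero.1 h3 with h4 | h4
  · exact h4
  · exact absurd (sub_eq_zero.1 h4) h1

lemma hh_l2 (N : ℕ) (hN : 0 < N) (R : Finset ℕ) (hR : R ⊆ Finset.range N) (c : ℕ → ℂ) (hc : ∀ ξ, ‖c ξ‖ ≤ 1) :
    ∑ n ∈ Finset.range N, ‖hh N R c n‖ ^ 2 ≤ N * R.card := by
  have h1 : ((∑ n ∈ Finset.range N, ‖hh N R c n‖ ^ 2 : ℝ) : ℂ) = ∑ ξ ∈ R, (c ξ * (starRingEnd ℂ) (c ξ)) * N := by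
    rw [Complex.ofReal_sum]
    simp only [hh_sq]
    rw [Finset.sum_comm]
    apply Finset.sum_congr rfl; intro ξ hξ
    rw [Finset.sum_comm]
    simp only [← Finset.mul_sum]
    rw [Finset.sum_eq_single_of_mem ξ hξ]
    · simp [e_zero]
    · intro ξ' hξ' hne
      rw [orth N hN ξ ξ' (Finset.mem_range.1 (hR hξ)) (Finset.mem_range.1 (hR hξ')) hne.symm, mul_zero]
  have h2 : ‖((∑ n ∈ Finset.range N, ‖hh N R c n‖ ^ 2 : ℝ) : ℂ)‖ ≤ N * R.card := by
    rw [h1]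
    calc _ ≤ ∑ ξ ∈ R, (N:ℝ) := by
          apply norm_sum_le_of_le; intro ξ _
          rw [norm_mul, norm_mul, Complex.norm_conj, Complex.norm_natCast]
          have := hc ξ
          have h0 := norm_nonneg (c ξ)
          calc ‖c ξ‖ * ‖c ξ‖ * (N:ℝ) ≤ 1 * 1 * N := by gcongr
            _ = N := by ring
      _ = _ := by simp; ring
  rw [Complex.norm_real] at h2
  exact (le_abs_self _).trans h2

/-- duality -/
lemma dual (N : ℕ) (R : Finset ℕ) (f ν : ℕ → ℝ) (hf : ∀ n, |f n| ≤ ν n) (δ : ℝ) (hδ : 0 ≤ δ)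
    (h : ∀ ξ ∈ R, δ ≤ ‖fourierZN N f ξ‖) :
    ∃ c : ℕ → ℂ, (∀ ξ, ‖c ξ‖ ≤ 1) ∧ δ * R.card ≤ ∑ n ∈ Finset.range N, ν n * ‖hh N R c n‖ := by
  refine ⟨fun ξ => if fourierZN N f ξ = 0 then 0 else (starRingEnd ℂ) (fourierZN N f ξ) / ‖fourierZN N f ξ‖, ?_, ?_⟩
  · intro ξ
    simp only []
    split_ifs with h0
    · simp
    · rw [norm_div, Complex.norm_conj, Complex.norm_real, norm_norm, div_self (by simpa using h0)]
  · set c : ℕ → ℂ := fun ξ => if fourierZN N f ξ = 0 then 0 else (starRingEnd ℂ) (fourierZN N f ξ) / ‖fourierZN N f ξ‖ with hc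
    have h1 : ∀ ξ, c ξ * fourierZN N f ξ = (‖fourierZN N f ξ‖ : ℂ) := by
      intro ξ
      simp only [hc]
      split_ifs with h0
      · simp [h0]
      · have h2 : (‖fourierZN N f ξ‖ : ℂ) ≠ 0 := by
          simpa using h0
        rw [div_mul_eq_mul_div, div_eq_iff h2, mul_comm, Complex.mul_conj', sq]
    have h2 : ((∑ ξ ∈ R, ‖fourierZN N f ξ‖ : ℝ) : ℂ) = ∑ n ∈ Finset.range N, (f n : ℂ) * hh N R c n := by
      rw [Complex.ofReal_sum, Finset.sum_congr rfl (fun ξ _ => (h1 ξ).symm)]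
      simp only [fourierZN, hh, Finset.mul_sum]
      rw [Finset.sum_comm]
      apply Finset.sum_congr rfl; intro n _
      apply Finset.sum_congr rfl; intro ξ _
      ring
    calc δ * R.card = ∑ ξ ∈ R, δ := by simp; ring
      _ ≤ ∑ ξ ∈ R, ‖fourierZN N f ξ‖ := Finset.sum_le_sum h
      _ ≤ ‖((∑ ξ ∈ R, ‖fourierZN N f ξ‖ : ℝ) : ℂ)‖ := by rw [Complex.norm_real]; exact le_abs_self _
      _ ≤ _ := by
        rw [h2]
        apply norm_sum_le_of_le; intro n _
        rw [norm_mul, Complex.norm_real]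
        exact mul_le_mul_of_nonneg_right (hf n) (norm_nonneg _)

lemma dual_sq (N : ℕ) (R : Finset ℕ) (f ν : ℕ → ℝ) (hf : ∀ n, |f n| ≤ ν n) (δ : ℝ) (hδ : 0 ≤ δ)
    (h : ∀ ξ ∈ R, δ ≤ ‖fourierZN N f ξ‖) :
    ∃ c : ℕ → ℂ, (∀ ξ, ‖c ξ‖ ≤ 1) ∧ (δ * R.card) ^ 2 ≤ (∑ n ∈ Finset.range N, ν n) *
      ∑ n ∈ Finset.range N, ν n * ‖hh N R c n‖ ^ 2 := by
  obtain ⟨c, hc, h1⟩ := dual N R f ν hf δ hδ h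
  refine ⟨c, hc, ?_⟩
  have hν : ∀ n, 0 ≤ ν n := fun n => (abs_nonneg _).trans (hf n)
  refine (pow_le_pow_left₀ (by positivity) h1 2).trans ?_
  apply Finset.sum_sq_le_sum_mul_sum_of_sq_le_mul
  · intro n _; exact hν n
  · intro n _; exact mul_nonneg (hν n) (by positivity)
  · intro n _; exact le_of_eq (by ring)

lemma dual_l2 (N : ℕ) (hN : 0 < N) (R : Finset ℕ) (hR : R ⊆ Finset.range N) (f : ℕ → ℝ) (δ : ℝ) (hδ : 0 ≤ δ)
    (h : ∀ ξ ∈ R, δ ≤ ‖fourierZN N f ξ‖) :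
    δ ^ 2 * R.card ≤ N * ∑ n ∈ Finset.range N, f n ^ 2 := by
  obtain ⟨c, hc, h1⟩ := dual N R f (fun n => |f n|) (fun n => le_rfl) δ hδ h
  have h2 : (δ * R.card) ^ 2 ≤ (∑ n ∈ Finset.range N, f n ^ 2) * ∑ n ∈ Finset.range N, ‖hh N R c n‖ ^ 2 := by
    refine (pow_le_pow_left₀ (by positivity) h1 2).trans ?_
    apply Finset.sum_sq_le_sum_mul_sum_of_sq_le_mul
    · intro n _; positivity
    · intro n _; positivity
    · intro n _; rw [mul_pow, sq_abs]
  have h3 := hh_l2 N hN R hR c hc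
  have h0 : 0 ≤ ∑ n ∈ Finset.range N, f n ^ 2 := Finset.sum_nonneg (fun n _ => sq_nonneg _)
  rcases Nat.eq_zero_or_pos R.card with hz | hz
  · rw [hz]; simp; positivity
  have hz' : (0:ℝ) < R.card := by exact_mod_cast hz
  have h4 : R.card * (δ ^ 2 * R.card) ≤ R.card * (N * ∑ n ∈ Finset.range N, f n ^ 2) := by
    calc _ = (δ * R.card) ^ 2 := by ring
      _ ≤ _ := h2
      _ ≤ (∑ n ∈ Finset.range N, f n ^ 2) * (N * R.card) := by gcongr
      _ = _ := by ring
  exact le_of_mul_le_mul_left h4 hz'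

end PS

namespace PS

lemma SS_sum : ∃ C : ℝ, 1 ≤ C ∧ ∀ N m b D : ℕ, 1 ≤ D →
    ∑ n ∈ Finset.range N, SS (PP D m) D (m * n + b) ≤ C * N + 2 * (D:ℝ) ^ 10 := by
  obtain ⟨C, hC, hc⟩ := coef_small
  refine ⟨C, hC, fun N m b D hD => ?_⟩
  have hD' : (1:ℝ) ≤ D := by exact_mod_cast hD
  have h := sieve_sum (P := PP D m) PP_prime hD' m b N PP_coprime (V := fam (PP D m) ((D:ℝ)^2)) (fun v hv => hv) C
    (by linarith) (by
      intro v hv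
      refine (hc _ PP_prime v (mem_fam.1 hv).1).trans ?_
      have h1 : (1:ℝ) ≤ qq v := by exact_mod_cast qq_pos PP_prime (mem_fam.1 hv).1
      have h2 : (qq v:ℝ) ^ (-(3/4):ℝ) ≤ 1 := Real.rpow_le_one_of_one_le_of_nonpos h1 (by norm_num)
      nlinarith) 0
  simp only [mul_zero, e_zero, mul_one] at h
  rw [← Complex.ofReal_sum, Complex.norm_real] at h
  refine le_trans ?_ h
  refine le_trans (le_of_eq ?_) (le_abs_self _)
  apply Finset.sum_congr rfl; intro n _
  exact SS_eq_SV PP_prime _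

lemma SH (ε0 : ℝ) (hε0 : 0 < ε0) : ∃ p : ℕ, 1 ≤ p ∧ ∀ κ : ℝ, 0 < κ → ∃ C : ℝ, 1 ≤ C ∧
    ∀ N m b D : ℕ, 0 < N → 1 ≤ D → (D:ℝ) ^ (2 * p) ≤ N → ∀ δ : ℝ, 0 < δ → δ ≤ 1 →
    ∀ R ⊆ Finset.range N, ∀ c : ℕ → ℂ, (∀ ξ, ‖c ξ‖ ≤ 1) →
    ∑ n ∈ Finset.range N, SS (PP D m) D (m * n + b) * ‖hh N R c n‖ ^ 2 ≤
      C * δ ^ (-ε0) * N * R.card + (R.card:ℝ) ^ 2 * (κ * δ ^ 2 * N + 2 * (D:ℝ) ^ 10) := by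
  set p : ℕ := ⌈3 / ε0⌉₊ + 2 with hp
  have hp1 : (3:ℝ) / ε0 ≤ (p:ℝ) - 1 := by
    rw [hp]; push_cast; linarith [Nat.le_ceil (3 / ε0)]
  have hp3 : 3 ≤ ε0 * ((p:ℝ) - 1) := by
    rw [div_le_iff₀ hε0] at hp1; linarith
  have hp2 : 2 ≤ p := by omega
  have hp0 : (0:ℝ) < p := by positivity
  refine ⟨p, by omega, fun κ hκ => ?_⟩
  set ε : ℝ := 1 / (6 * p) with hε
  have hεp : 0 < ε := by positivity
  obtain ⟨Ch, hCh, hhead⟩ := head_bound ε hεp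
  obtain ⟨Cm, hCm, hmom⟩ := moment p ε hεp
  obtain ⟨Cc, hCc, hcoef⟩ := coef_small
  set C0 : ℝ := 1 + 2 * Cc / κ with hC0
  have hC01 : 1 ≤ C0 := by have : 0 < 2 * Cc / κ := by positivity
                           linarith
  set C' : ℝ := C0 ^ (4/3:ℝ) with hC'
  have hC'1 : 1 ≤ C' := Real.one_le_rpow hC01 (by norm_num)
  have hC'2 : Cc * C' ^ (-(3/4):ℝ) ≤ κ / 2 := by
    rw [hC', ← Real.rpow_mul (by linarith), show (4/3:ℝ) * (-(3/4)) = -1 by norm_num, Real.rpow_neg_one,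
      ← div_eq_mul_inv, div_le_iff₀ (by linarith), hC0]
    have : κ / 2 * (1 + 2 * Cc / κ) = κ / 2 + Cc := by field_simp
    linarith
  set E : ℝ := Ch ^ p * Cm * C' with hE
  have hE0 : 0 < E := by positivity
  set C3 : ℝ := E * (2 / κ) + 1 with hC3
  have hC31 : 1 ≤ C3 := by
    have : 0 < E * (2 / κ) := by positivity
    linarith
  refine ⟨C3, hC31, fun N m b D hN hD hDN δ hδ hδ1 R hR c hc => ?_⟩
  have hD' : (1:ℝ) ≤ D := by exact_mod_cast hD
  have hN' : (0:ℝ) < N := by exact_mod_cast hN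
  set P := PP D m with hP
  have hPp : ∀ p ∈ P, p.Prime := PP_prime
  have hPm : ∀ p ∈ P, Nat.Coprime p m := PP_coprime
  set Q0 : ℝ := C' * δ ^ (-3:ℝ) with hQ0
  have hδ3 : 1 ≤ δ ^ (-3:ℝ) := Real.one_le_rpow_of_pos_of_le_one_of_nonpos hδ hδ1 (by norm_num)
  have hQ01 : 1 ≤ Q0 := by rw [hQ0]; nlinarith
  set Q : ℝ := min Q0 ((D:ℝ)^2) with hQ
  have hQ1 : 1 ≤ Q := le_min hQ01 (one_le_pow₀ hD')
  have hQQ0 : Q ≤ Q0 := min_le_left _ _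
  have hQD : Q ≤ (D:ℝ)^2 := min_le_right _ _
  have hsub : fam P Q ⊆ fam P ((D:ℝ)^2) := fun v hv => by
    rw [mem_fam] at hv ⊢; exact ⟨hv.1, hv.2.trans hQD⟩
  set V := fam P ((D:ℝ)^2) \ fam P Q with hV
  have hsplit : ∀ x, SS P D x = SV P D (fam P Q) x + SV P D V x := by
    intro x
    rw [SS_eq_SV hPp]
    unfold SV
    rw [hV, add_comm, Finset.sum_sdiff hsub]
  -- tail
  have htail : ∑ n ∈ Finset.range N, SV P D V (m * n + b) * ‖hh N R c n‖ ^ 2 ≤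
      (R.card:ℝ) ^ 2 * (κ / 2 * δ ^ 2 * N + 2 * (D:ℝ) ^ 10) := by
    have h1 := sieve_sum (P := P) hPp hD' m b N hPm (V := V) Finset.sdiff_subset (κ / 2 * δ ^ 2) (by positivity) (by
      intro v hv
      rw [hV, Finset.mem_sdiff, mem_fam, mem_fam] at hv
      have hq : Q0 < qq v := by
        by_contra hcon
        exact hv.2 ⟨hv.1.1, le_min (not_lt.1 hcon) hv.1.2⟩
      refine (hcoef _ hPp v hv.1.1).trans ?_
      have h2 : (qq v:ℝ) ^ (-(3/4):ℝ) ≤ Q0 ^ (-(3/4):ℝ) :=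
        Real.rpow_le_rpow_of_nonpos (by linarith) hq.le (by norm_num)
      have h3 : Q0 ^ (-(3/4):ℝ) = C' ^ (-(3/4):ℝ) * δ ^ (9/4:ℝ) := by
        rw [hQ0, Real.mul_rpow (by linarith) (by positivity), ← Real.rpow_mul hδ.le]
        norm_num
      have h4 : δ ^ (9/4:ℝ) ≤ δ ^ 2 := by
        rw [← Real.rpow_natCast]
        exact Real.rpow_le_rpow_of_exponent_ge hδ hδ1 (by norm_num)
      calc Cc * (qq v:ℝ) ^ (-(3/4):ℝ) ≤ Cc * (C' ^ (-(3/4):ℝ) * δ ^ (9/4:ℝ)) := by rw [← h3]; gcongr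
        _ = (Cc * C' ^ (-(3/4):ℝ)) * δ ^ (9/4:ℝ) := by ring
        _ ≤ κ / 2 * δ ^ 2 := by gcongr)
    have h2 := expand_sq N R c hc (Finset.range N) (fun n => ((SV P D V (m * n + b) : ℝ) : ℂ)) _ h1
    refine le_trans ?_ h2
    have h3 : ∑ n ∈ Finset.range N, ((SV P D V (m * n + b) : ℝ) : ℂ) * ((‖hh N R c n‖ ^ 2 : ℝ) : ℂ) =
      ((∑ n ∈ Finset.range N, SV P D V (m * n + b) * ‖hh N R c n‖ ^ 2 : ℝ) : ℂ) := by push_cast; rfl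
    rw [h3, Complex.norm_real]; exact le_abs_self _
  -- head
  have hQpow : Q ^ p ≤ N := by
    calc Q ^ p ≤ ((D:ℝ)^2) ^ p := by gcongr
      _ = (D:ℝ) ^ (2 * p) := by rw [pow_mul]
      _ ≤ N := hDN
  have hmo := hmom P m b N Q hPp hPm hQ1 hQpow
  set U : ℕ → ℝ := fun n => Ch * Q ^ ε * tq P Q (m * n + b) with hU
  have hU0 : ∀ n, 0 ≤ U n := fun n => by positivity
  set W : ℝ := C3 * δ ^ (-ε0) with hW
  have hδε : 1 ≤ δ ^ (-ε0) := Real.one_le_rpow_of_pos_of_le_one_of_nonpos hδ hδ1 (by linarith)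
  have hW0 : 0 < W := by positivity
  have hUp : ∑ n ∈ Finset.range N, U n ^ p ≤ E * δ ^ (-1:ℝ) * N := by
    have h1 : ∀ n, U n ^ p = Ch ^ p * (Q ^ ε) ^ p * (tq P Q (m * n + b) : ℝ) ^ p := fun n => by
      simp only [hU]; rw [mul_pow, mul_pow]
    simp only [h1]
    rw [← Finset.mul_sum]
    have h2 : (Q ^ ε) ^ p * Q ^ ε ≤ C' * δ ^ (-1:ℝ) := by
      calc (Q ^ ε) ^ p * Q ^ ε = Q ^ (ε * p + ε) := by
            rw [← Real.rpow_natCast, ← Real.rpow_mul (by linarith), ← Real.rpow_add (by linarith)]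
        _ ≤ Q ^ (1/3:ℝ) := by
            apply Real.rpow_le_rpow_of_exponent_le hQ1
            rw [hε]
            have : (1:ℝ) ≤ p := by exact_mod_cast (by omega : 1 ≤ p)
            have h5 : 1 / (6 * (p:ℝ)) * p = 1/6 := by field_simp
            have h6 : 1 / (6 * (p:ℝ)) ≤ 1/6 := by
              apply one_div_le_one_div_of_le (by norm_num); linarith
            linarith
        _ ≤ Q0 ^ (1/3:ℝ) := by gcongr
        _ = C' ^ (1/3:ℝ) * δ ^ (-1:ℝ) := by
            rw [hQ0, Real.mul_rpow (by linarith) (by positivity), ← Real.rpow_mul hδ.le]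
            norm_num
        _ ≤ C' * δ ^ (-1:ℝ) := by
            gcongr
            conv_rhs => rw [← Real.rpow_one C']
            exact Real.rpow_le_rpow_of_exponent_le hC'1 (by norm_num)
    calc Ch ^ p * (Q ^ ε) ^ p * ∑ n ∈ Finset.range N, (tq P Q (m * n + b) : ℝ) ^ p
        ≤ Ch ^ p * (Q ^ ε) ^ p * (Cm * N * Q ^ ε) := by gcongr
      _ = Ch ^ p * Cm * N * ((Q ^ ε) ^ p * Q ^ ε) := by ring
      _ ≤ Ch ^ p * Cm * N * (C' * δ ^ (-1:ℝ)) := by gcongr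
      _ = _ := by rw [hE]; ring
  have hhd : ∑ n ∈ Finset.range N, SV P D (fam P Q) (m * n + b) * ‖hh N R c n‖ ^ 2 ≤
      W * N * R.card + (R.card:ℝ) ^ 2 * (κ / 2 * δ ^ 2 * N) := by
    have hpt : ∀ n ∈ Finset.range N, SV P D (fam P Q) (m * n + b) * ‖hh N R c n‖ ^ 2 ≤
        W * ‖hh N R c n‖ ^ 2 + (R.card:ℝ) ^ 2 * (U n ^ p / W ^ (p - 1)) := by
      intro n _
      have h1 : SV P D (fam P Q) (m * n + b) ≤ U n :=
        (le_abs_self _).trans (hhead P D Q (m * n + b) hPp hD' hQ1)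
      have h2 : ‖hh N R c n‖ ^ 2 ≤ (R.card:ℝ) ^ 2 :=
        pow_le_pow_left₀ (norm_nonneg _) (hh_norm_le N R c hc n) 2
      have h3 : 0 ≤ U n ^ p / W ^ (p - 1) := div_nonneg (pow_nonneg (hU0 n) _) (by positivity)
      have h4 : SV P D (fam P Q) (m * n + b) * ‖hh N R c n‖ ^ 2 ≤ U n * ‖hh N R c n‖ ^ 2 := by gcongr
      rcases le_total (U n) W with h | h
      · have h5 : U n * ‖hh N R c n‖ ^ 2 ≤ W * ‖hh N R c n‖ ^ 2 := by gcongr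
        have h6 : 0 ≤ (R.card:ℝ) ^ 2 * (U n ^ p / W ^ (p - 1)) := by positivity
        linarith
      · have h5 : U n ≤ U n ^ p / W ^ (p - 1) := by
          rw [le_div_iff₀ (by positivity)]
          calc U n * W ^ (p-1) ≤ U n * U n ^ (p-1) := by
                have := hU0 n; gcongr
            _ = U n ^ p := by rw [mul_pow_sub_one (by omega)]
        have h6 : U n * ‖hh N R c n‖ ^ 2 ≤ U n ^ p / W ^ (p - 1) * (R.card:ℝ) ^ 2 :=
          mul_le_mul h5 h2 (by positivity) h3
        have h7 : 0 ≤ W * ‖hh N R c n‖ ^ 2 := by positivity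
        linarith
    refine (Finset.sum_le_sum hpt).trans ?_
    rw [Finset.sum_add_distrib, ← Finset.mul_sum, ← Finset.mul_sum, ← Finset.sum_div]
    have h1 := hh_l2 N hN R hR c hc
    have h2 : (∑ n ∈ Finset.range N, U n ^ p) / W ^ (p-1) ≤ κ / 2 * δ ^ 2 * N := by
      rw [div_le_iff₀ (by positivity)]
      refine hUp.trans ?_
      have h3 : C3 * δ ^ (-3:ℝ) ≤ W ^ (p-1) := by
        rw [hW, mul_pow]
        apply mul_le_mul
        · exact le_self_pow₀ hC31 (by omega)
        · rw [← Real.rpow_natCast, ← Real.rpow_mul hδ.le]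
          apply Real.rpow_le_rpow_of_exponent_ge hδ hδ1
          rw [Nat.cast_sub (by omega)]; push_cast; linarith
        · positivity
        · positivity
      have h4 : E ≤ κ / 2 * C3 := by
        rw [hC3]
        have : κ / 2 * (E * (2 / κ) + 1) = E + κ / 2 := by field_simp
        linarith
      have h5 : δ ^ (-1:ℝ) = δ ^ 2 * δ ^ (-3:ℝ) := by
        rw [← Real.rpow_natCast, ← Real.rpow_add hδ]; norm_num
      calc E * δ ^ (-1:ℝ) * N ≤ (κ / 2 * C3) * δ ^ (-1:ℝ) * N := by gcongr
        _ = κ / 2 * δ ^ 2 * N * (C3 * δ ^ (-3:ℝ)) := by rw [h5]; ring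
        _ ≤ _ := by gcongr
    calc _ ≤ W * (N * R.card) + (R.card:ℝ) ^ 2 * (κ / 2 * δ ^ 2 * N) := by gcongr
      _ = _ := by ring
  have hfin : ∑ n ∈ Finset.range N, SS P D (m * n + b) * ‖hh N R c n‖ ^ 2 =
      ∑ n ∈ Finset.range N, SV P D (fam P Q) (m * n + b) * ‖hh N R c n‖ ^ 2 +
      ∑ n ∈ Finset.range N, SV P D V (m * n + b) * ‖hh N R c n‖ ^ 2 := by
    rw [← Finset.sum_add_distrib]
    apply Finset.sum_congr rfl; intro n _
    rw [hsplit]; ring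
  rw [hfin]
  refine (add_le_add hhd htail).trans (le_of_eq ?_)
  ring

end PS

namespace PS

set_option maxHeartbeats 1000000 in
lemma weak_ii {φ : ℝ → ℝ} {P : Set ℕ} {γ X : ℝ} (hΦ : PhiOK φ P γ (1/10000) X) (hγ1 : 71/72 < γ) (hγ : γ ≤ 1)
    (ε0 : ℝ) (hε0 : 0 < ε0) :
    ∃ C : ℝ, 1 ≤ C ∧ ∃ N0 : ℕ, ∀ N ≥ N0, ∀ m b : ℕ, 1 ≤ m → (m:ℝ) ≤ (N:ℝ) ^ (1/1000:ℝ) → b < m →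
    ∀ f : ℕ → ℝ, (∀ n, f n ≠ 0 → 2 * (N:ℝ) ^ (9/10:ℝ) ≤ n ∧ n ≤ N / 2 ∧ m * n + b ∈ P ∧
      |f n| ≤ (Nat.totient m : ℝ) * Real.log (m * n + b) / (m * N * deriv φ ((m * n + b : ℕ) : ℝ))) →
    (∑ n ∈ Finset.range N, |f n| ≤ C) ∧
    ∀ δ : ℝ, (N:ℝ) ^ (-(1/56):ℝ) ≤ δ → δ ≤ 1 → ∀ R ⊆ Finset.range N, (∀ ξ ∈ R, δ / 2 ≤ ‖fourierZN N f ξ‖) →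
      (R.card : ℝ) ≤ C * δ ^ (-(2 + ε0)) := by
  obtain ⟨p, hp, hSH⟩ := SH ε0 hε0
  obtain ⟨N1, hG⟩ := partG hΦ hγ1 hγ
  obtain ⟨Cs, hCs, hsum⟩ := SS_sum
  have hp' : (1:ℝ) ≤ p := by exact_mod_cast hp
  set η : ℝ := 1 / (1000 * p) with hη
  have hη0 : 0 < η := by positivity
  have hη1 : η ≤ 1/1000 := by
    rw [hη]; apply one_div_le_one_div_of_le (by norm_num); linarith
  have hηp : η * p = 1/1000 := by rw [hη]; field_simp
  set C1 : ℝ := 96 * (8 / η) with hC1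
  have hC10 : 0 < C1 := by positivity
  set Cν : ℝ := C1 * (Cs + 3) with hCν
  have hCν0 : 0 < Cν := by positivity
  set Ca : ℝ := Cν * C1 with hCa
  have hCa0 : 0 < Ca := by positivity
  obtain ⟨C2, hC2, hS⟩ := hSH (1 / (16 * Ca)) (by positivity)
  have hlarge : ∀ᶠ N : ℕ in atTop, 48 * Ca ≤ (N:ℝ) ^ (1/100:ℝ) ∧ 2 ≤ (N:ℝ) ^ (η/2) ∧ (1:ℝ) < (N:ℝ) ∧ N1 ≤ N := by
    refine (Tendsto.eventually_ge_atTop ?_ _).and ((Tendsto.eventually_ge_atTop ?_ _).and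
      ((Tendsto.eventually_gt_atTop ?_ _).and (eventually_ge_atTop _)))
    · exact (tendsto_rpow_atTop (by norm_num)).comp tendsto_natCast_atTop_atTop
    · exact (tendsto_rpow_atTop (by positivity)).comp tendsto_natCast_atTop_atTop
    · exact tendsto_natCast_atTop_atTop
  obtain ⟨N0, hN0⟩ := eventually_atTop.1 hlarge
  refine ⟨max (max 1 Cν) (8 * Ca * C2), le_max_of_le_left (le_max_left _ _), N0, fun N hN m b hm hmN hb f hf => ?_⟩
  obtain ⟨hNa, hNb, hNc, hNd⟩ := hN0 N hN
  obtain ⟨I, K, hI, hI1, hIX, hI2, hK0, hK1, hK2⟩ := hG N hNd m b hm hmN hb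
  set T : ℝ := (N:ℝ) with hT
  have hT0 : 0 < T := by linarith
  have hT1 : 1 ≤ T := hNc.le
  have hNpos : 0 < N := by
    have : (0:ℝ) < (N:ℝ) := hT0
    exact_mod_cast this
  have hm' : (1:ℝ) ≤ m := by exact_mod_cast hm
  set D : ℕ := ⌊T ^ η⌋₊ with hD
  have hTη : 1 ≤ T ^ η := Real.one_le_rpow hT1 hη0.le
  have hD1 : 1 ≤ D := Nat.le_floor (by exact_mod_cast hTη)
  have hD1' : (1:ℝ) ≤ D := by exact_mod_cast hD1
  have hDle : (D:ℝ) ≤ T ^ η := Nat.floor_le (by linarith)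
  have hDpow : ∀ k : ℕ, (D:ℝ) ^ k ≤ T ^ (η * k) := by
    intro k
    rw [Real.rpow_mul hT0.le, Real.rpow_natCast]
    gcongr
  have hlogD : η / 2 * Real.log T ≤ Real.log D := by
    rw [← Real.log_rpow hT0]
    apply Real.log_le_log (by positivity)
    have h1 := Nat.lt_floor_add_one (T ^ η)
    have h2 : T ^ η = T ^ (η/2) * T ^ (η/2) := by rw [← Real.rpow_add hT0]; ring_nf
    have h3 : (⌊T ^ η⌋₊:ℝ) = D := rfl
    rw [h3] at h1
    nlinarith
  have hlogT : 0 < Real.log T := Real.log_pos hNc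
  set S : ℕ → ℝ := fun n => SS (PP D m) D (m * n + b) with hSd
  have hS0 : ∀ n, 0 ≤ S n := fun n => SS_nonneg PP_prime hD1' _
  -- majorant
  set ν : ℕ → ℝ := fun n => if n ∈ I then C1 / T * (S n * K n) else 0 with hν
  have hν0 : ∀ n, 0 ≤ ν n := by
    intro n; simp only [hν]; split_ifs
    · have := hS0 n; have := hK0 n; positivity
    · exact le_rfl
  have hmaj : ∀ n, |f n| ≤ ν n := by
    intro n
    by_cases h0 : f n = 0
    · rw [h0, abs_zero]; exact hν0 n
    obtain ⟨h1, h2, h3, h4⟩ := hf n h0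
    have hnI := hI2 n h1 h2
    simp only [hν]; rw [if_pos hnI]
    refine h4.trans ?_
    have hx9 : T ^ (9/10:ℝ) ≤ ((m * n + b : ℕ) : ℝ) := by
      refine (hI1 n hnI).trans ?_
      exact_mod_cast (by nlinarith : n ≤ m * n + b)
    have hprime := hΦ.prime _ h3
    have hSG : S n = GG (PP D m) D := by
      apply SS_eq_GG PP_prime hD1'
      intro q hq hdvd
      have hqp := PP_prime q hq
      have hqx : q = m * n + b := (Nat.prime_dvd_prime_iff_eq hqp hprime).1 hdvd
      have hqD : q ≤ D := by
        have := (Finset.mem_filter.1 hq).1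
        rw [Finset.mem_range] at this; omega
      have h5 : ((m * n + b : ℕ) : ℝ) ≤ D := by rw [← hqx]; exact_mod_cast hqD
      have h6 : T ^ η < T ^ (9/10:ℝ) := Real.rpow_lt_rpow_of_exponent_lt hNc (by linarith)
      linarith
    have hGG := GG_lower D m (by omega)
    rw [← hSG] at hGG
    have hlogx : Real.log (m * n + b) ≤ 2 * Real.log T := by
      have hnN : n < N := Finset.mem_range.1 (hI hnI)
      have h5 : ((m:ℝ) * n + b) ≤ m * T := by
        rw [hT]; exact_mod_cast (by nlinarith : m * n + b ≤ m * N)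
      have h6 : (m:ℝ) * T ≤ T ^ (2:ℝ) := by
        rw [Real.rpow_two, sq]
        gcongr
        refine hmN.trans ?_
        calc T ^ (1/1000:ℝ) ≤ T ^ (1:ℝ) := Real.rpow_le_rpow_of_exponent_le hT1 (by norm_num)
          _ = T := Real.rpow_one T
      rw [← Real.log_rpow hT0]
      apply Real.log_le_log _ (h5.trans h6)
      have : 0 < T ^ (9/10:ℝ) := by positivity
      push_cast at hx9; linarith
    have hdx := hΦ.pos _ (hIX n hnI)
    have hKn := hK1 n hnI h3
    have htot : (0:ℝ) ≤ Nat.totient m / m := by positivity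
    have h7 : (Nat.totient m : ℝ) / m * Real.log (m * n + b) ≤ 8 / η * S n := by
      have h8 : Real.log (m * n + b) ≤ 4 / η * Real.log D := by
        have : 4 / η * (η / 2 * Real.log T) ≤ 4 / η * Real.log D := by gcongr
        have h9 : 4 / η * (η / 2 * Real.log T) = 2 * Real.log T := by field_simp; ring
        linarith
      calc (Nat.totient m : ℝ) / m * Real.log (m * n + b) ≤ (Nat.totient m : ℝ) / m * (4 / η * Real.log D) := by gcongr
        _ = 4 / η * ((Nat.totient m : ℝ) / m * Real.log D) := by ring
        _ ≤ 4 / η * (2 * S n) := by gcongr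
        _ = _ := by ring
    have h10 := hS0 n
    calc (Nat.totient m : ℝ) * Real.log (m * n + b) / (m * T * deriv φ ((m * n + b : ℕ) : ℝ))
        = ((Nat.totient m : ℝ) / m * Real.log (m * n + b)) * (1 / deriv φ ((m * n + b : ℕ) : ℝ)) / T := by
          field_simp
      _ ≤ (8 / η * S n) * (96 * K n) / T := by
          apply div_le_div_of_nonneg_right _ hT0.le
          exact mul_le_mul h7 hKn (by positivity) (by positivity)
      _ = _ := by rw [hC1]; ring
  -- error term
  set Er : ℝ := (D:ℝ) ^ 6 * T ^ (0.94:ℝ) with hEr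
  have hEr1 : Er ≤ T ^ (0.95:ℝ) := by
    have h1 := hDpow 6
    calc Er ≤ T ^ (η * (6:ℕ)) * T ^ (0.94:ℝ) := by rw [hEr]; gcongr
      _ = T ^ (η * (6:ℕ) + 0.94) := by rw [← Real.rpow_add hT0]
      _ ≤ _ := by
        apply Real.rpow_le_rpow_of_exponent_le hT1
        push_cast; linarith
  have hD10 : (D:ℝ) ^ 10 ≤ T ^ (0.95:ℝ) := by
    refine (hDpow 10).trans ?_
    apply Real.rpow_le_rpow_of_exponent_le hT1
    push_cast; linarith
  have h95 : T ^ (0.95:ℝ) ≤ T := by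
    conv_rhs => rw [← Real.rpow_one T]
    exact Real.rpow_le_rpow_of_exponent_le hT1 (by norm_num)
  have hw : ∀ θ : ℝ, ‖∑ n ∈ I, ((S n : ℂ) * ((K n : ℂ) - 1)) * e (n * θ)‖ ≤ Er := by
    intro θ
    have h1 := SS_weighted (P := PP D m) PP_prime hD1' m b I (fun n => ((K n : ℂ) - 1) * e (n * θ)) (T ^ (0.94:ℝ)) (by
      intro θ'
      have h2 := hK2 (θ + θ')
      have h3 : ∑ n ∈ I, (((K n : ℂ) - 1) * e (n * θ)) * e (n * θ') = ∑ n ∈ I, ((K n : ℂ) - 1) * e (n * (θ + θ')) := by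
        apply Finset.sum_congr rfl; intro n _
        rw [mul_assoc, ← e_add]; congr 2; ring
      rw [h3]; exact h2)
    have h4 : ∑ n ∈ I, ((S n : ℂ) * ((K n : ℂ) - 1)) * e (n * θ) =
        ∑ n ∈ I, (SS (PP D m) D (m * n + b) : ℂ) * (((K n : ℂ) - 1) * e (n * θ)) := by
      apply Finset.sum_congr rfl; intro n _
      simp only [hSd]; ring
    rw [h4]; exact h1
  have key : ∀ g : ℕ → ℝ, (∀ n, 0 ≤ g n) → ∀ A B : ℝ, ∑ n ∈ Finset.range N, S n * g n ≤ A →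
      ‖∑ n ∈ I, ((S n : ℂ) * ((K n : ℂ) - 1)) * (g n : ℂ)‖ ≤ B →
      ∑ n ∈ Finset.range N, ν n * g n ≤ C1 / T * (A + B) := by
    intro g hg A B hA hB
    have h1 : ∑ n ∈ Finset.range N, ν n * g n = C1 / T * ∑ n ∈ I, S n * K n * g n := by
      rw [Finset.mul_sum, ← Finset.sum_subset hI]
      · apply Finset.sum_congr rfl; intro n hn
        simp only [hν]; rw [if_pos hn]; ring
      · intro n _ hn
        simp only [hν]; rw [if_neg hn, zero_mul]
    rw [h1]
    have h2 : ∑ n ∈ I, S n * K n * g n = ∑ n ∈ I, S n * g n + ∑ n ∈ I, S n * (K n - 1) * g n := by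
      rw [← Finset.sum_add_distrib]; apply Finset.sum_congr rfl; intro n _; ring
    have h3 : ∑ n ∈ I, S n * g n ≤ A := by
      refine le_trans ?_ hA
      exact Finset.sum_le_sum_of_subset_of_nonneg hI (fun n _ _ => mul_nonneg (hS0 n) (hg n))
    have h4 : ∑ n ∈ I, S n * (K n - 1) * g n ≤ B := by
      refine le_trans ?_ hB
      have : ∑ n ∈ I, ((S n : ℂ) * ((K n : ℂ) - 1)) * (g n : ℂ) = ((∑ n ∈ I, S n * (K n - 1) * g n : ℝ) : ℂ) := by
        push_cast; rfl
      rw [this, Complex.norm_real]; exact le_abs_self _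
    rw [h2]
    gcongr
  have hsumν : ∑ n ∈ Finset.range N, ν n ≤ Cν := by
    have h1 := key (fun _ => 1) (fun _ => zero_le_one) (Cs * T + 2 * (D:ℝ) ^ 10) Er
      (by simpa [hSd] using hsum N m b D hD1) (by simpa [e_zero] using hw 0)
    simp only [mul_one] at h1
    refine h1.trans ?_
    have h2 : Cs * T + 2 * (D:ℝ) ^ 10 + Er ≤ (Cs + 3) * T := by linarith
    calc C1 / T * (Cs * T + 2 * (D:ℝ) ^ 10 + Er) ≤ C1 / T * ((Cs + 3) * T) :=
          mul_le_mul_of_nonneg_left h2 (by positivity)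
      _ = Cν := by rw [hCν]; field_simp
  refine ⟨?_, ?_⟩
  · refine (Finset.sum_le_sum (fun n _ => hmaj n)).trans (hsumν.trans ?_)
    exact le_max_of_le_left (le_max_right _ _)
  · intro δ hδN hδ1 R hR hRf
    have hδ0 : 0 < δ := lt_of_lt_of_le (by positivity) hδN
    obtain ⟨c, hc, h1⟩ := dual_sq N R f ν hmaj (δ/2) (by positivity) hRf
    have hDN : (D:ℝ) ^ (2 * p) ≤ (N:ℝ) := by
      refine (hDpow _).trans ?_
      conv_rhs => rw [← hT, ← Real.rpow_one T]
      apply Real.rpow_le_rpow_of_exponent_le hT1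
      push_cast; nlinarith
    have h2 := hS N m b D hNpos hD1 hDN δ hδ0 hδ1 R hR c hc
    have h3 := expand_sq N R c hc I (fun n => (S n : ℂ) * ((K n : ℂ) - 1)) Er hw
    have h4 := key (fun n => ‖hh N R c n‖ ^ 2) (fun n => by positivity) _ _ h2 h3
    set r : ℝ := (R.card : ℝ) with hr
    have hr0 : 0 ≤ r := by positivity
    have h5 : (δ / 2 * r) ^ 2 ≤ Cν * (C1 / T * (C2 * δ ^ (-ε0) * T * r + r ^ 2 * (1 / (16 * Ca) * δ ^ 2 * T + 2 * (D:ℝ) ^ 10)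
        + r ^ 2 * Er)) := by
      refine h1.trans ?_
      apply mul_le_mul hsumν h4 _ hCν0.le
      exact Finset.sum_nonneg (fun n _ => mul_nonneg (hν0 n) (by positivity))
    have h6 : Ca * ((2 * (D:ℝ) ^ 10 + Er) / T) ≤ δ ^ 2 / 16 := by
      have e1 : (2 * (D:ℝ) ^ 10 + Er) ≤ 3 * T ^ (0.95:ℝ) := by linarith
      have e2 : T ^ (-(1/28):ℝ) ≤ δ ^ 2 := by
        calc T ^ (-(1/28):ℝ) = (T ^ (-(1/56):ℝ)) ^ 2 := by
              rw [← Real.rpow_natCast, ← Real.rpow_mul hT0.le]; norm_num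
          _ ≤ δ ^ 2 := by gcongr
      have e3 : 48 * Ca * T ^ (0.95:ℝ) ≤ δ ^ 2 * T := by
        calc 48 * Ca * T ^ (0.95:ℝ) ≤ T ^ (1/100:ℝ) * T ^ (0.95:ℝ) := by gcongr
          _ = T ^ (0.96:ℝ) := by rw [← Real.rpow_add hT0]; norm_num
          _ ≤ T ^ (-(1/28):ℝ) * T ^ (1:ℝ) := by
              rw [← Real.rpow_add hT0]
              exact Real.rpow_le_rpow_of_exponent_le hT1 (by norm_num)
          _ ≤ δ ^ 2 * T := by rw [Real.rpow_one]; gcongr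
      rw [mul_div_assoc', div_le_div_iff₀ hT0 (by norm_num)]
      nlinarith
    have h7 : Cν * (C1 / T * (C2 * δ ^ (-ε0) * T * r + r ^ 2 * (1 / (16 * Ca) * δ ^ 2 * T + 2 * (D:ℝ) ^ 10)
        + r ^ 2 * Er)) = Ca * C2 * δ ^ (-ε0) * r + r ^ 2 * (δ ^ 2 / 16 + Ca * ((2 * (D:ℝ) ^ 10 + Er) / T)) := by
      have : Cν * C1 = Ca := rfl
      rw [← mul_assoc, mul_div_assoc', this]
      field_simp
      ring
    rw [h7] at h5
    have h8 : r ^ 2 * (δ ^ 2 / 16 + Ca * ((2 * (D:ℝ) ^ 10 + Er) / T)) ≤ r ^ 2 * (δ ^ 2 / 16 + δ ^ 2 / 16) := by gcongr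
    have h9 : r * (r * δ ^ 2) ≤ r * (8 * Ca * C2 * δ ^ (-ε0)) := by nlinarith
    have h10 : δ ^ (-(2 + ε0)) = δ ^ (-ε0) / δ ^ 2 := by
      rw [← Real.rpow_natCast, ← Real.rpow_sub hδ0]; congr 1; push_cast; ring
    have h11 : r ≤ 8 * Ca * C2 * δ ^ (-(2 + ε0)) := by
      rcases hr0.eq_or_lt with h | h
      · rw [← h]; positivity
      · have h12 := le_of_mul_le_mul_left h9 h
        rw [h10, mul_div_assoc', le_div_iff₀ (by positivity)]; exact h12
    refine h11.trans ?_
    gcongr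
    exact le_max_right _ _

end PS

namespace PS

lemma lam_bound {φ : ℝ → ℝ} {P : Set ℕ} {γ η X : ℝ} (hΦ : PhiOK φ P γ η X) (hγ : γ ≤ 1) (hη : 0 < η)
    (τ : ℝ) (hτ : 0 < τ) :
    ∃ C : ℝ, 1 ≤ C ∧ ∀ N m b n : ℕ, 1 ≤ m → b < m → n < N → m * n + b ∈ P →
      |(Nat.totient m : ℝ) * Real.log (m * n + b) / (m * N * deriv φ ((m * n + b : ℕ) : ℝ))|
        ≤ C * ((m:ℝ) * N) ^ (1 - γ + η + τ) / N := by
  set S : ℝ := ∑ k ∈ Finset.range ⌈X⌉₊, |Real.log k / deriv φ (k:ℝ)| with hS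
  have hS0 : 0 ≤ S := Finset.sum_nonneg (fun _ _ => abs_nonneg _)
  refine ⟨1 / τ + S + 1, by have : 0 < 1/τ := by positivity
                            linarith, ?_⟩
  intro N m b n hm hb hn hP
  have hN : (0:ℝ) < N := by exact_mod_cast (by omega : 0 < N)
  have hm0 : (0:ℝ) < m := by exact_mod_cast hm
  have hp := hΦ.prime _ hP
  have hcast : ((m:ℝ) * n + b) = ((m * n + b : ℕ) : ℝ) := by push_cast; rfl
  rw [hcast]
  have hxle : m * n + b ≤ m * N := by nlinarith
  generalize hx : m * n + b = x at *
  have hx1 : (1:ℝ) ≤ x := by exact_mod_cast hp.one_le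
  have hxle' : (x:ℝ) ≤ (m:ℝ) * N := by exact_mod_cast hxle
  have htot : (Nat.totient m : ℝ) / m ≤ 1 := by
    rw [div_le_one hm0]; exact_mod_cast Nat.totient_le m
  have hE : 0 < 1 - γ + η + τ := by linarith
  have hone : (1:ℝ) ≤ ((m:ℝ) * N) ^ (1 - γ + η + τ) :=
    Real.one_le_rpow (hx1.trans hxle') hE.le
  have key : |Real.log x / deriv φ x| ≤ (1 / τ + S + 1) * ((m:ℝ) * N) ^ (1 - γ + η + τ) := by
    by_cases hxX : X ≤ x
    · have hd := hΦ.pos x hxX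
      have hlow := hΦ.low x hxX
      have hl0 : 0 ≤ Real.log x := Real.log_nonneg hx1
      rw [abs_of_nonneg (by positivity)]
      have h1 : Real.log x ≤ (x:ℝ) ^ τ / τ := Real.log_le_rpow_div (by linarith) hτ
      have hx0 : (0:ℝ) < x := by linarith
      have h2 : (deriv φ x)⁻¹ ≤ (x:ℝ) ^ (1 - γ + η) := by
        rw [show 1 - γ + η = -(γ - 1 - η) by ring, Real.rpow_neg hx0.le]
        exact inv_anti₀ (by positivity) hlow
      calc Real.log x / deriv φ x = Real.log x * (deriv φ x)⁻¹ := div_eq_mul_inv _ _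
        _ ≤ ((x:ℝ) ^ τ / τ) * (x:ℝ) ^ (1 - γ + η) := by gcongr
        _ = 1 / τ * (x:ℝ) ^ (1 - γ + η + τ) := by rw [Real.rpow_add hx0 (1-γ+η) τ]; ring
        _ ≤ (1 / τ + S + 1) * ((m:ℝ) * N) ^ (1 - γ + η + τ) := by
            gcongr; linarith
    · have hmem : x ∈ Finset.range ⌈X⌉₊ := by
        rw [Finset.mem_range]; exact Nat.lt_ceil.2 (not_le.1 hxX)
      have h1 : |Real.log x / deriv φ (x:ℝ)| ≤ S :=
        Finset.single_le_sum (f := fun k : ℕ => |Real.log k / deriv φ (k:ℝ)|) (fun _ _ => abs_nonneg _) hmem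
      have : 0 < 1/τ := by positivity
      nlinarith
  have heq : (Nat.totient m : ℝ) * Real.log x / (m * N * deriv φ x) =
      (Nat.totient m : ℝ) / m * (Real.log x / deriv φ x) / N := by
    field_simp
  rw [heq, abs_div, abs_mul, abs_of_pos hN, abs_of_nonneg (by positivity : 0 ≤ (Nat.totient m : ℝ) / m)]
  refine div_le_div_of_nonneg_right ?_ hN.le
  calc (Nat.totient m : ℝ) / m * |Real.log x / deriv φ x| ≤ 1 * |Real.log x / deriv φ x| := by gcongr
    _ ≤ _ := by rw [one_mul]; exact key

lemma lam_bound2 {φ : ℝ → ℝ} {P : Set ℕ} {γ η X : ℝ} (hΦ : PhiOK φ P γ η X) (hγ0 : 0 ≤ γ) (hγ : γ ≤ 1) (hη : 0 < η)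
    (hη1 : η ≤ 1/4) :
    ∃ C : ℝ, 1 ≤ C ∧ ∀ N m b n : ℕ, 1 ≤ m → (m:ℝ) ≤ Real.log N → b < m → n < N → m * n + b ∈ P →
      |(Nat.totient m : ℝ) * Real.log (m * n + b) / (m * N * deriv φ ((m * n + b : ℕ) : ℝ))|
        ≤ C * (N:ℝ) ^ (-γ + 4 * η) := by
  obtain ⟨C, hC, h⟩ := lam_bound hΦ hγ hη η hη
  have hE : 0 < 1 - γ + η + η := by linarith
  have hη' : 1 ≤ 1/η := by rw [le_div_iff₀ hη]; linarith
  have h1 : 1 ≤ (1/η) ^ (1 - γ + η + η) := Real.one_le_rpow hη' hE.le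
  refine ⟨C * (1/η) ^ (1 - γ + η + η), by nlinarith, ?_⟩
  intro N m b n hm hml hb hn hP
  refine (h N m b n hm hb hn hP).trans ?_
  have hN1 : (1:ℝ) ≤ N := by exact_mod_cast (by omega : 1 ≤ N)
  have hN : (0:ℝ) < N := by linarith
  have hlog : Real.log N ≤ (N:ℝ) ^ η / η := Real.log_le_rpow_div hN.le hη
  have hmN : (m:ℝ) * N ≤ 1/η * (N:ℝ) ^ (1 + η) := by
    calc (m:ℝ) * N ≤ (N:ℝ) ^ η / η * N := by gcongr; linarith
      _ = 1/η * (N:ℝ) ^ (1 + η) := by rw [Real.rpow_add hN, Real.rpow_one]; ring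
  have h2 : ((m:ℝ) * N) ^ (1 - γ + η + η) ≤ (1/η) ^ (1 - γ + η + η) * (N:ℝ) ^ (1 - γ + 4 * η) := by
    calc ((m:ℝ) * N) ^ (1 - γ + η + η) ≤ (1/η * (N:ℝ) ^ (1 + η)) ^ (1 - γ + η + η) := by gcongr
      _ = (1/η) ^ (1 - γ + η + η) * (N:ℝ) ^ ((1 + η) * (1 - γ + η + η)) := by
          rw [Real.mul_rpow (by positivity) (by positivity), ← Real.rpow_mul hN.le]
      _ ≤ _ := by
          gcongr
          nlinarith
  rw [div_le_iff₀ hN]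
  calc C * ((m:ℝ) * N) ^ (1 - γ + η + η) ≤ C * ((1/η) ^ (1 - γ + η + η) * (N:ℝ) ^ (1 - γ + 4 * η)) := by gcongr
    _ = C * (1/η) ^ (1 - γ + η + η) * (N:ℝ) ^ (-γ + 4 * η) * N := by
        rw [show 1 - γ + 4 * η = (-γ + 4 * η) + 1 by ring, Real.rpow_add_one hN.ne']; ring

lemma primorial_le_log (N W : ℕ) (hN : 2 ≤ N) (hW : (W : ℝ) ≤ (1 / 2 : ℝ) * Real.log (Real.log N)) :
    (primorial W : ℝ) ≤ Real.log N := by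
  have hN1 : (1:ℝ) < N := by exact_mod_cast hN
  have hl : 0 < Real.log N := Real.log_pos hN1
  have hll : 0 ≤ Real.log (Real.log N) := by
    have : (0:ℝ) ≤ W := Nat.cast_nonneg _
    linarith
  have h2 : Real.log 2 ≤ 1 := by have := Real.log_two_lt_d9; linarith
  have h20 : 0 < Real.log 2 := Real.log_pos (by norm_num)
  calc (primorial W : ℝ) ≤ (4:ℝ) ^ W := by exact_mod_cast primorial_le_four_pow W
    _ = Real.exp (2 * Real.log 2 * W) := by
        rw [show (4:ℝ) = 2 ^ 2 by norm_num, ← pow_mul]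
        conv_lhs => rw [← Real.exp_log (show (0:ℝ) < 2 by norm_num)]
        rw [← Real.exp_nat_mul]; push_cast; congr 1; ring
    _ ≤ Real.exp (Real.log (Real.log N)) := by
        apply Real.exp_le_exp.2
        nlinarith
    _ = Real.log N := Real.exp_log hl

end PS

namespace PS

lemma norm_fourier_le (N : ℕ) (f : ℕ → ℝ) (ξ : ℕ) : ‖fourierZN N f ξ‖ ≤ ∑ n ∈ Finset.range N, |f n| := by
  unfold fourierZN
  refine (norm_sum_le _ _).trans (Finset.sum_le_sum fun n _ => ?_)
  rw [norm_mul, norm_e, mul_one, Complex.norm_real, Real.norm_eq_abs]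

lemma fourier_add (N : ℕ) (f g h : ℕ → ℝ) (hfg : ∀ n, f n = g n + h n) (ξ : ℕ) :
    fourierZN N f ξ = fourierZN N g ξ + fourierZN N h ξ := by
  unfold fourierZN
  rw [← Finset.sum_add_distrib]
  apply Finset.sum_congr rfl; intro n _
  rw [hfg]; push_cast; ring

lemma ev_large (X K : ℝ) : ∃ N1 : ℕ, ∀ N : ℕ, N1 ≤ N →
    Real.log N ≤ (N:ℝ) ^ (1/1000:ℝ) ∧ X ≤ 2 * (N:ℝ) ^ (9/10:ℝ) ∧ 8 * K ≤ (N:ℝ) ^ (1/100:ℝ) ∧ 2 ≤ N := by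
  have h1 : ∀ᶠ x : ℝ in atTop, Real.log x ≤ x ^ (1/1000:ℝ) := by
    have := (isLittleO_log_rpow_atTop (show (0:ℝ) < 1/1000 by norm_num)).bound (show (0:ℝ) < 1 by norm_num)
    filter_upwards [this, eventually_ge_atTop 1] with x hx hx1
    rw [one_mul, Real.norm_eq_abs, Real.norm_eq_abs, abs_of_nonneg (Real.rpow_nonneg (by linarith) _)] at hx
    exact (le_abs_self _).trans hx
  have h2 : ∀ᶠ x : ℝ in atTop, X / 2 ≤ x ^ (9/10:ℝ) :=
    (tendsto_rpow_atTop (by norm_num)).eventually_ge_atTop _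
  have h3 : ∀ᶠ x : ℝ in atTop, 8 * K ≤ x ^ (1/100:ℝ) :=
    (tendsto_rpow_atTop (by norm_num)).eventually_ge_atTop _
  have h4 := tendsto_natCast_atTop_atTop (R := ℝ) |>.eventually (h1.and (h2.and h3))
  obtain ⟨N1, hN1⟩ := (h4.and (eventually_ge_atTop 2)).exists_forall_of_atTop
  refine ⟨N1, fun N hN => ?_⟩
  obtain ⟨⟨a, b, c⟩, d⟩ := hN1 N hN
  exact ⟨a, by linarith, c, d⟩

set_option maxHeartbeats 1000000 in
lemma strong_main {φ : ℝ → ℝ} {P : Set ℕ} {γ X : ℝ} (hΦ : PhiOK φ P γ (1/10000) X) (hγ1 : 71/72 < γ) (hγ : γ ≤ 1)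
    (r κ K : ℝ) (hr : 2 + 56 * (1 - γ) + 112 * κ < r) (hκ0 : 0 < κ) (hκ : κ ≤ 1/1000) (hK : 1 ≤ K) :
    ∃ C : ℝ, 1 ≤ C ∧ ∀ N m b : ℕ, 2 ≤ N → 1 ≤ m → (m:ℝ) ≤ Real.log N → b < m → ∀ a : ℕ → ℝ,
      (∀ n, a n ≠ 0 → n ≤ N / 2 ∧ m * n + b ∈ P ∧
        a n = (Nat.totient m : ℝ) * Real.log (m * n + b) / (m * N * deriv φ ((m * n + b : ℕ) : ℝ))) →
      (∀ n, |a n| ≤ K * (N:ℝ) ^ (-γ + κ)) →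
      ∑ ξ ∈ Finset.range N, ‖fourierZN N a ξ‖ ^ r ≤ C := by
  set s : ℝ := 2 + 56 * (1 - γ) + 56 * κ with hs
  have hs2 : 2 < s := by linarith
  obtain ⟨C, hC1, N0, hweak⟩ := weak_ii hΦ hγ1 hγ (s - 2) (by linarith)
  obtain ⟨N1, hN1⟩ := ev_large X K
  set N2 : ℕ := max N0 N1 with hN2
  set M : ℝ := C + 1 + K * N2 with hM
  have hM1 : 1 ≤ M := by have : 0 ≤ K * N2 := by positivity
                         linarith
  have hMs : 1 ≤ M ^ s := Real.one_le_rpow hM1 (by linarith)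
  set C' : ℝ := C * M ^ s + N2 * M ^ s + K * M with hC'
  obtain ⟨C3, hC3⟩ := strong_of_weak s r C' M (by linarith) (by linarith) (by positivity) (by positivity)
  refine ⟨max 1 C3, le_max_left _ _, ?_⟩
  intro N m b hN hm hml hb a ha haK
  refine (hC3 N (fun ξ => ‖fourierZN N a ξ‖) ?_ ?_).trans (le_max_right _ _)
  all_goals
    have hNr : (2:ℝ) ≤ N := by exact_mod_cast hN
    have hNpos : (0:ℝ) < N := by linarith
    have hNone : (1:ℝ) ≤ N := by linarith
    -- L1 bound
    have hbig : N2 ≤ N → ∃ f : ℕ → ℝ, (∑ n ∈ Finset.range N, |f n| ≤ C) ∧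
        (∑ n ∈ Finset.range N, |a n - f n| ≤ (N:ℝ) ^ (-(1/56):ℝ) / 2) ∧
        ∀ δ : ℝ, (N:ℝ) ^ (-(1/56):ℝ) ≤ δ → δ ≤ 1 → ∀ R ⊆ Finset.range N,
          (∀ ξ ∈ R, δ / 2 ≤ ‖fourierZN N f ξ‖) → (R.card : ℝ) ≤ C * δ ^ (-s) := by
      intro hN2N
      obtain ⟨g1, g2, g3, _⟩ := hN1 N ((le_max_right _ _).trans hN2N)
      set f : ℕ → ℝ := fun n => if 2 * (N:ℝ) ^ (9/10:ℝ) ≤ n then a n else 0 with hf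
      have hw := hweak N ((le_max_left _ _).trans hN2N) m b hm (hml.trans g1) hb f (by
        intro n hn
        by_cases hc : 2 * (N:ℝ) ^ (9/10:ℝ) ≤ n
        · have hfa : f n = a n := if_pos hc
          rw [hfa] at hn ⊢
          obtain ⟨k1, k2, k3⟩ := ha n hn
          refine ⟨hc, ?_, k2, ?_⟩
          · exact k1
          · rw [k3]
            apply le_of_eq; apply abs_of_nonneg
            have hx : X ≤ ((m * n + b : ℕ) : ℝ) := by
              have : (n:ℝ) ≤ ((m * n + b : ℕ) : ℝ) := by
                exact_mod_cast (by nlinarith : n ≤ m * n + b)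
              linarith
            have hd := hΦ.pos _ hx
            have hl : 0 ≤ Real.log ((m:ℝ) * n + b) := by
              apply Real.log_nonneg
              have := hΦ.one_le.trans hx
              push_cast at this; exact this
            positivity
        · exact absurd (if_neg hc) hn)
      refine ⟨f, hw.1, ?_, ?_⟩
      · have hsub : ∑ n ∈ Finset.range N, |a n - f n| ≤
            ∑ n ∈ (Finset.range N).filter (fun n : ℕ => (n:ℝ) < 2 * (N:ℝ) ^ (9/10:ℝ)), K * (N:ℝ) ^ (-γ + κ) := by
          rw [Finset.sum_filter]
          apply Finset.sum_le_sum; intro n _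
          by_cases hc : 2 * (N:ℝ) ^ (9/10:ℝ) ≤ n
          · rw [if_neg (not_lt.2 hc)]; simp [hf, hc]
          · rw [if_pos (not_le.1 hc)]; simp only [hf, if_neg hc, sub_zero]; exact haK n
        refine hsub.trans ?_
        rw [Finset.sum_const, nsmul_eq_mul]
        have hN9 : (1:ℝ) ≤ (N:ℝ) ^ (9/10:ℝ) := Real.one_le_rpow hNone (by norm_num)
        have hcard : (((Finset.range N).filter (fun n : ℕ => (n:ℝ) < 2 * (N:ℝ) ^ (9/10:ℝ))).card : ℝ)
            ≤ 4 * (N:ℝ) ^ (9/10:ℝ) := by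
          have h1 : (Finset.range N).filter (fun n : ℕ => (n:ℝ) < 2 * (N:ℝ) ^ (9/10:ℝ)) ⊆
              Finset.range ⌈2 * (N:ℝ) ^ (9/10:ℝ)⌉₊ := by
            intro n hn
            rw [Finset.mem_filter] at hn
            rw [Finset.mem_range]; exact Nat.lt_ceil.2 hn.2
          have h2 := Finset.card_le_card h1
          rw [Finset.card_range] at h2
          have h3 : ((⌈2 * (N:ℝ) ^ (9/10:ℝ)⌉₊ : ℕ) : ℝ) < 2 * (N:ℝ) ^ (9/10:ℝ) + 1 :=
            Nat.ceil_lt_add_one (by positivity)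
          have h4 : (((Finset.range N).filter (fun n : ℕ => (n:ℝ) < 2 * (N:ℝ) ^ (9/10:ℝ))).card : ℝ) ≤
            ((⌈2 * (N:ℝ) ^ (9/10:ℝ)⌉₊ : ℕ) : ℝ) := by exact_mod_cast h2
          linarith
        calc _ ≤ 4 * (N:ℝ) ^ (9/10:ℝ) * (K * (N:ℝ) ^ (-γ + κ)) := by gcongr
          _ = (8 * K) * ((N:ℝ) ^ (9/10:ℝ) * (N:ℝ) ^ (-γ + κ)) / 2 := by ring
          _ ≤ (N:ℝ) ^ (1/100:ℝ) * ((N:ℝ) ^ (9/10:ℝ) * (N:ℝ) ^ (-γ + κ)) / 2 := by gcongr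
          _ = (N:ℝ) ^ (1/100 + (9/10 + (-γ + κ)):ℝ) / 2 := by
              rw [Real.rpow_add hNpos (1/100), Real.rpow_add hNpos (9/10)]
          _ ≤ (N:ℝ) ^ (-(1/56):ℝ) / 2 := by
              have : (N:ℝ) ^ (1/100 + (9/10 + (-γ + κ)):ℝ) ≤ (N:ℝ) ^ (-(1/56):ℝ) :=
                Real.rpow_le_rpow_of_exponent_le hNone (by linarith)
              linarith
      · intro δ h1 h2 R hR h3
        have := hw.2 δ h1 h2 R hR h3
        rwa [show -(2 + (s - 2)) = -s by ring] at this
    have hL1 : ∑ n ∈ Finset.range N, |a n| ≤ M := by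
      by_cases hc : N2 ≤ N
      · obtain ⟨f, h1, h2, _⟩ := hbig hc
        have h3 : ∑ n ∈ Finset.range N, |a n| ≤ ∑ n ∈ Finset.range N, |a n - f n| + ∑ n ∈ Finset.range N, |f n| := by
          rw [← Finset.sum_add_distrib]
          apply Finset.sum_le_sum; intro n _
          have := abs_add_le (a n - f n) (f n)
          simpa using this
        have h4 : (N:ℝ) ^ (-(1/56):ℝ) ≤ 1 := Real.rpow_le_one_of_one_le_of_nonpos hNone (by norm_num)
        have : 0 ≤ K * N2 := by positivity
        linarith
      · have h1 : ∑ n ∈ Finset.range N, |a n| ≤ ∑ n ∈ Finset.range N, K := by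
          apply Finset.sum_le_sum; intro n _
          refine (haK n).trans ?_
          have : (N:ℝ) ^ (-γ + κ) ≤ 1 := Real.rpow_le_one_of_one_le_of_nonpos hNone (by linarith)
          nlinarith
        rw [Finset.sum_const, nsmul_eq_mul, Finset.card_range] at h1
        have h2 : (N:ℝ) ≤ N2 := by exact_mod_cast (not_le.1 hc).le
        nlinarith
  · intro ξ _
    exact ⟨norm_nonneg _, (norm_fourier_le N a ξ).trans hL1⟩
  · intro δ hδ
    set R := (Finset.range N).filter (fun ξ => δ ≤ ‖fourierZN N a ξ‖) with hR
    have hRs : R ⊆ Finset.range N := Finset.filter_subset _ _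
    have hRδ : ∀ ξ ∈ R, δ ≤ ‖fourierZN N a ξ‖ := fun ξ hξ => (Finset.mem_filter.1 hξ).2
    have hδs : 0 < δ ^ (-s) := by positivity
    have hCM : 0 ≤ C * M ^ s := by positivity
    have hNM : 0 ≤ N2 * M ^ s := by positivity
    have hKM : 0 ≤ K * M := by positivity
    by_cases hδM : M < δ
    · have : R = ∅ := by
        apply Finset.eq_empty_of_forall_notMem
        intro ξ hξ
        have := hRδ ξ hξ
        have := (norm_fourier_le N a ξ).trans hL1
        linarith
      rw [this]; simp only [Finset.card_empty, Nat.cast_zero]; positivity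
    rw [not_lt] at hδM
    have hMδ : 1 ≤ M ^ s * δ ^ (-s) := by
      rw [Real.rpow_neg hδ.le, ← div_eq_mul_inv, one_le_div (by positivity)]
      exact Real.rpow_le_rpow hδ.le hδM (by linarith)
    by_cases hc : N2 ≤ N
    · by_cases hδ1 : δ < (N:ℝ) ^ (-(1/56):ℝ)
      · have h1 := dual_l2 N (by omega) R hRs a δ hδ.le hRδ
        have h2 : ∑ n ∈ Finset.range N, a n ^ 2 ≤ K * (N:ℝ) ^ (-γ + κ) * M := by
          calc ∑ n ∈ Finset.range N, a n ^ 2 ≤ ∑ n ∈ Finset.range N, K * (N:ℝ) ^ (-γ + κ) * |a n| := by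
                apply Finset.sum_le_sum; intro n _
                rw [← sq_abs, sq]
                exact mul_le_mul_of_nonneg_right (haK n) (abs_nonneg _)
            _ = K * (N:ℝ) ^ (-γ + κ) * ∑ n ∈ Finset.range N, |a n| := by rw [Finset.mul_sum]
            _ ≤ _ := by gcongr
        have h3 : (N:ℝ) ^ (1 - γ + κ) ≤ δ ^ (-(56 * (1 - γ + κ))) := by
          have h4 : δ ^ (-(56 * (1 - γ + κ))) ≥ ((N:ℝ) ^ (-(1/56):ℝ)) ^ (-(56 * (1 - γ + κ))) :=
            Real.rpow_le_rpow_of_nonpos hδ hδ1.le (by linarith)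
          rw [← Real.rpow_mul hNpos.le] at h4
          have h5 : (-(1/56):ℝ) * (-(56 * (1 - γ + κ))) = 1 - γ + κ := by ring
          rw [h5] at h4; exact h4
        have h6 : δ ^ 2 * (R.card:ℝ) ≤ K * M * δ ^ (-(56 * (1 - γ + κ))) := by
          calc δ ^ 2 * (R.card:ℝ) ≤ N * (K * (N:ℝ) ^ (-γ + κ) * M) := h1.trans (by gcongr)
            _ = K * M * (N:ℝ) ^ (1 - γ + κ) := by
                rw [show 1 - γ + κ = (-γ + κ) + 1 by ring, Real.rpow_add_one hNpos.ne']; ring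
            _ ≤ _ := by gcongr
        have h7 : δ ^ (-s) = δ ^ (-(56 * (1 - γ + κ))) / δ ^ 2 := by
          rw [← Real.rpow_natCast, ← Real.rpow_sub hδ]; congr 1; push_cast; rw [hs]; ring
        have h8 : (R.card:ℝ) ≤ K * M * δ ^ (-s) := by
          rw [h7, mul_div_assoc', le_div_iff₀ (by positivity)]; linarith
        refine h8.trans ?_
        apply mul_le_mul_of_nonneg_right _ hδs.le
        linarith
      · rw [not_lt] at hδ1
        obtain ⟨f, h1, h2, h3⟩ := hbig hc
        have hfour : ∀ ξ, ‖fourierZN N a ξ‖ ≤ ‖fourierZN N f ξ‖ + (N:ℝ) ^ (-(1/56):ℝ) / 2 := by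
          intro ξ
          rw [fourier_add N a f (fun n => a n - f n) (fun n => by ring) ξ]
          refine (norm_add_le _ _).trans ?_
          have := (norm_fourier_le N (fun n => a n - f n) ξ).trans h2
          linarith
        have hCC : C * 1 ≤ C * M ^ s := by gcongr
        by_cases hδ2 : δ ≤ 1
        · have h4 := h3 δ hδ1 hδ2 R hRs (by
            intro ξ hξ
            have := hRδ ξ hξ
            have := hfour ξ
            linarith)
          refine h4.trans ?_
          apply mul_le_mul_of_nonneg_right _ hδs.le
          linarith
        · have h4 := h3 1 (Real.rpow_le_one_of_one_le_of_nonpos hNone (by norm_num)) le_rfl R hRs (by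
            intro ξ hξ
            have := hRδ ξ hξ
            have := hfour ξ
            have : (N:ℝ) ^ (-(1/56):ℝ) ≤ 1 := Real.rpow_le_one_of_one_le_of_nonpos hNone (by norm_num)
            linarith)
          rw [Real.one_rpow, mul_one] at h4
          calc (R.card:ℝ) ≤ C * 1 := by linarith
            _ ≤ C * (M ^ s * δ ^ (-s)) := by gcongr
            _ = (C * M ^ s) * δ ^ (-s) := by ring
            _ ≤ _ := by
              apply mul_le_mul_of_nonneg_right _ hδs.le
              linarith
    · have h1 : R.card ≤ N2 := by
        have := Finset.card_le_card hRs
        rw [Finset.card_range] at this; omega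
      calc (R.card:ℝ) ≤ N2 * 1 := by rw [mul_one]; exact_mod_cast h1
        _ ≤ N2 * (M ^ s * δ ^ (-s)) := by gcongr
        _ = (N2 * M ^ s) * δ ^ (-s) := by ring
        _ ≤ _ := by
              apply mul_le_mul_of_nonneg_right _ hδs.le
              linarith

end PS

/-- **Lemma 5.6 of the paper.** If `A` has no nontrivial three-term AP in `ℤ_N`, then
for any `r ∈ ((26-24γ)/(16γ-15), 3)` with conjugate exponent `r'`, there is `C₁ > 0`
with `Λ₃(a₁, a₁, a₁) ≤ C₁ N^{-3/2} + C₁ N^{-1}(ε² δ^{-r} + δ^{2 - r/r'})`, where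
`a₁ = a * β * β` is the smoothing of `a = 1_A λ^h_{b,m,N}` over the Bohr set of level `δ`. -/
theorem trilinear_form_upper_bound (γ : ℝ) (hγ₁ : 71 / 72 < γ) (hγ₂ : γ ≤ 1)
    {c : ℝ} (hc : c = 1 / γ) (F : Fc c)
    (φ : ℝ → ℝ) (hφ₁ : ∀ x ≥ F.x₀, φ (F.toFun x) = x)
    (hφ₂ : ∀ y ≥ F.toFun F.x₀, F.toFun (φ y) = y)
    (hφ₃ : ∀ y ≥ F.toFun F.x₀, F.x₀ ≤ φ y)
    (r r' : ℝ) (hr₁ : (26 - 24 * γ) / (16 * γ - 15) < r) (hr₂ : r < 3)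
    (hr' : 1 / r + 1 / r' = 1) :
    ∃ C₁ > 0, ∀ N : ℕ, N.Prime →
      ∀ W : ℕ, (1 / 8 : ℝ) * Real.log (Real.log N) ≤ W →
        (W : ℝ) ≤ (1 / 2 : ℝ) * Real.log (Real.log N) →
      ∀ b : ℕ, b ≤ primorial W - 1 → Nat.gcd b (primorial W) = 1 →
      ∀ A : Finset ℕ, A ⊆ Finset.Icc 1 (N / 2) →
      (¬ ∃ a ∈ A, ∃ d : ℕ, d < N ∧ d ≠ 0 ∧ (a + d) % N ∈ A ∧ (a + 2 * d) % N ∈ A) →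
      ∀ δ ε : ℝ, δ ∈ Set.Ioo (0 : ℝ) 1 → ε ∈ Set.Ioo (0 : ℝ) 1 →
      ∀ a : ℕ → ℝ, (∀ n, a n = if n ∈ A then lamh F φ b (primorial W) N n else 0) →
      ∀ R : Finset ℕ, R = (Finset.range N).filter (fun ξ => δ ≤ ‖fourierZN N a ξ‖) →
      ∀ B : Finset ℕ,
        B = (Finset.range N).filter (fun x : ℕ => ∀ ξ ∈ R, nint ((x : ℝ) * ξ / N) ≤ ε) →
      ∀ β : ℕ → ℝ, (∀ n, β n = if n ∈ B then ((B.card : ℝ))⁻¹ else 0) →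
      ∀ a₁ : ℕ → ℝ, (∀ n, a₁ n = convZN N (convZN N a β) β n) →
      lam3 N a₁ a₁ a₁ ≤ C₁ * (N : ℝ) ^ (-(3 : ℝ) / 2)
        + C₁ * (N : ℝ)⁻¹ * (ε ^ 2 * δ ^ (-r) + δ ^ (2 - r / r')) := by
  have hu : 0 < 16 * γ - 15 := by linarith
  have hr2' : 2 + 56 * (1 - γ) < r := by
    refine lt_of_le_of_lt ?_ hr₁
    rw [le_div_iff₀ hu]
    nlinarith [sq_nonneg (1 - γ)]
  have hr2 : 2 < r := by linarith
  set κ : ℝ := min (1/1000) ((r - 2 - 56 * (1 - γ)) / 200) with hκ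
  have hκ0 : 0 < κ := lt_min (by norm_num) (by linarith)
  have hκ1 : κ ≤ 1/1000 := min_le_left _ _
  have hκ2 : κ ≤ (r - 2 - 56 * (1 - γ)) / 200 := min_le_right _ _
  obtain ⟨X, hX⟩ := PS.phi_ok F φ hφ₁ hφ₂ hφ₃ γ (by linarith) hγ₂ hc (1/10000) (by norm_num) (by norm_num)
  obtain ⟨X', hX'⟩ := PS.phi_ok F φ hφ₁ hφ₂ hφ₃ γ (by linarith) hγ₂ hc (κ/4) (by linarith) (by linarith)
  obtain ⟨K, hK1, hK⟩ := PS.lam_bound2 hX' (by linarith) hγ₂ (by linarith) (by linarith)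
  obtain ⟨C, hC1, hC⟩ := PS.strong_main hX hγ₁ hγ₂ r κ K (by linarith) hκ0 hκ1 hK1
  refine ⟨K ^ 3 + 240 * C ^ 4 + 4 * C, by positivity, ?_⟩
  intro N hN W hW1 hW2 b hb hgcd A hA hAP δ ε hδ hε a ha R hR B hB β hβ a₁ ha₁
  have hN2 : 2 ≤ N := hN.two_le
  have hNr : (2:ℝ) ≤ N := by exact_mod_cast hN2
  have hNpos : (0:ℝ) < N := by linarith
  have hml := PS.primorial_le_log N W hN2 hW2
  have hm1 : 1 ≤ primorial W := primorial_pos W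
  have hbm : b < primorial W := by omega
  have hNne : N ≠ 2 := by
    rintro rfl
    have h1 : (1:ℝ) ≤ (primorial W : ℝ) := by exact_mod_cast hm1
    have h2 := Real.log_two_lt_d9
    push_cast at hml
    linarith
  have ha' : ∀ n, a n ≠ 0 → n ∈ A ∧ n ≤ N / 2 ∧ primorial W * n + b ∈ Ph F ∧
      a n = (Nat.totient (primorial W) : ℝ) * Real.log ((primorial W : ℝ) * n + b) /
        ((primorial W : ℝ) * N * deriv φ ((primorial W * n + b : ℕ) : ℝ)) := by
    intro n hn
    rw [ha n] at hn ⊢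
    by_cases hnA : n ∈ A
    · rw [if_pos hnA] at hn ⊢
      unfold lamh at hn ⊢
      by_cases hc : n ≤ N ∧ primorial W * n + b ∈ Ph F
      · rw [if_pos hc]
        exact ⟨hnA, (Finset.mem_Icc.1 (hA hnA)).2, hc.2, rfl⟩
      · rw [if_neg hc] at hn; exact absurd rfl hn
    · rw [if_neg hnA] at hn; exact absurd rfl hn
  have haK : ∀ n, |a n| ≤ K * (N:ℝ) ^ (-γ + κ) := by
    intro n
    by_cases hn : a n = 0
    · rw [hn, abs_zero]; positivity
    · obtain ⟨_, h1, h2, h3⟩ := ha' n hn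
      have h4 := hK N (primorial W) b n hm1 hml hbm (by omega) h2
      rw [h3]
      rwa [show 4 * (κ / 4) = κ by ring] at h4
  have hF := hC N (primorial W) b hN2 hm1 hml hbm a (fun n hn => (ha' n hn).2) haK
  have hred := PS.reduction N hN hNne r C (K * (N:ℝ) ^ (-γ + κ)) hr2 hr₂ hC1 (by positivity) A hAP δ ε hδ hε a
    (fun n hn => by rw [ha n, if_neg hn]) (fun n _ => haK n) hF R hR B hB β hβ a₁ ha₁
  refine hred.trans ?_
  have hδ0 : 0 < δ := hδ.1
  have hε0 : 0 < ε := hε.1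
  have hrr : 2 - r / r' = 3 - r := by
    have h1 : 1 / r' = 1 - 1 / r := by linarith
    have h2 : r / r' = r * (1 / r') := by ring
    rw [h2, h1]
    have : r ≠ 0 := by linarith
    field_simp; ring
  rw [hrr]
  have hfirst : (N:ℝ) * (K * (N:ℝ) ^ (-γ + κ)) ^ 3 ≤ (K ^ 3 + 240 * C ^ 4 + 4 * C) * (N:ℝ) ^ (-(3:ℝ) / 2) := by
    have h1 : (N:ℝ) * (K * (N:ℝ) ^ (-γ + κ)) ^ 3 = K ^ 3 * (N:ℝ) ^ ((-γ + κ) * 3 + 1) := by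
      rw [Real.rpow_add_one hNpos.ne', Real.rpow_mul hNpos.le, mul_pow]
      norm_cast; ring
    rw [h1]
    have h2 : (N:ℝ) ^ ((-γ + κ) * 3 + 1) ≤ (N:ℝ) ^ (-(3:ℝ) / 2) :=
      Real.rpow_le_rpow_of_exponent_le (by linarith) (by linarith)
    have h3 : 0 ≤ 240 * C ^ 4 + 4 * C := by positivity
    apply mul_le_mul _ h2 (by positivity) (by positivity)
    linarith
  refine add_le_add hfirst ?_
  rw [mul_assoc (K ^ 3 + 240 * C ^ 4 + 4 * C), mul_left_comm (K ^ 3 + 240 * C ^ 4 + 4 * C)]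
  apply mul_le_mul_of_nonneg_left _ (by positivity)
  rw [mul_add]
  have hK3 : 0 ≤ K ^ 3 := by positivity
  have hC4 : 0 ≤ C ^ 4 := by positivity
  apply add_le_add
  · apply mul_le_mul_of_nonneg_right _ (by positivity)
    linarith
  · apply mul_le_mul_of_nonneg_right _ (by positivity)
    linarith
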